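/- arXiv:2012.10624 — 2 statements merged into one kernel-verified Lean document; each statement's English description precedes it below -/
import Mathlib

section
/- Let k ≥ 2 be an integer. If G is a finite simple graph with chromatic number k+1, then G contains cycles of at least ⌊k/2⌋ distinct odd lengths; that is, there exist ⌊k/2⌋ pairwise distinct odd integers each of which is the length of some cycle in G. -/
/-- `G` contains a cycle of length `n`. -/
def HasCycleLength {V : Type*} (G : SimpleGraph V) (n : ℕ) : Prop :=
  ∃ (u : V) (c : G.Walk u u), c.IsCycle ∧ c.length = n

lemma path_of_list {V : Type*} (G : SimpleGraph V) (a : V) (l₂ : List V) (l : List V) :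
    ∀ s : V, (s :: (l ++ a :: l₂)).IsChain G.Adj → (s :: (l ++ a :: l₂)).Nodup →
    ∃ w : G.Walk s a, w.IsPath ∧ w.length = l.length + 1 ∧ w.support = s :: (l ++ [a]) := by
  induction l with
  | nil =>
    intro s h hn
    have h1 : G.Adj s a := by simp at h; exact h.1
    refine ⟨.cons h1 .nil, ?_, by simp, by simp⟩
    simpa using h1.ne
  | cons b l ih =>
    intro s h hn
    simp only [List.cons_append, List.isChain_cons_cons] at h
    rw [List.cons_append, List.nodup_cons] at hn
    obtain ⟨w, hw, hl, hs⟩ := ih b h.2 hn.2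
    refine ⟨.cons h.1 w, ?_, by simp [hl], by simp [hs]⟩
    rw [SimpleGraph.Walk.cons_isPath_iff]
    refine ⟨hw, ?_⟩
    rw [hs]
    have := hn.1
    simp at this ⊢
    tauto

lemma cycle_of_list {V : Type*} (G : SimpleGraph V) (a s : V) (l l₂ : List V) (hl : l ≠ [])
    (h : (s :: (l ++ a :: l₂)).IsChain G.Adj) (hn : (s :: (l ++ a :: l₂)).Nodup)
    (hadj : G.Adj s a) : HasCycleLength G (l.length + 2) := by
  obtain ⟨b, l, rfl⟩ := List.exists_cons_of_ne_nil hl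
  simp only [List.cons_append, List.isChain_cons_cons] at h
  rw [List.cons_append, List.nodup_cons] at hn
  obtain ⟨w, hw, hl, hs⟩ := path_of_list G a l₂ l b h.2 hn.2
  have hsw : s ∉ w.support := by
    rw [hs]
    have := hn.1
    simp at this ⊢
    tauto
  refine ⟨a, .cons hadj.symm (.cons h.1 w), ?_, by simp [hl]⟩
  rw [SimpleGraph.Walk.cons_isCycle_iff, SimpleGraph.Walk.cons_isPath_iff]
  refine ⟨⟨hw, hsw⟩, ?_⟩
  rw [SimpleGraph.Walk.edges_cons, List.mem_cons, not_or]
  constructor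
  · intro he
    have hab : a = b := by
      have := hadj.ne
      simp at he
      grind
    have := hn.2
    simp [hab] at this
  · intro he
    exact hsw (w.snd_mem_support_of_mem_edges he)

lemma odd_of_bodd (a b : ℕ) (h : b.bodd = (a + (b + 1)).bodd) : Odd a := by
  rw [Nat.bodd_add, Nat.bodd_add] at h
  rw [Nat.odd_iff, Nat.mod_two_of_bodd]
  revert h
  cases a.bodd <;> cases b.bodd <;> decide

set_option maxHeartbeats 1000000 in
open Classical in
lemma dfs_color {V : Type*} [Fintype V] (G : SimpleGraph V) (M : ℕ)
    (hM : ((Finset.range (Fintype.card V + 2)).filter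
      (fun n => Odd n ∧ HasCycleLength G n)).card < M) (n : ℕ) :
    ∀ (S : Finset V) (p : List V) (c : V → Bool × Fin M), S.card ≤ n →
      p.IsChain G.Adj → p.Nodup → (∀ x ∈ p, x ∉ S) →
      (∀ l₁ a l₂, p = l₁ ++ a :: l₂ → (c a).1 = l₂.length.bodd) →
      (∀ x ∈ S, ∃ s ∈ S, (∀ v ∈ p.head?, G.Adj s v) ∧
        Relation.ReflTransGen (fun a b => G.Adj a b ∧ b ∈ S) s x) →
      ∃ c' : V → Bool × Fin M, (∀ x, x ∉ S → c' x = c x) ∧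
        ∀ x ∈ S, ∀ y, y ∈ S ∨ y ∈ p → G.Adj x y → c' x ≠ c' y := by
  induction n with
  | zero =>
    intro S p c hS _ _ _ _ _
    have : S = ∅ := by simpa using hS
    subst this
    exact ⟨c, by simp, by simp⟩
  | succ n ih =>
    intro S p c hS hch hnd hdis hpar hreach
    rcases S.eq_empty_or_nonempty with rfl | ⟨x₀, hx₀⟩
    · exact ⟨c, by simp, by simp⟩
    obtain ⟨s, hsS, hsp, -⟩ := hreach x₀ hx₀
    have hsnp : s ∉ p := fun h => hdis s h hsS
    have hch' : (s :: p).IsChain G.Adj := by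
      cases p with
      | nil => simp
      | cons v p => exact List.isChain_cons_cons.2 ⟨hsp v (by simp), hch⟩
    have hnd' : (s :: p).Nodup := List.nodup_cons.2 ⟨hsnp, hnd⟩
    -- the available color
    obtain ⟨col, hcol⟩ : ∃ col : Fin M, ∀ x ∈ p, G.Adj s x → (c x).1 = p.length.bodd →
        (c x).2 ≠ col := by
      let N := p.toFinset.filter (fun x => G.Adj s x ∧ (c x).1 = p.length.bodd)
      have hN : N.card < M := by
        refine lt_of_le_of_lt (Finset.card_le_card_of_injOn (fun x => p.idxOf x + 2) ?_ ?_) hM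
        · intro x hx
          simp only [N, Finset.coe_filter, List.mem_toFinset, Set.mem_ofPred_eq] at hx
          obtain ⟨hxp, hadj, hx1⟩ := hx
          obtain ⟨l₁, l₂, rfl, hxl⟩ := List.append_of_mem hxp |>.elim fun l₁ h => h.elim fun l₂ h =>
            (⟨l₁, l₂, h, by
              subst h
              have := hnd
              simp [List.nodup_append] at this
              grind⟩ : ∃ l₁ l₂, p = l₁ ++ x :: l₂ ∧ x ∉ l₁)
          have hi : (l₁ ++ x :: l₂).idxOf x = l₁.length := by
            simp [List.idxOf_append, hxl]
          have hcard := hnd.length_le_card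
          rw [hpar l₁ x l₂ rfl] at hx1
          simp at hcard
          have hodd : Odd l₁.length := by
            apply odd_of_bodd l₁.length l₂.length
            rw [hx1]
            simp
          simp only [Finset.coe_filter, Finset.mem_range, Set.mem_ofPred_eq, hi]
          refine ⟨by omega, by grind, ?_⟩
          refine cycle_of_list G x s l₁ l₂ ?_ hch' hnd' hadj
          rintro rfl
          simp at hodd
        · intro x hx y hy hxy
          simp only [N, Finset.coe_filter, List.mem_toFinset, Set.mem_ofPred_eq] at hx hy
          exact (List.idxOf_inj hx.1).1 (by simpa using hxy)
      have hF : (N.image (fun x => (c x).2)).card < (Finset.univ : Finset (Fin M)).card := by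
        simpa using lt_of_le_of_lt Finset.card_image_le hN
      obtain ⟨col, -, hc⟩ := Finset.exists_mem_notMem_of_card_lt_card hF
      refine ⟨col, fun x hx ha h1 h2 => hc ?_⟩
      exact Finset.mem_image.2 ⟨x, by simp [N, hx, ha, h1], h2⟩
    let R : V → V → Prop := Relation.ReflTransGen (fun a b => G.Adj a b ∧ b ∈ S)
    let c₁ : V → Bool × Fin M := Function.update c s (p.length.bodd, col)
    let C' := S.filter (fun x => R s x ∧ x ≠ s)
    let D := S.filter (fun x => ¬ R s x)
    have hc₁ : ∀ x, x ≠ s → c₁ x = c x := fun x hx => Function.update_of_ne hx _ _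
    have hc₁s : c₁ s = (p.length.bodd, col) := Function.update_self _ _ _
    have hC'lt : C'.card < S.card := Finset.card_lt_card
      (Finset.filter_ssubset.2 ⟨s, hsS, by simp⟩)
    have hDlt : D.card < S.card := Finset.card_lt_card
      (Finset.filter_ssubset.2 ⟨s, hsS, by simpa using Relation.ReflTransGen.refl⟩)
    have hRC : ∀ x, R s x → Relation.ReflTransGen (fun a b => G.Adj a b ∧ b ∈ C') s x := by
      intro x hx
      induction hx with
      | refl => exact .refl
      | @tail b x hb hx ihx =>
        by_cases hxs : x = s
        · subst hxs; exact .refl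
        · exact ihx.tail ⟨hx.1, Finset.mem_filter.2 ⟨hx.2, hb.tail hx, hxs⟩⟩
    obtain ⟨c₂, h2a, h2b⟩ := ih C' (s :: p) c₁ (by omega) hch' hnd'
      (by
        intro x hx hxC
        rcases List.mem_cons.1 hx with rfl | hx
        · simp [C'] at hxC
        · exact hdis x hx (Finset.mem_filter.1 hxC).1)
      (by
        intro l₁ a l₂ h
        cases l₁ with
        | nil =>
          simp at h
          obtain ⟨rfl, rfl⟩ := h
          simp [hc₁s]
        | cons b l₁ =>
          simp at h
          have ha : a ≠ s := by
            rintro rfl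
            exact hsnp (by simp [h.2])
          rw [hc₁ a ha]
          exact hpar l₁ a l₂ h.2)
      (by
        intro x hx
        have hx' := (Finset.mem_filter.1 hx).2
        rcases Relation.ReflTransGen.cases_head (hRC x hx'.1) with h | ⟨t, ht, h⟩
        · exact absurd h.symm hx'.2
        · exact ⟨t, ht.2, by simpa using ht.1.symm, h⟩)
    have hpC' : ∀ x ∈ p, x ∉ C' := fun x hx h => hdis x hx (Finset.mem_filter.1 h).1
    obtain ⟨c₃, h3a, h3b⟩ := ih D p c₂ (by omega) hch hnd
      (fun x hx h => hdis x hx (Finset.mem_filter.1 h).1)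
      (by
        intro l₁ a l₂ h
        have hap : a ∈ p := by simp [h]
        rw [h2a a (hpC' a hap), hc₁ a (by rintro rfl; exact hsnp hap)]
        exact hpar l₁ a l₂ h)
      (by
        intro x hx
        obtain ⟨hxS, hxR⟩ := Finset.mem_filter.1 hx
        obtain ⟨t, htS, htp, htx⟩ := hreach x hxS
        have htR : ¬ R s t := fun h => hxR (h.trans htx)
        refine ⟨t, Finset.mem_filter.2 ⟨htS, htR⟩, htp, ?_⟩
        clear hx hxS
        induction htx with
        | refl => exact .refl
        | @tail b x hb hx ihx =>
          exact (ihx (fun h => hxR (h.tail hx))).tail ⟨hx.1, Finset.mem_filter.2 ⟨hx.2, hxR⟩⟩)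
    have hadjR : ∀ x y, R s x → G.Adj x y → y ∈ S → R s y := fun x y h ha hy => h.tail ⟨ha, hy⟩
    have hDm : ∀ x, x ∈ D ↔ x ∈ S ∧ ¬ R s x := fun x => by simp [D]
    have hCm : ∀ x, x ∈ C' ↔ x ∈ S ∧ R s x ∧ x ≠ s := fun x => by simp [C']
    have hRs : R s s := .refl
    have hs2 : c₂ s = (p.length.bodd, col) := by rw [h2a s (by simp [C']), hc₁s]
    have hp2 : ∀ x ∈ p, c₂ x = c x := fun x hx => by
      rw [h2a x (hpC' x hx), hc₁ x (by rintro rfl; exact hsnp hx)]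
    have hs_p : ∀ y ∈ p, G.Adj s y → c₂ s ≠ c₂ y := by
      intro y hy ha h
      rw [hs2, hp2 y hy] at h
      exact hcol y hy ha (by rw [← h]) (by rw [← h])
    clear_value R C' D c₁
    refine ⟨c₃, ?_, ?_⟩
    · intro x hx
      have hxs : x ≠ s := by rintro rfl; exact hx hsS
      rw [h3a x (by simp [hDm, hx]), h2a x (by simp [hCm, hx]), hc₁ x hxs]
    · intro x hx y hy ha
      by_cases hxR : R s x
      · have hyD : y ∉ D := by
          rw [hDm]
          rintro ⟨h1, h2⟩
          exact h2 (hadjR x y hxR ha h1)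
        rw [h3a x (by simp [hDm, hxR]), h3a y hyD]
        by_cases hxs : x = s
        · subst hxs
          rcases hy with hy | hy
          · have hyC : y ∈ C' := (hCm y).2 ⟨hy, hadjR x y hxR ha hy, ha.ne'⟩
            exact (h2b y hyC x (by simp) ha.symm).symm
          · exact hs_p y hy ha
        · refine h2b x ((hCm x).2 ⟨hx, hxR, hxs⟩) y ?_ ha
          rcases hy with hy | hy
          · by_cases hys : y = s
            · simp [hys]
            · exact Or.inl ((hCm y).2 ⟨hy, hadjR x y hxR ha hy, hys⟩)
          · simp [hy]
      · refine h3b x ((hDm x).2 ⟨hx, hxR⟩) y ?_ ha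
        rcases hy with hy | hy
        · exact Or.inl ((hDm y).2 ⟨hy, fun h => hxR (hadjR y x h ha.symm hx)⟩)
        · exact Or.inr hy

/-- Gyárfás' theorem: every graph of chromatic number `k + 1` (with `k ≥ 2`) contains cycles of
at least `⌊k / 2⌋` distinct odd lengths. -/
theorem stmt_0 {V : Type*} [Fintype V] (k : ℕ) (hk : 2 ≤ k)
    (G : SimpleGraph V) (hchrom : G.chromaticNumber = k + 1) :
    ∃ L : Finset ℕ, L.card = k / 2 ∧ ∀ n ∈ L, Odd n ∧ HasCycleLength G n := by
  classical
  by_cases hA : ((Finset.range (Fintype.card V + 2)).filter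
      (fun n => Odd n ∧ HasCycleLength G n)).card < k / 2
  · exfalso
    have hpos : 0 < k / 2 := by omega
    obtain ⟨c, -, hc⟩ := dfs_color G (k / 2) (by convert hA) (Fintype.card V) Finset.univ []
      (fun _ => (true, ⟨0, hpos⟩)) (Finset.card_le_univ _) (by simp) (by simp) (by simp) (by simp)
      (fun x _ => ⟨x, Finset.mem_univ _, by simp, .refl⟩)
    let col : G.Coloring (Bool × Fin (k / 2)) :=
      SimpleGraph.Coloring.mk c (fun {x y} h => hc x (Finset.mem_univ _) y (by simp) h)
    have h1 := col.colorable.chromaticNumber_le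
    rw [hchrom] at h1
    simp only [Fintype.card_prod, Fintype.card_bool, Fintype.card_fin] at h1
    have h2 : k + 1 ≤ 2 * (k / 2) := by exact_mod_cast h1
    omega
  · obtain ⟨L, hL, hc⟩ := Finset.exists_subset_card_eq (not_lt.1 hA)
    exact ⟨L, hc, fun n hn => (Finset.mem_filter.1 (hL hn)).2⟩
end

section
/- Let k ≥ 2 be an integer. If G is a finite simple graph with chromatic number k+1, then G contains cycles of ⌊k/2⌋ consecutive odd lengths; that is, there exists a positive integer m such that for every i = 0, 1, …, ⌊k/2⌋−1, G contains a cycle of length 2m+1+2i. -/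
namespace OC
open Set

variable {V : Type*}

/-- `B` is a union of components of `G[X]`. -/
def Cl (G : SimpleGraph V) (X B : Set V) : Prop :=
  B ⊆ X ∧ ∀ u ∈ B, ∀ v ∈ X, G.Adj u v → v ∈ B

def Conn (G : SimpleGraph V) (X : Set V) : Prop :=
  ∀ C, Cl G X C → C.Nonempty → C = X

def K (G : SimpleGraph V) (X : Set V) (a : V) : Set V :=
  {b | b ∈ X ∧ ∀ C, Cl G X C → a ∈ C → b ∈ C}

structure Pth (G : SimpleGraph V) (W : Set V) (a b : V) (l : List V) : Prop where
  chain : l.IsChain G.Adj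
  nodup : l.Nodup
  mem : ∀ v ∈ l, v ∈ W
  head : l.head? = some a
  last : l.getLast? = some b

variable {G : SimpleGraph V}

theorem K_self {X : Set V} {a : V} (ha : a ∈ X) : a ∈ K G X a := ⟨ha, fun _ _ h => h⟩

theorem K_cl (X : Set V) (a : V) : Cl G X (K G X a) :=
  ⟨fun _ h => h.1, fun u hu v hv huv => ⟨hv, fun C hC ha => hC.2 u (hu.2 C hC ha) v hv huv⟩⟩

theorem K_conn {X : Set V} {a : V} (haX : a ∈ X) : Conn G (K G X a) := by
  intro C hC hne
  have hCX : Cl G X C := ⟨fun x hx => (hC.1 hx).1, fun u hu v hv huv =>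
    hC.2 u hu v ((K_cl X a).2 u (hC.1 hu) v hv huv) huv⟩
  apply Subset.antisymm hC.1
  by_cases ha : a ∈ C
  · exact fun x hx => hx.2 C hCX ha
  · obtain ⟨y, hy⟩ := hne
    have : Cl G X (K G X a \ C) := by
      refine ⟨fun x hx => hx.1.1, fun u hu v hv huv =>
        ⟨(K_cl X a).2 u hu.1 v hv huv, fun hvC => hu.2 ?_⟩⟩
      exact hC.2 v hvC u hu.1 huv.symm
    exact absurd hy ((hC.1 hy).2 _ this ⟨K_self haX, ha⟩).2

theorem K_adj {X : Set V} {u v : V} (hu : u ∈ X) (hv : v ∈ X) (h : G.Adj u v) :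
    K G X u = K G X v := by
  apply Subset.antisymm
  · exact fun x hx => hx.2 _ (K_cl X v) ((K_cl X v).2 v (K_self hv) u hu h.symm)
  · exact fun x hx => hx.2 _ (K_cl X u) ((K_cl X u).2 u (K_self hu) v hv h)

theorem Cl.trans {X B C : Set V} (h : Cl G X B) (h' : Cl G B C) : Cl G X C :=
  ⟨h'.1.trans h.1, fun u hu v hv huv => h'.2 u hu v (h.2 u (h'.1 hu) v hv huv) huv⟩

/-- deleting a part attached at one vertex keeps connectivity -/
theorem Conn.del {W B : Set V} {w : V} (hW : Conn G W) (hw : w ∈ W)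
    (hB : Cl G (W \ {w}) B) : Conn G (W \ B) := by
  have hwB : w ∉ B := fun h => (hB.1 h).2 rfl
  intro C hC hne
  by_cases hwC : w ∈ C
  · have : Cl G W (C ∪ B) := by
      refine ⟨union_subset (fun x hx => (hC.1 hx).1) (fun x hx => (hB.1 hx).1), ?_⟩
      rintro u (hu | hu) v hv huv
      · by_cases hvB : v ∈ B
        · exact Or.inr hvB
        · exact Or.inl (hC.2 u hu v ⟨hv, hvB⟩ huv)
      · by_cases hvw : v = w
        · exact Or.inl (hvw ▸ hwC)
        · exact Or.inr (hB.2 u hu v ⟨hv, hvw⟩ huv)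
    have h := hW _ this ⟨w, Or.inl hwC⟩
    apply Subset.antisymm hC.1
    intro x hx
    have : x ∈ C ∪ B := h ▸ hx.1
    exact this.resolve_right hx.2
  · exfalso
    have : Cl G W C := by
      refine ⟨fun x hx => (hC.1 hx).1, fun u hu v hv huv => ?_⟩
      refine hC.2 u hu v ⟨hv, fun hvB => (hC.1 hu).2 ?_⟩ huv
      exact hB.2 v hvB u ⟨(hC.1 hu).1, fun h => hwC (h ▸ hu)⟩ huv.symm
    exact hwC ((hW _ this hne) ▸ hw)

/-- the same with two adjacent vertices -/
theorem Conn.del2 {W B : Set V} {w w' : V} (hW : Conn G W) (hw : w ∈ W) (hw' : w' ∈ W)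
    (hadj : G.Adj w w') (hB : Cl G (W \ {w, w'}) B) : Conn G (W \ B) := by
  have hwB : w ∉ B := fun h => (hB.1 h).2 (by simp)
  have hwB' : w' ∉ B := fun h => (hB.1 h).2 (by simp)
  intro C hC hne
  by_cases hwC : w ∈ C
  · have hwC' : w' ∈ C := hC.2 w hwC w' ⟨hw', hwB'⟩ hadj
    have : Cl G W (C ∪ B) := by
      refine ⟨union_subset (fun x hx => (hC.1 hx).1) (fun x hx => (hB.1 hx).1), ?_⟩
      rintro u (hu | hu) v hv huv
      · by_cases hvB : v ∈ B
        · exact Or.inr hvB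
        · exact Or.inl (hC.2 u hu v ⟨hv, hvB⟩ huv)
      · by_cases hvw : v = w
        · exact Or.inl (hvw ▸ hwC)
        · by_cases hvw' : v = w'
          · exact Or.inl (hvw' ▸ hwC')
          · exact Or.inr (hB.2 u hu v ⟨hv, by simp [hvw, hvw']⟩ huv)
    have h := hW _ this ⟨w, Or.inl hwC⟩
    apply Subset.antisymm hC.1
    intro x hx
    have : x ∈ C ∪ B := h ▸ hx.1
    exact this.resolve_right hx.2
  · exfalso
    have hwC' : w' ∉ C := fun h => hwC (hC.2 w' h w ⟨hw, hwB⟩ hadj.symm)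
    have : Cl G W C := by
      refine ⟨fun x hx => (hC.1 hx).1, fun u hu v hv huv => ?_⟩
      refine hC.2 u hu v ⟨hv, fun hvB => (hC.1 hu).2 ?_⟩ huv
      refine hB.2 v hvB u ⟨(hC.1 hu).1, ?_⟩ huv.symm
      rintro (h | h)
      · exact hwC (h ▸ hu)
      · exact hwC' (h ▸ hu)
    exact hwC ((hW _ this hne) ▸ hw)

/-- adding a vertex adjacent to a connected set -/
theorem Conn.insert {B : Set V} {s x : V} (hB : Conn G B) (hx : x ∈ B) (h : G.Adj x s) :
    Conn G (insert s B) := by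
  by_cases hsB : s ∈ B
  · rwa [Set.insert_eq_of_mem hsB]
  intro C hC hne
  have h1 : Cl G B (C ∩ B) := ⟨inter_subset_right, fun u hu v hv huv =>
    ⟨hC.2 u hu.1 v (Or.inr hv) huv, hv⟩⟩
  have h2 : (C ∩ B).Nonempty := by
    obtain ⟨y, hy⟩ := hne
    rcases hC.1 hy with rfl | hyB
    · exact ⟨x, hC.2 _ hy x (Or.inr hx) h.symm, hx⟩
    · exact ⟨y, hy, hyB⟩
  have h3 := hB _ h1 h2
  have h4 : B ⊆ C := fun z hz => (h3.symm.subset hz).1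
  apply Subset.antisymm hC.1
  rintro z (rfl | hz)
  · exact hC.2 x (h4 hx) z (Or.inl rfl) h
  · exact h4 hz

/-! paths -/

theorem Pth.single {W : Set V} {a : V} (ha : a ∈ W) : Pth G W a a [a] :=
  ⟨by simp, by simp, by simpa, by simp, by simp⟩

theorem Pth.mono {W W' : Set V} {a b : V} {l : List V} (h : Pth G W a b l) (hs : W ⊆ W') :
    Pth G W' a b l := ⟨h.1, h.2, fun v hv => hs (h.3 v hv), h.4, h.5⟩

theorem Pth.reverse {W : Set V} {a b : V} {l : List V} (h : Pth G W a b l) :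
    Pth G W b a l.reverse := by
  refine ⟨?_, List.nodup_reverse.2 h.2, by simpa using h.3, by simpa using h.5, by simpa using h.4⟩
  rw [List.isChain_reverse]
  exact h.1.imp fun _ _ h => h.symm

theorem Pth.append {W W' : Set V} {a b c d : V} {l l' : List V} (h : Pth G W a b l)
    (h' : Pth G W' c d l') (hbc : G.Adj b c) (hd : ∀ v ∈ W, v ∉ W') :
    Pth G (W ∪ W') a d (l ++ l') := by
  have hl : l ≠ [] := by rintro rfl; simpa using h.4
  have hl' : l' ≠ [] := by rintro rfl; simpa using h'.4
  refine ⟨?_, ?_, ?_, ?_, ?_⟩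
  · rw [List.isChain_append]
    refine ⟨h.1, h'.1, ?_⟩
    intro x hx y hy
    rw [h.5] at hx
    rw [h'.4] at hy
    simp at hx hy
    subst hx hy
    exact hbc
  · rw [List.nodup_append']
    exact ⟨h.2, h'.2, fun v hv hv' => hd v (h.3 v hv) (h'.3 v hv')⟩
  · intro v hv
    rcases List.mem_append.1 hv with hv | hv
    · exact Or.inl (h.3 v hv)
    · exact Or.inr (h'.3 v hv)
  · rw [List.head?_append, h.4]; rfl
  · rw [List.getLast?_append, h'.5]; rfl

theorem Pth.cons {W : Set V} {a b s : V} {l : List V} (h : Pth G W a b l)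
    (hs : G.Adj s a) (hsW : s ∉ W) : Pth G (insert s W) s b (s :: l) := by
  have := (Pth.single (G := G) (W := {s}) rfl).append h hs (by simpa using hsW)
  exact this

theorem Pth.head_mem {W : Set V} {a b : V} {l : List V} (h : Pth G W a b l) : a ∈ l :=
  List.mem_of_mem_head? h.4

theorem Pth.last_mem {W : Set V} {a b : V} {l : List V} (h : Pth G W a b l) : b ∈ l :=
  List.mem_of_mem_getLast? h.5

theorem Conn.path {W : Set V} (hW : Conn G W) {a b : V} (ha : a ∈ W) (hb : b ∈ W) :
    ∃ l, Pth G W a b l := by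
  have hC : Cl G W {b | b ∈ W ∧ ∃ l, Pth G W a b l} := by
    refine ⟨fun x hx => hx.1, ?_⟩
    rintro u ⟨hu, l, hl⟩ v hv huv
    refine ⟨hv, ?_⟩
    by_cases hvl : v ∈ l
    · obtain ⟨l1, l2, rfl⟩ := List.append_of_mem hvl
      refine ⟨l1 ++ [v], ?_, ?_, ?_, ?_, by simp⟩
      · exact List.IsChain.left_of_append (l₂ := l2) (by simpa using hl.1)
      · exact List.Nodup.of_append_left (l₂ := l2) (by simpa using hl.2)
      · intro x hx
        exact hl.3 x (by simp at hx ⊢; tauto)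
      · have := hl.4
        cases l1 <;> simpa using this
    · have h1 : Pth G {x | x ∈ l} a u l := ⟨hl.1, hl.2, fun v hv => hv, hl.4, hl.5⟩
      refine ⟨l ++ [v], (h1.append (Pth.single (W := {v}) rfl) huv ?_).mono ?_⟩
      · rintro x hx rfl
        exact hvl hx
      · rintro x (hx | rfl)
        · exact hl.3 x hx
        · exact hv
  have := hW _ hC ⟨a, ha, [a], Pth.single ha⟩
  have hb' : b ∈ {b | b ∈ W ∧ ∃ l, Pth G W a b l} := by rw [this]; exact hb
  exact hb'.2

theorem Pth.lastExit {W : Set V} (Q : V → Prop) {b : V} : ∀ {l : List V} {a : V},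
    Pth G W a b l → Q a → ∃ a' q, Q a' ∧ Pth G W a' b (a' :: q) ∧ ∀ v ∈ q, ¬ Q v := by
  intro l
  induction l with
  | nil => intro a h; simpa using h.4
  | cons x l ih =>
    intro a h ha
    have hx : x = a := by simpa using h.4
    subst hx
    by_cases hq : ∀ v ∈ l, ¬ Q v
    · exact ⟨x, l, ha, h, hq⟩
    push Not at hq
    -- find first: use generic induction through the tail
    cases l with
    | nil => simp at hq
    | cons y l =>
      have hy : Pth G W y b (y :: l) := ⟨h.1.tail, h.2.tail, fun v hv => h.3 v (by simp at hv ⊢; tauto),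
        rfl, by simpa [List.getLast?_cons_cons] using h.5⟩
      by_cases hQy : Q y
      · exact ih hy hQy
      · -- remove the non-Q prefix
        have key : ∀ (l : List V) (y : V), Pth G W y b (y :: l) → (∃ v ∈ y :: l, Q v) →
            ∃ a' q, Q a' ∧ Pth G W a' b (a' :: q) ∧ ∀ v ∈ q, ¬ Q v := by
          intro l
          induction l with
          | nil =>
            intro y hy hv
            exact ⟨y, [], by simpa using hv, hy, by simp⟩
          | cons z l ih2 =>
            intro y hy hv
            have hz : Pth G W z b (z :: l) := ⟨hy.1.tail, hy.2.tail,
              fun v hv => hy.3 v (by simp at hv ⊢; tauto), rfl,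
              by simpa [List.getLast?_cons_cons] using hy.5⟩
            by_cases hh : ∃ v ∈ z :: l, Q v
            · exact ih2 z hz hh
            · push Not at hh
              refine ⟨y, z :: l, ?_, hy, hh⟩
              obtain ⟨v, hv, hQ⟩ := hv
              rcases List.mem_cons.1 hv with rfl | hv
              · exact hQ
              · exact absurd hQ (hh v hv)
        exact key l y hy hq

def PL (G : SimpleGraph V) (W S T : Set V) (k : ℕ) : Prop :=
  ∃ a b l, a ∈ S ∧ b ∈ T ∧ Pth G W a b l ∧ l.length = k

def Run (G : SimpleGraph V) (W S T : Set V) (n : ℕ) : Prop :=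
  ∃ m, ∀ i < n, PL G W S T (m + i)

theorem Run.map {W S T W' S' T' : Set V} {n : ℕ} (c : ℕ) (h : Run G W S T n)
    (f : ∀ a b l, a ∈ S → b ∈ T → Pth G W a b l →
      ∃ a' b' l', a' ∈ S' ∧ b' ∈ T' ∧ Pth G W' a' b' l' ∧ l'.length = l.length + c) :
    Run G W' S' T' n := by
  obtain ⟨m, hm⟩ := h
  refine ⟨m + c, fun i hi => ?_⟩
  obtain ⟨a, b, l, ha, hb, hl, hk⟩ := hm i hi
  obtain ⟨a', b', l', h1, h2, h3, h4⟩ := f a b l ha hb hl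
  exact ⟨a', b', l', h1, h2, h3, by omega⟩

/-- two consecutive lengths for each -/
theorem Run.map2 {W S T W' S' T' : Set V} {n : ℕ} (c : ℕ) (hn : 0 < n) (h : Run G W S T n)
    (f : ∀ a b l, a ∈ S → b ∈ T → Pth G W a b l → ∀ d < 2,
      ∃ a' b' l', a' ∈ S' ∧ b' ∈ T' ∧ Pth G W' a' b' l' ∧ l'.length = l.length + c + d) :
    Run G W' S' T' (n + 1) := by
  obtain ⟨m, hm⟩ := h
  refine ⟨m + c, fun i hi => ?_⟩
  obtain ⟨j, d, hj, hd, rfl⟩ : ∃ j d, j < n ∧ d < 2 ∧ i = j + d := by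
    rcases Nat.lt_or_ge i n with h | h
    · exact ⟨i, 0, h, by omega, by omega⟩
    · exact ⟨n - 1, 1, by omega, by omega, by omega⟩
  obtain ⟨a, b, l, ha, hb, hl, hk⟩ := hm j hj
  obtain ⟨a', b', l', h1, h2, h3, h4⟩ := f a b l ha hb hl d hd
  exact ⟨a', b', l', h1, h2, h3, by omega⟩

theorem Run.symm {W S T : Set V} {n : ℕ} (h : Run G W S T n) : Run G W T S n := by
  refine h.map 0 fun a b l ha hb hl => ⟨b, a, l.reverse, hb, ha, hl.reverse, by simp⟩

/-! colourings -/

def Pr {κ : Type*} (G : SimpleGraph V) (W : Set V) (c : V → κ) : Prop :=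
  ∀ u ∈ W, ∀ v ∈ W, G.Adj u v → c u ≠ c v

theorem Pr.mono {κ : Type*} {W W' : Set V} {c : V → κ} (h : Pr G W c) (hs : W' ⊆ W) :
    Pr G W' c := fun u hu v hv => h u (hs hu) v (hs hv)

theorem Pr.comp {κ κ' : Type*} {W : Set V} {c : V → κ} (h : Pr G W c) {σ : κ → κ'}
    (hσ : Function.Injective σ) : Pr G W (σ ∘ c) :=
  fun u hu v hv huv he => h u hu v hv huv (hσ he)

theorem perm_exists {ι κ : Type*} [Finite κ] (f g : ι → κ) (h : ∀ i j, f i = f j ↔ g i = g j) :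
    ∃ σ : Equiv.Perm κ, ∀ i, σ (f i) = g i := by
  classical
  have := Fintype.ofFinite κ
  let F : Set.range f → Set.range g := fun x => ⟨g x.2.choose, ⟨_, rfl⟩⟩
  have hF : ∀ i, (F ⟨f i, i, rfl⟩ : κ) = g i := fun i =>
    (h _ _).1 (Exists.choose_spec (⟨i, rfl⟩ : ∃ j, f j = f i))
  have hinj : Function.Injective F := by
    rintro ⟨_, i, rfl⟩ ⟨_, j, rfl⟩ hij
    have := congrArg Subtype.val hij
    rw [hF, hF] at this
    exact Subtype.ext ((h i j).2 this)
  have hsur : Function.Surjective F := by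
    rintro ⟨_, i, rfl⟩
    exact ⟨⟨f i, i, rfl⟩, Subtype.ext (hF i)⟩
  let e : {x // x ∈ Set.range f} ≃ {x // x ∈ Set.range g} := Equiv.ofBijective F ⟨hinj, hsur⟩
  refine ⟨e.extendSubtype, fun i => ?_⟩
  rw [Equiv.extendSubtype_apply_of_mem e (f i) ⟨i, rfl⟩]
  exact hF i

theorem perm1 {κ : Type*} [Finite κ] (a b : κ) : ∃ σ : Equiv.Perm κ, σ a = b := by
  classical
  exact ⟨Equiv.swap a b, by simp⟩

theorem perm2 {κ : Type*} [Finite κ] (a b a' b' : κ) (h : a = b ↔ a' = b') :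
    ∃ σ : Equiv.Perm κ, σ a = a' ∧ σ b = b' := by
  obtain ⟨σ, hσ⟩ := perm_exists ![a, b] ![a', b'] (by
    intro i j
    fin_cases i <;> fin_cases j <;> simp [h, eq_comm])
  exact ⟨σ, hσ 0, hσ 1⟩

theorem perm3 {κ : Type*} [Finite κ] (a b c a' b' c' : κ) (h : a ≠ b) (h1 : a ≠ c) (h2 : b ≠ c)
    (h' : a' ≠ b') (h1' : a' ≠ c') (h2' : b' ≠ c') :
    ∃ σ : Equiv.Perm κ, σ a = a' ∧ σ b = b' ∧ σ c = c' := by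
  obtain ⟨σ, hσ⟩ := perm_exists ![a, b, c] ![a', b', c'] (by
    intro i j
    fin_cases i <;> fin_cases j <;> simp [h, h1, h2, h', h1', h2', h.symm, h1.symm, h2.symm, h'.symm, h1'.symm, h2'.symm])
  exact ⟨σ, hσ 0, hσ 1, hσ 2⟩

theorem glue {κ : Type*} [Nonempty κ] (U : Set V) (F : V → κ → Prop)
    (h : ∀ a ∈ U, ∃ c : V → κ, Pr G (K G U a) c ∧ ∀ v ∈ K G U a, ¬ F v (c v)) :
    ∃ c : V → κ, Pr G U c ∧ ∀ v ∈ U, ¬ F v (c v) := by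
  classical
  have h' : ∀ X : Set V, ∃ c : V → κ, (∃ a ∈ U, X = K G U a) → Pr G X c ∧ ∀ v ∈ X, ¬ F v (c v) := by
    intro X
    by_cases hX : ∃ a ∈ U, X = K G U a
    · obtain ⟨a, ha, rfl⟩ := hX
      obtain ⟨c, hc⟩ := h a ha
      exact ⟨c, fun _ => hc⟩
    · exact ⟨fun _ => Classical.arbitrary κ, fun h => absurd h hX⟩
  choose c hc using h'
  refine ⟨fun v => c (K G U v) v, ?_, ?_⟩
  · intro u hu v hv huv
    have hK := K_adj hu hv huv
    show c (K G U u) u ≠ c (K G U v) v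
    rw [← hK]
    exact (hc _ ⟨u, hu, rfl⟩).1 u (K_self hu) v (hK ▸ K_self hv) huv
  · intro v hv
    exact (hc _ ⟨v, hv, rfl⟩).2 v (K_self hv)

/-- colouring of `W` in which `S` avoids `α`, `T` avoids `β`. -/
def Av {κ : Type*} (G : SimpleGraph V) (W S T : Set V) (α β : κ) (c : V → κ) : Prop :=
  Pr G W c ∧ (∀ v ∈ W, v ∈ S → c v ≠ α) ∧ (∀ v ∈ W, v ∈ T → c v ≠ β)

def CC (G : SimpleGraph V) (W S T : Set V) (n : ℕ) (e : Prop) : Prop :=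
  ∃ (c : V → Fin n) (α β : Fin n), Av G W S T α β c ∧ (α = β ↔ e)

theorem Av.symm {κ : Type*} {W S T : Set V} {α β : κ} {c : V → κ} (h : Av G W S T α β c) :
    Av G W T S β α c := ⟨h.1, h.2.2, h.2.1⟩

theorem Av.comp {κ κ' : Type*} {W S T : Set V} {α β : κ} {c : V → κ} (h : Av G W S T α β c)
    {σ : κ → κ'} (hσ : Function.Injective σ) : Av G W S T (σ α) (σ β) (σ ∘ c) :=
  ⟨h.1.comp hσ, fun v hv hs he => h.2.1 v hv hs (hσ he), fun v hv hs he => h.2.2 v hv hs (hσ he)⟩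

theorem Av.mono {κ : Type*} {W S T W' S' T' : Set V} {α β : κ} {c : V → κ} (h : Av G W S T α β c)
    (hW : W' ⊆ W) (hS : S' ∩ W' ⊆ S) (hT : T' ∩ W' ⊆ T) : Av G W' S' T' α β c :=
  ⟨h.1.mono hW, fun v hv hs => h.2.1 v (hW hv) (hS ⟨hs, hv⟩),
    fun v hv hs => h.2.2 v (hW hv) (hT ⟨hs, hv⟩)⟩

theorem CC.symm {W S T : Set V} {n : ℕ} {e : Prop} (h : CC G W S T n e) : CC G W T S n e := by
  obtain ⟨c, α, β, h, he⟩ := h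
  exact ⟨c, β, α, h.symm, by rw [← he, eq_comm]⟩

theorem CC.mono {W S T W' S' T' : Set V} {n : ℕ} {e : Prop} (h : CC G W S T n e)
    (hW : W' ⊆ W) (hS : S' ∩ W' ⊆ S) (hT : T' ∩ W' ⊆ T) : CC G W' S' T' n e := by
  obtain ⟨c, α, β, h, he⟩ := h
  exact ⟨c, α, β, h.mono hW hS hT, he⟩

theorem CC.at {W S T : Set V} {n : ℕ} {e : Prop} (h : CC G W S T n e) (α β : Fin n)
    (he : α = β ↔ e) : ∃ c, Av G W S T α β c := by
  obtain ⟨c, α', β', h, he'⟩ := h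
  obtain ⟨σ, h1, h2⟩ := perm2 α' β' α β (he'.trans he.symm)
  exact ⟨σ ∘ c, by simpa [h1, h2] using h.comp σ.injective⟩

theorem exists_pair {n : ℕ} (hn : 2 ≤ n) (e : Prop) : ∃ α β : Fin n, α = β ↔ e := by
  by_cases h : e
  · exact ⟨⟨0, by omega⟩, ⟨0, by omega⟩, by simp [h]⟩
  · exact ⟨⟨0, by omega⟩, ⟨1, by omega⟩, by simp [h]⟩

theorem exists_third {n : ℕ} (hn : 3 ≤ n) (α β : Fin n) : ∃ γ : Fin n, γ ≠ α ∧ γ ≠ β := by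
  have : ({α, β} : Finset (Fin n)).card < Fintype.card (Fin n) := by
    have := Finset.card_le_two (a := α) (b := β)
    simp; omega
  obtain ⟨γ, hγ⟩ := Finset.exists_mem_notMem_of_card_lt_card (s := {α, β}) (t := Finset.univ)
    (by simpa using this)
  simp at hγ
  exact ⟨γ, hγ.1, hγ.2⟩

theorem exists_ne_fin {n : ℕ} (hn : 2 ≤ n) (α : Fin n) : ∃ γ : Fin n, γ ≠ α := by
  have : Nontrivial (Fin n) := Fin.nontrivial_iff_two_le.2 hn
  exact exists_ne α

theorem CC.comps {U S T : Set V} {n : ℕ} {e : Prop} (hn : 2 ≤ n)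
    (h : ∀ a ∈ U, CC G (K G U a) S T n e) : CC G U S T n e := by
  obtain ⟨α, β, he⟩ := exists_pair hn e
  have : Nonempty (Fin n) := ⟨α⟩
  obtain ⟨c, hc, hF⟩ := glue (G := G) U (fun v x => (v ∈ S ∧ x = α) ∨ (v ∈ T ∧ x = β)) (by
    intro a ha
    obtain ⟨c, hc⟩ := (h a ha).at α β he
    refine ⟨c, hc.1, fun v hv => ?_⟩
    rintro (⟨h1, h2⟩ | ⟨h1, h2⟩)
    · exact hc.2.1 v hv h1 h2
    · exact hc.2.2 v hv h1 h2)
  exact ⟨c, α, β, ⟨hc, fun v hv hs h => hF v hv (Or.inl ⟨hs, h⟩),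
    fun v hv hs h => hF v hv (Or.inr ⟨hs, h⟩)⟩, he⟩

theorem exists_bad {U S T : Set V} {n : ℕ} {e : Prop} (hn : 2 ≤ n) (h : ¬ CC G U S T n e) :
    ∃ C, Cl G U C ∧ Conn G C ∧ C.Nonempty ∧ ¬ CC G C S T n e := by
  by_contra! hh
  exact h (CC.comps hn fun a ha => hh _ (K_cl U a) (K_conn ha) ⟨a, K_self ha⟩)

/-- gluing two colourings along a partition -/
theorem Pr.glue2 {κ : Type*} {A B : Set V} {c d f : V → κ} (hc : Pr G A c) (hd : Pr G B d)
    (hfA : ∀ v ∈ A, f v = c v) (hfB : ∀ v ∈ B, f v = d v)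
    (hAB : ∀ u ∈ A, ∀ v ∈ B, G.Adj u v → f u ≠ f v) : Pr G (A ∪ B) f := by
  rintro u (hu | hu) v (hv | hv) huv
  · rw [hfA u hu, hfA v hv]; exact hc u hu v hv huv
  · exact hAB u hu v hv huv
  · exact (hAB v hv u hu huv.symm).symm
  · rw [hfB u hu, hfB v hv]; exact hd u hu v hv huv

end OC

namespace OC
open Set

variable {V : Type*} {G : SimpleGraph V}

def H2 (G : SimpleGraph V) (W S T : Set V) (n : ℕ) : Prop :=
  ∀ w ∈ W, ∀ B, Cl G (W \ {w}) B → B.Nonempty → (∀ v ∈ B, v ∉ S ∧ v ∉ T) →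
    ∃ c : V → Fin n, Pr G (insert w B) c

def RCfor (G : SimpleGraph V) (N : ℕ) : Prop :=
  ∀ W : Set V, W.ncard < N → ∀ (S T : Set V) (n : ℕ), 2 ≤ n → Conn G W → (∃ v ∈ W, v ∈ S) →
    (∃ v ∈ W, v ∈ T) → H2 G W S T n → ∀ e, ¬ CC G W S T n e → Run G W S T (n - 1)

theorem H2.vac {W S T : Set V} {n : ℕ} (h : ∀ w ∈ W, ∀ B, Cl G (W \ {w}) B → B.Nonempty →
    (∀ v ∈ B, v ∉ S ∧ v ∉ T) → False) : H2 G W S T n :=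
  fun w hw B h1 h2 h3 => (h w hw B h1 h2 h3).elim

theorem H2.symm {W S T : Set V} {n : ℕ} (h : H2 G W S T n) : H2 G W T S n :=
  fun w hw B h1 h2 h3 => h w hw B h1 h2 fun v hv => (h3 v hv).symm

theorem card_lt [Finite V] {B W : Set V} {w : V} (h : B ⊆ W) (hw : w ∈ W) (hB : w ∉ B) :
    B.ncard < W.ncard :=
  Set.ncard_lt_ncard ⟨h, fun h' => hB (h' hw)⟩ (Set.toFinite _)

theorem Conn.out {W B : Set V} (hW : Conn G W) (hB : B ⊆ W) (hne : B.Nonempty) {z : V}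
    (hz : z ∈ W) (hzB : z ∉ B) : ∃ x ∈ B, ∃ y ∈ W, y ∉ B ∧ G.Adj x y := by
  by_contra! h
  have : Cl G W B := ⟨hB, fun u hu v hv huv => by
    by_contra hvB
    exact h u hu v hv hvB huv⟩
  exact hzB ((hW _ this hne) ▸ hz)

theorem Conn.nbr {W B : Set V} {w : V} (hW : Conn G W) (hw : w ∈ W) (hB : Cl G (W \ {w}) B)
    (hne : B.Nonempty) : ∃ x ∈ B, x ∈ G.neighborSet w := by
  obtain ⟨x, hx, y, hy, hyB, hxy⟩ := hW.out (fun x hx => (hB.1 hx).1) hne hw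
    (fun h => (hB.1 h).2 rfl)
  by_cases hyw : y = w
  · subst hyw
    exact ⟨x, hx, hxy.symm⟩
  · exact absurd (hB.2 x hx y ⟨hy, hyw⟩ hxy) hyB

theorem Cl.lift1 {W B B' : Set V} {w u : V} (hB : Cl G (W \ {w}) B)
    (hB' : Cl G ((W \ B) \ {u}) B') (hw : w ∉ B') : Cl G (W \ {u}) B' := by
  refine ⟨fun x hx => ⟨(hB'.1 hx).1.1, (hB'.1 hx).2⟩, fun x hx v hv hxv => ?_⟩
  refine hB'.2 x hx v ⟨⟨hv.1, fun hvB => (hB'.1 hx).1.2 ?_⟩, hv.2⟩ hxv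
  exact hB.2 v hvB x ⟨(hB'.1 hx).1.1, fun h => hw (h ▸ hx)⟩ hxv.symm

theorem Cl.lift2 {W B B' : Set V} {w u : V} (hB : Cl G (W \ {w}) B)
    (hB' : Cl G ((W \ B) \ {u}) B') (hu : u ∉ B) (hw : w ∈ B') : Cl G (W \ {u}) (B' ∪ B) := by
  refine ⟨?_, ?_⟩
  · rintro x (hx | hx)
    · exact ⟨(hB'.1 hx).1.1, (hB'.1 hx).2⟩
    · exact ⟨(hB.1 hx).1, fun h => hu (h ▸ hx)⟩
  · rintro x (hx | hx) v hv hxv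
    · by_cases hvB : v ∈ B
      · exact Or.inr hvB
      · exact Or.inl (hB'.2 x hx v ⟨⟨hv.1, hvB⟩, hv.2⟩ hxv)
    · by_cases hvw : v = w
      · exact Or.inl (hvw ▸ hw)
      · exact Or.inr (hB.2 x hx v ⟨hv.1, hvw⟩ hxv)

/-- Gluing a colouring of `W \ B` and one of `B`, when `B` is attached at `w`. -/
theorem Av.glueB {κ : Type*} {W B S T : Set V} {w : V} {α β : κ} {c d : V → κ}
    (hB : Cl G (W \ {w}) B) (hc : Av G (W \ B) S T α β c) (hd : Pr G B d)
    (hdw : ∀ v ∈ B, G.Adj w v → d v ≠ c w) (hdS : ∀ v ∈ B, v ∈ S → d v ≠ α)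
    (hdT : ∀ v ∈ B, v ∈ T → d v ≠ β) : ∃ f, Av G W S T α β f := by
  classical
  let f : V → κ := fun v => if v ∈ B then d v else c v
  have f1 : ∀ v ∈ B, f v = d v := fun v hv => by simp [f, hv]
  have f2 : ∀ v ∈ W \ B, f v = c v := fun v hv => by simp [f, hv.2]
  have hW : W = W \ B ∪ B := by
    rw [Set.sdiff_union_self, Set.union_eq_left.2]
    exact fun x hx => (hB.1 hx).1
  refine ⟨f, ?_, ?_, ?_⟩
  · rw [hW]
    refine hc.1.glue2 hd f2 f1 ?_
    intro u hu v hv huv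
    rw [f1 v hv, f2 u hu]
    have : u = w := by
      by_contra h
      exact hu.2 (hB.2 v hv u ⟨hu.1, h⟩ huv.symm)
    subst this
    exact (hdw v hv huv).symm
  · intro v hv hs
    by_cases hvB : v ∈ B
    · rw [f1 v hvB]; exact hdS v hvB hs
    · rw [f2 v ⟨hv, hvB⟩]; exact hc.2.1 v ⟨hv, hvB⟩ hs
  · intro v hv hs
    by_cases hvB : v ∈ B
    · rw [f1 v hvB]; exact hdT v hvB hs
    · rw [f2 v ⟨hv, hvB⟩]; exact hc.2.2 v ⟨hv, hvB⟩ hs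

variable [Finite V]

theorem step0 {W S T : Set V} {n : ℕ} {e : Prop} (ih : RCfor G W.ncard) (hn : 2 ≤ n)
    (hW : Conn G W) (hS : ∃ v ∈ W, v ∈ S) (hT : ∃ v ∈ W, v ∈ T) (h2 : H2 G W S T n)
    (he : ¬ CC G W S T n e) {w : V} (hw : w ∈ W) {B : Set V} (hB : Cl G (W \ {w}) B)
    (hne : B.Nonempty) (hmiss : ∀ v ∈ B, v ∉ S ∧ v ∉ T) : Run G W S T (n - 1) := by
  have hwB : w ∉ B := fun h => (hB.1 h).2 rfl
  obtain ⟨b, hb⟩ := hne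
  have : Run G (W \ B) S T (n - 1) := by
    refine ih (W \ B) (card_lt sdiff_subset (hB.1 hb).1 (fun h => h.2 hb)) S T n hn (hW.del hw hB)
      ?_ ?_ ?_ e ?_
    · obtain ⟨v, hv, hs⟩ := hS
      exact ⟨v, ⟨hv, fun h => (hmiss v h).1 hs⟩, hs⟩
    · obtain ⟨v, hv, hs⟩ := hT
      exact ⟨v, ⟨hv, fun h => (hmiss v h).2 hs⟩, hs⟩
    · intro u hu B' hB' hne' hm'
      by_cases hwB' : w ∈ B'
      · obtain ⟨c, hc⟩ := h2 u hu.1 (B' ∪ B) (hB.lift2 hB' hu.2 hwB') ⟨w, Or.inl hwB'⟩ (by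
          rintro v (hv | hv)
          · exact hm' v hv
          · exact hmiss v hv)
        exact ⟨c, hc.mono (insert_subset_insert subset_union_left)⟩
      · exact h2 u hu.1 B' (hB.lift1 hB' hwB') hne' hm'
    · rintro ⟨c, α, β, hc, hab⟩
      obtain ⟨d, hd⟩ := h2 w hw B hB ⟨b, hb⟩ hmiss
      obtain ⟨σ, hσ⟩ := perm1 (d w) (c w)
      have hd' := hd.comp σ.injective
      obtain ⟨f, hf⟩ := hc.glueB (d := σ ∘ d) hB (hd'.mono (subset_insert _ _)) (by
        intro v hv hwv
        rw [← hσ]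
        exact (hd' w (mem_insert _ _) v (mem_insert_of_mem _ hv) hwv).symm)
        (fun v hv hs => absurd hs (hmiss v hv).1) (fun v hv hs => absurd hs (hmiss v hv).2)
      exact he ⟨f, α, β, hf, hab⟩
  exact this.map 0 fun a b l ha hb hl => ⟨a, b, l, ha, hb, hl.mono sdiff_subset, rfl⟩

theorem step1a {W S T : Set V} {n : ℕ} {e : Prop} (ih : RCfor G W.ncard) (hn : 2 ≤ n)
    (hW : Conn G W) (hT : ∃ v ∈ W, v ∈ T)
    (h2 : ∀ w ∈ W, ∀ B, Cl G (W \ {w}) B → B.Nonempty → ∃ v ∈ B, v ∈ S ∨ v ∈ T)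
    {w : V} (hw : w ∈ W) {B : Set V} (hB : Cl G (W \ {w}) B) (hBc : Conn G B)
    (hne : B.Nonempty) (hmiss : ∀ v ∈ B, v ∉ T)
    (he : ¬ CC G B S (G.neighborSet w) n e) : Run G W S T (n - 1) := by
  have hwB : w ∉ B := fun h => (hB.1 h).2 rfl
  have hBW : B ⊆ W := fun x hx => (hB.1 hx).1
  have hrun : Run G B S (G.neighborSet w) (n - 1) := by
    refine ih B (card_lt hBW hw hwB) S _ n hn hBc ?_ (hW.nbr hw hB hne) ?_ e he
    · obtain ⟨v, hv, h⟩ := h2 w hw B hB hne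
      exact ⟨v, hv, h.resolve_right (hmiss v hv)⟩
    · apply H2.vac
      intro u hu B' hB' hne' hm'
      have : Cl G (W \ {u}) B' := by
        refine ⟨fun x hx => ⟨hBW (hB'.1 hx).1, (hB'.1 hx).2⟩, fun x hx v hv hxv => ?_⟩
        refine hB'.2 x hx v ⟨hB.2 x (hB'.1 hx).1 v ⟨hv.1, ?_⟩ hxv, hv.2⟩ hxv
        rintro rfl
        exact (hm' x hx).2 hxv.symm
      obtain ⟨v, hv, h⟩ := h2 u (hBW hu) B' this hne'
      rcases h with h | h
      · exact (hm' v hv).1 h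
      · exact hmiss v (hB'.1 hv).1 h
  obtain ⟨t, ht, htT⟩ := hT
  obtain ⟨tl, htl⟩ := (hW.del hw hB).path (a := w) (b := t) ⟨hw, hwB⟩ ⟨ht, fun h => hmiss t h htT⟩
  refine hrun.map tl.length fun a b l ha hb hl => ⟨a, t, l ++ tl, ha, htT, ?_, by simp⟩
  exact (hl.append htl hb.symm (fun v hv hv' => hv'.2 hv)).mono (union_subset hBW sdiff_subset)

theorem step1b {W S T : Set V} {n : ℕ} {e : Prop} (ih : RCfor G W.ncard) (hn : 2 ≤ n)
    (hW : Conn G W) (hT : ∃ v ∈ W, v ∈ T) (h2 : H2 G W S T n)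
    (he : ¬ CC G W S T n e)
    (hg : ∀ w ∈ W, ∀ B, Cl G (W \ {w}) B → (∀ v ∈ B, v ∉ T) → ∀ e, CC G B S (G.neighborSet w) n e)
    {w : V} (hw : w ∈ W) {B : Set V} (hB : Cl G (W \ {w}) B)
    (hne : B.Nonempty) (hmiss : ∀ v ∈ B, v ∉ T) (hS : ∃ v ∈ W, v ∉ B ∧ v ∈ S) :
    Run G W S T (n - 1) := by
  classical
  have hwB : w ∉ B := fun h => (hB.1 h).2 rfl
  obtain ⟨b, hb⟩ := hne
  have : Run G (W \ B) S T (n - 1) := by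
    refine ih (W \ B) (card_lt sdiff_subset (hB.1 hb).1 (fun h => h.2 hb)) S T n hn (hW.del hw hB)
      ?_ ?_ ?_ e ?_
    · obtain ⟨v, hv, hs, h⟩ := hS
      exact ⟨v, ⟨hv, hs⟩, h⟩
    · obtain ⟨v, hv, hs⟩ := hT
      exact ⟨v, ⟨hv, fun h => (hmiss v h) hs⟩, hs⟩
    · intro u hu B' hB' hne' hm'
      by_cases hwB' : w ∈ B'
      · obtain ⟨c, α, β, hc, -⟩ := hg u hu.1 (B' ∪ B) (hB.lift2 hB' hu.2 hwB') (by
          rintro v (hv | hv)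
          · exact (hm' v hv).2
          · exact hmiss v hv) True
        have huB' : u ∉ B' := fun h => (hB'.1 h).2 rfl
        refine ⟨fun v => if v = u then β else c v, ?_⟩
        have hcu : ∀ v ∈ B', G.Adj u v → c v ≠ β := fun v hv huv => hc.2.2 v (Or.inl hv) huv
        rintro x (rfl | hx) y (rfl | hy) hxy
        · exact absurd hxy (G.irrefl)
        · have : y ≠ x := fun h => huB' (h ▸ hy)
          simpa [this] using (hcu y hy hxy).symm
        · have : x ≠ y := fun h => huB' (h ▸ hx)
          simpa [this] using (hcu x hx hxy.symm)
        · have h1 : x ≠ u := fun h => huB' (h ▸ hx)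
          have h2 : y ≠ u := fun h => huB' (h ▸ hy)
          simpa [h1, h2] using hc.1 x (Or.inl hx) y (Or.inl hy) hxy
      · exact h2 u hu.1 B' (hB.lift1 hB' hwB') hne' hm'
    · rintro ⟨c, α, β, hc, hab⟩
      obtain ⟨d, hd⟩ := (hg w hw B hB hmiss (α = c w)).at α (c w) Iff.rfl
      obtain ⟨f, hf⟩ := hc.glueB (d := d) hB hd.1 hd.2.2
        hd.2.1 (fun v hv hs => absurd hs (hmiss v hv))
      exact he ⟨f, α, β, hf, hab⟩
  exact this.map 0 fun a b l ha hb hl => ⟨a, b, l, ha, hb, hl.mono sdiff_subset, rfl⟩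

theorem step1c {W S T : Set V} {n : ℕ} {e : Prop} (hn : 2 ≤ n)
    (he : ¬ CC G W S T n e)
    (hg : ∀ w ∈ W, ∀ B, Cl G (W \ {w}) B → (∀ v ∈ B, v ∉ T) → ∀ e, CC G B S (G.neighborSet w) n e)
    (hg' : ∀ w ∈ W, ∀ B, Cl G (W \ {w}) B → (∀ v ∈ B, v ∉ S) → ∀ e, CC G B T (G.neighborSet w) n e)
    (ha : ∀ w ∈ W, ∀ B, Cl G (W \ {w}) B → B.Nonempty → (∀ v ∈ B, v ∉ T) →
      ∀ v ∈ W, v ∈ S → v ∈ B)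
    (ha' : ∀ w ∈ W, ∀ B, Cl G (W \ {w}) B → B.Nonempty → (∀ v ∈ B, v ∉ S) →
      ∀ v ∈ W, v ∈ T → v ∈ B)
    {w : V} (hw : w ∈ W) {B : Set V} (hB : Cl G (W \ {w}) B)
    (hne : B.Nonempty) (hmiss : ∀ v ∈ B, v ∉ T) : False := by
  classical
  have hwB : w ∉ B := fun h => (hB.1 h).2 rfl
  have hSB := ha w hw B hB hne hmiss
  have hwS : w ∉ S := fun h => hwB (hSB w hw h)
  set B2 := (W \ {w}) \ B with hB2
  have hB2c : Cl G (W \ {w}) B2 := ⟨sdiff_subset, fun u hu v hv huv =>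
    ⟨hv, fun h => hu.2 (hB.2 v h u hu.1 huv.symm)⟩⟩
  have hm2 : ∀ v ∈ B2, v ∉ S := fun v hv h => hv.2 (hSB v hv.1.1 h)
  by_cases hne2 : B2.Nonempty
  · have hTB := ha' w hw B2 hB2c hne2 hm2
    obtain ⟨c, α, β, hc, hab⟩ := (hg' w hw B2 hB2c hm2 e)
    -- α for T, β for N(w)
    obtain ⟨d, hd⟩ := (hg w hw B hB hmiss True).at β β (by simp)
    have hwT : w ∉ T := fun h => (hTB w hw h).1.2 rfl
    have hc' : Av G (W \ B) S T β α (fun v => if v = w then β else c v) := by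
      have hx : ∀ x ∈ W \ B, x ≠ w → x ∈ B2 := fun x hx h => ⟨⟨hx.1, h⟩, hx.2⟩
      refine ⟨?_, ?_, ?_⟩
      · intro x hx' y hy' hxy
        by_cases h1 : x = w
        · have h2 : y ≠ w := fun h => G.irrefl (h1 ▸ h ▸ hxy)
          simpa [h1, h2] using (hc.2.2 y (hx y hy' h2) (h1 ▸ hxy)).symm
        · by_cases h2 : y = w
          · simpa [h1, h2] using (hc.2.2 x (hx x hx' h1) (h2 ▸ hxy.symm))
          · simpa [h1, h2] using hc.1 x (hx x hx' h1) y (hx y hy' h2) hxy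
      · intro v hv hs
        exact absurd (hSB v hv.1 hs) hv.2
      · intro v hv hs
        have h1 : v ≠ w := fun h => hwT (h ▸ hs)
        simpa [h1] using hc.2.1 v (hx v hv h1) hs
    obtain ⟨f, hf⟩ := hc'.glueB (d := d) hB hd.1 (by simpa using hd.2.2)
        hd.2.1 (fun v hv hs => absurd hs (hmiss v hv))
    exact he ⟨f, β, α, hf, by rw [← hab, eq_comm]⟩
  · have hx : ∀ x ∈ W \ B, x = w := fun x hx => by
      by_contra h
      exact hne2 ⟨x, ⟨hx.1, h⟩, hx.2⟩
    obtain ⟨d, α, β, hd, hab⟩ := hg w hw B hB hmiss (¬ e)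
    obtain ⟨y, hy, hye⟩ : ∃ y : Fin n, y ≠ β ∧ (α = y ↔ e) := by
      by_cases h : e
      · exact ⟨α, fun h' => (hab.1 h') h, by simp [h]⟩
      · obtain ⟨y, hy⟩ := exists_ne_fin hn β
        have : α = β := hab.2 h
        exact ⟨y, hy, by simp [h, this, hy.symm]⟩
    have hc' : Av G (W \ B) S T α y (fun _ => β) := by
      refine ⟨?_, ?_, ?_⟩
      · intro x hx' z hz' hxz
        rw [hx x hx', hx z hz'] at hxz
        exact absurd hxz G.irrefl
      · intro v hv hs
        exact absurd (hSB v hv.1 hs) hv.2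
      · intro v hv hs
        exact hy.symm
    obtain ⟨f, hf⟩ := hc'.glueB (d := d) hB hd.1 hd.2.2
        hd.2.1 (fun v hv hs => absurd hs (hmiss v hv))
    exact he ⟨f, α, y, hf, hye⟩

end OC

namespace OC
open Set

variable {V : Type*} {G : SimpleGraph V}

/-- colouring of `B ∪ {s, s1}` with `S` avoiding a third colour -/
def CS (G : SimpleGraph V) (B S : Set V) (s s1 : V) (n : ℕ) : Prop :=
  ∃ (c : V → Fin n) (α β γ : Fin n), α ≠ β ∧ α ≠ γ ∧ β ≠ γ ∧
    Av G B S (G.neighborSet s) α β c ∧ ∀ v ∈ B, G.Adj s1 v → c v ≠ γ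

theorem CS.at {B S : Set V} {s s1 : V} {n : ℕ} (h : CS G B S s s1 n) (α β γ : Fin n)
    (h1 : α ≠ β) (h2 : α ≠ γ) (h3 : β ≠ γ) : ∃ c, Av G B S (G.neighborSet s) α β c ∧
      ∀ v ∈ B, G.Adj s1 v → c v ≠ γ := by
  obtain ⟨c, a, b, g, h1', h2', h3', hc, hg⟩ := h
  obtain ⟨σ, e1, e2, e3⟩ := perm3 a b g α β γ h1' h2' h3' h1 h2 h3
  refine ⟨σ ∘ c, by simpa [e1, e2] using hc.comp σ.injective, fun v hv hs he => hg v hv hs ?_⟩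
  rw [← e3] at he
  exact σ.injective he

theorem CS.comps {U S : Set V} {s s1 : V} {n : ℕ} (hn : 3 ≤ n)
    (h : ∀ a ∈ U, CS G (K G U a) S s s1 n) : CS G U S s s1 n := by
  let α : Fin n := ⟨0, by omega⟩
  let β : Fin n := ⟨1, by omega⟩
  let γ : Fin n := ⟨2, by omega⟩
  have h1 : α ≠ β := by simp [α, β]
  have h2 : α ≠ γ := by simp [α, γ]
  have h3 : β ≠ γ := by simp [β, γ]
  have : Nonempty (Fin n) := ⟨α⟩
  obtain ⟨c, hc, hF⟩ := glue (G := G) U (fun v x => (v ∈ S ∧ x = α) ∨ (G.Adj s v ∧ x = β) ∨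
      (G.Adj s1 v ∧ x = γ)) (by
    intro a ha
    obtain ⟨c, hc, hg⟩ := (h a ha).at α β γ h1 h2 h3
    refine ⟨c, hc.1, fun v hv => ?_⟩
    rintro (⟨h1, h2⟩ | ⟨h1, h2⟩ | ⟨h1, h2⟩)
    · exact hc.2.1 v hv h1 h2
    · exact hc.2.2 v hv h1 h2
    · exact hg v hv h1 h2)
  exact ⟨c, α, β, γ, h1, h2, h3, ⟨hc, fun v hv hs h => hF v hv (Or.inl ⟨hs, h⟩),
    fun v hv hs h => hF v hv (Or.inr (Or.inl ⟨hs, h⟩))⟩,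
    fun v hv hs h => hF v hv (Or.inr (Or.inr ⟨hs, h⟩))⟩

variable [Finite V]

theorem step2a {W S T : Set V} {n : ℕ} (ih : RCfor G W.ncard) (hn : 2 ≤ n)
    (h3T : ∀ w ∈ W, ∀ B, Cl G (W \ {w}) B → B.Nonempty → ∃ v ∈ B, v ∈ T)
    (h3S : ∀ w ∈ W, ∀ B, Cl G (W \ {w}) B → B.Nonempty → ∃ v ∈ B, v ∈ S)
    {s s1 : V} (hs : s ∈ W) (hsS : s ∈ S) (hs1 : s1 ∈ W)
    (hadj : G.Adj s s1) {B : Set V} (hB : Cl G (W \ {s, s1}) B) (hBc : Conn G B)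
    (hne : B.Nonempty) (hmiss : ∀ v ∈ B, v ∉ T)
    (he : ¬ CS G B S s s1 n) : Run G W S T (n - 1) := by
  have hBW : B ⊆ W := fun x hx => (hB.1 hx).1
  have hsB : s ∉ B := fun h => (hB.1 h).2 (by simp)
  have hs1B : s1 ∉ B := fun h => (hB.1 h).2 (by simp)
  -- neighbours of s in B
  obtain ⟨x, hx, hxs⟩ : ∃ x ∈ B, G.Adj x s := by
    by_contra! h
    have : Cl G (W \ {s1}) B := by
      refine ⟨fun x hx => ⟨hBW hx, fun h => hs1B (h ▸ hx)⟩, fun u hu v hv huv => ?_⟩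
      refine hB.2 u hu v ⟨hv.1, ?_⟩ huv
      rintro (rfl | h')
      · exact h u hu huv
      · exact hv.2 h'
    obtain ⟨v, hv, hvT⟩ := h3T s1 hs1 B this hne
    exact hmiss v hv hvT
  have hrun : Run G (insert s B) S (G.neighborSet s1) (n - 1) := by
    refine ih (insert s B) (card_lt (insert_subset hs hBW) hs1 ?_) S _ n hn (hBc.insert hx hxs)
      ⟨s, mem_insert _ _, hsS⟩ ⟨s, mem_insert _ _, hadj.symm⟩ ?_ False ?_
    · rintro (h | h)
      · exact hadj.ne h.symm
      · exact hs1B h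
    · apply H2.vac
      intro u hu B' hB' hne' hm'
      have hsB' : s ∉ B' := fun h => (hm' s h).1 hsS
      have hB'B : B' ⊆ B := fun y hy => ((hB'.1 hy).1).resolve_left (fun h => hsB' (h ▸ hy))
      have : Cl G (W \ {u}) B' := by
        refine ⟨fun y hy => ⟨hBW (hB'B hy), (hB'.1 hy).2⟩, fun y hy v hv hyv => ?_⟩
        by_cases hvs : v = s
        · exact hB'.2 y hy v ⟨Or.inl hvs, hv.2⟩ hyv
        · by_cases hvs1 : v = s1
          · subst hvs1
            exact absurd hyv.symm (hm' y hy).2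
          · exact hB'.2 y hy v ⟨Or.inr (hB.2 y (hB'B hy) v ⟨hv.1, by simp [hvs, hvs1]⟩ hyv), hv.2⟩ hyv
      have huW : u ∈ W := by
        rcases hu with rfl | hu
        · exact hs
        · exact hBW hu
      obtain ⟨v, hv, h⟩ := h3S u huW B' this hne'
      exact (hm' v hv).1 h
    · rintro ⟨c, α, β, hc, hab⟩
      refine he ⟨c, α, c s, β, (hc.2.1 s (mem_insert _ _) hsS).symm, fun h => hab.1 h,
        hc.2.2 s (mem_insert _ _) hadj.symm, ⟨hc.1.mono (subset_insert _ _), ?_, ?_⟩, ?_⟩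
      · exact fun v hv hs => hc.2.1 v (Or.inr hv) hs
      · exact fun v hv hsv => (hc.1 s (mem_insert _ _) v (Or.inr hv) hsv).symm
      · exact fun v hv hs => hc.2.2 v (Or.inr hv) hs
  have hs1s : s1 ∈ W \ {s} := ⟨hs1, fun h => hadj.ne h.symm⟩
  obtain ⟨t, ht, htT⟩ := h3T s hs (K G (W \ {s}) s1) (K_cl _ _) ⟨s1, K_self hs1s⟩
  have hdel : Conn G (K G (W \ {s}) s1 \ (B ∩ K G (W \ {s}) s1)) := by
    refine (K_conn hs1s).del (K_self hs1s) ⟨fun y hy => ⟨hy.2, fun h => hs1B (h ▸ hy.1)⟩, ?_⟩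
    intro u hu v hv huv
    refine ⟨hB.2 u hu.1 v ⟨hv.1.1.1, ?_⟩ huv, hv.1⟩
    rintro (h | h)
    · exact hv.1.1.2 h
    · exact hv.2 h
  obtain ⟨tl, htl⟩ := hdel.path (a := s1) (b := t) ⟨K_self hs1s, fun h => hs1B h.1⟩
    ⟨ht, fun h => hmiss t h.1 htT⟩
  refine hrun.map tl.length fun a b l ha hb hl => ⟨a, t, l ++ tl, ha, htT, ?_, by simp⟩
  refine (hl.append htl hb.symm ?_).mono (union_subset (insert_subset hs hBW) ?_)
  · rintro v (rfl | hv) hv'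
    · exact hv'.1.1.2 rfl
    · exact hv'.2 ⟨hv, hv'.1⟩
  · exact fun y hy => hy.1.1.1

theorem step2b {W S T : Set V} {n : ℕ} {e : Prop} (ih : RCfor G W.ncard) (hn : 2 ≤ n)
    (hW : Conn G W) (hT : ∃ v ∈ W, v ∈ T)
    (h3S : ∀ w ∈ W, ∀ B, Cl G (W \ {w}) B → B.Nonempty → ∃ v ∈ B, v ∈ S)
    (he : ¬ CC G W S T n e)
    {s s1 : V} (hs : s ∈ W) (hsS : s ∈ S) (hs1 : s1 ∈ W) (hs1S : s1 ∈ S)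
    (hadj : G.Adj s s1) {B : Set V} (hB : Cl G (W \ {s, s1}) B)
    (hne : B.Nonempty) (hmiss : ∀ v ∈ B, v ∉ T)
    (hg : CS G B S s s1 n) : Run G W S T (n - 1) := by
  classical
  have hBW : B ⊆ W := fun x hx => (hB.1 hx).1
  have hsB : s ∉ B := fun h => (hB.1 h).2 (by simp)
  have hs1B : s1 ∉ B := fun h => (hB.1 h).2 (by simp)
  obtain ⟨b, hb⟩ := hne
  have : Run G (W \ B) S T (n - 1) := by
    refine ih (W \ B) (card_lt sdiff_subset (hBW hb) (fun h => h.2 hb)) S T n hn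
      (hW.del2 hs hs1 hadj hB) ⟨s, ⟨hs, hsB⟩, hsS⟩ ?_ ?_ e ?_
    · obtain ⟨v, hv, h⟩ := hT
      exact ⟨v, ⟨hv, fun h' => (hmiss v h') h⟩, h⟩
    · apply H2.vac
      intro u hu B' hB' hne' hm'
      have : Cl G (W \ {u}) B' := by
        refine ⟨fun y hy => ⟨(hB'.1 hy).1.1, (hB'.1 hy).2⟩, fun y hy v hv hyv => ?_⟩
        refine hB'.2 y hy v ⟨⟨hv.1, fun hvB => (hB'.1 hy).1.2 ?_⟩, hv.2⟩ hyv
        refine hB.2 v hvB y ⟨(hB'.1 hy).1.1, ?_⟩ hyv.symm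
        rintro (rfl | h)
        · exact (hm' _ hy).1 hsS
        · exact (hm' _ hy).1 (h ▸ hs1S)
      obtain ⟨v, hv, h⟩ := h3S u hu.1 B' this hne'
      exact (hm' v hv).1 h
    · rintro ⟨c, α, β, hc, hab⟩
      obtain ⟨d, hd, hd1⟩ := hg.at α (c s) (c s1) (hc.2.1 s ⟨hs, hsB⟩ hsS).symm
        (hc.2.1 s1 ⟨hs1, hs1B⟩ hs1S).symm (hc.1 s ⟨hs, hsB⟩ s1 ⟨hs1, hs1B⟩ hadj)
      let f : V → Fin n := fun v => if v ∈ B then d v else c v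
      have f1 : ∀ v ∈ B, f v = d v := fun v hv => by simp [f, hv]
      have f2 : ∀ v ∈ W \ B, f v = c v := fun v hv => by simp [f, hv.2]
      have hWe : W = W \ B ∪ B := by
        rw [Set.sdiff_union_self, Set.union_eq_left.2 hBW]
      refine he ⟨f, α, β, ⟨?_, ?_, ?_⟩, hab⟩
      · rw [hWe]
        refine hc.1.glue2 hd.1 f2 f1 ?_
        intro u hu v hv huv
        rw [f1 v hv, f2 u hu]
        by_cases h1 : u = s
        · subst h1; exact (hd.2.2 v hv huv).symm
        · by_cases h2 : u = s1
          · subst h2; exact (hd1 v hv huv).symm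
          · exact absurd (hB.2 v hv u ⟨hu.1, by simp [h1, h2]⟩ huv.symm) hu.2
      · intro v hv h
        by_cases hvB : v ∈ B
        · rw [f1 v hvB]; exact hd.2.1 v hvB h
        · rw [f2 v ⟨hv, hvB⟩]; exact hc.2.1 v ⟨hv, hvB⟩ h
      · intro v hv h
        by_cases hvB : v ∈ B
        · exact absurd h (hmiss v hvB)
        · rw [f2 v ⟨hv, hvB⟩]; exact hc.2.2 v ⟨hv, hvB⟩ h
  exact this.map 0 fun a b l ha hb hl => ⟨a, b, l, ha, hb, hl.mono sdiff_subset, rfl⟩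

theorem stepTri {W S T : Set V} {m : ℕ} {e : Prop} (ih : RCfor G W.ncard) (hm : 2 ≤ m)
    (hW : Conn G W)
    (h3T : ∀ w ∈ W, ∀ B, Cl G (W \ {w}) B → B.Nonempty → ∃ v ∈ B, v ∈ T)
    (he : ¬ CC G W S T (m + 1) e)
    {s s1 : V} (hs : s ∈ W) (hsS : s ∈ S) (hs1 : s1 ∈ W) (hs1S : s1 ∈ S)
    (hadj : G.Adj s s1)
    (h4 : ∀ B, Cl G (W \ {s, s1}) B → B.Nonempty → ∃ v ∈ B, v ∈ T) : Run G W S T m := by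
  classical
  have hunc : ¬ CC G (W \ {s}) (S ∩ G.neighborSet s) T m e := by
    rintro ⟨c, α, β, hc, hab⟩
    let f : V → Fin (m + 1) := fun v => if v = s then Fin.last m else
      if v ∈ S ∧ ¬ G.Adj s v ∧ c v = α then Fin.last m else (c v).castSucc
    have hl : ∀ x : Fin m, x.castSucc ≠ Fin.last m := fun x => (Fin.castSucc_lt_last x).ne
    have fs : f s = Fin.last m := by simp [f]
    have hne : ∀ v ∈ W, v ≠ s → v ∈ W \ {s} := fun v hv h => ⟨hv, h⟩
    have fadj : ∀ v ∈ W, G.Adj s v → f v = (c v).castSucc := fun v hv h => by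
      simp [f, h.ne.symm, h]
    refine he ⟨f, α.castSucc, β.castSucc, ⟨?_, ?_, ?_⟩, by simpa using hab⟩
    · intro u hu v hv huv
      by_cases hus : u = s
      · subst hus
        rw [fs, fadj v hv huv]
        exact (hl _).symm
      · by_cases hvs : v = s
        · subst hvs
          rw [fs, fadj u hu huv.symm]
          exact hl _
        · have hcc := hc.1 u (hne u hu hus) v (hne v hv hvs) huv
          simp only [f, hus, hvs, if_false]
          split_ifs with h1 h2 h2
          · exact absurd (h1.2.2.trans h2.2.2.symm) hcc
          · exact (hl _).symm
          · exact hl _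
          · simpa using hcc
    · intro v hv hvS
      by_cases hvs : v = s
      · subst hvs; rw [fs]; exact (hl _).symm
      · by_cases h : G.Adj s v
        · rw [fadj v hv h]
          simpa using hc.2.1 v (hne v hv hvs) ⟨hvS, h⟩
        · simp only [f, hvs, if_false]
          split_ifs with h1
          · exact (hl _).symm
          · intro h2
            exact h1 ⟨hvS, h, by simpa using h2⟩
    · intro v hv hvT
      by_cases hvs : v = s
      · subst hvs; rw [fs]; exact (hl _).symm
      · simp only [f, hvs, if_false]
        split_ifs with h1
        · exact (hl _).symm
        · simpa using hc.2.2 v (hne v hv hvs) hvT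
  obtain ⟨C, hC, hCc, hCne, hCe⟩ := exists_bad hm hunc
  have hCW : C ⊆ W := fun x hx => (hC.1 hx).1
  have hsC : s ∉ C := fun h => (hC.1 h).2 rfl
  have hCT := h3T s hs C hC hCne
  by_cases hs1C : s1 ∈ C
  · by_cases hh2 : H2 G C (S ∩ G.neighborSet s) T m
    · have hrun := ih C (card_lt hCW hs hsC) (S ∩ G.neighborSet s) T m hm hCc ⟨s1, hs1C, hs1S, hadj⟩ hCT hh2 e hCe
      have := hrun.map2 (S' := S) (T' := T) (W' := W) 0 (by omega) (by
        intro a b l ha hb hl d hd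
        rcases (by omega : d = 0 ∨ d = 1) with rfl | rfl
        · exact ⟨a, b, l, ha.1, hb, hl.mono hCW, rfl⟩
        · exact ⟨s, b, s :: l, hsS, hb, (hl.cons ha.2 hsC).mono (insert_subset hs hCW), by simp⟩)
      rwa [Nat.sub_add_cancel (by omega)] at this
    · unfold H2 at hh2
      push Not at hh2
      obtain ⟨u, hu, B, hB, hBne, hBm, hBc⟩ := hh2
      have huW := hCW hu
      have huB : u ∉ B := fun h => (hB.1 h).2 rfl
      have hB' : ¬ CC G B (G.neighborSet s) (G.neighborSet u) m False := by
        rintro ⟨c, α, β, hc, -⟩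
        refine hBc (fun v => if v = u then β else c v) ?_
        rintro x (rfl | hx) y (rfl | hy) hxy
        · exact absurd hxy (G.irrefl)
        · have : y ≠ x := fun h => huB (h ▸ hy)
          simpa [this] using (hc.2.2 y hy hxy).symm
        · have : x ≠ y := fun h => huB (h ▸ hx)
          simpa [this] using (hc.2.2 x hx hxy.symm)
        · have h1 : x ≠ u := fun h => huB (h ▸ hx)
          have h2 : y ≠ u := fun h => huB (h ▸ hy)
          simpa [h1, h2] using hc.1 x hx y hy hxy
      obtain ⟨B1, hB1, hB1c, hB1ne, hB1e⟩ := exists_bad hm hB'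
      have hB1C : Cl G (C \ {u}) B1 := hB.trans hB1
      have hB1W : B1 ⊆ W := fun x hx => hCW (hB1C.1 hx).1
      have huB1 : u ∉ B1 := fun h => (hB1C.1 h).2 rfl
      have hsB1 : s ∉ B1 := fun h => hsC (hB1C.1 h).1
      have hs1B1 : s1 ∉ B1 := fun h => (hBm s1 (hB1.1 h)).1 ⟨hs1S, hadj⟩
      have hB1T : ∀ v ∈ B1, v ∉ T := fun v hv => (hBm v (hB1.1 hv)).2
      -- step out of B1: only to s, u
      have hout : ∀ x ∈ B1, ∀ v ∈ W, G.Adj x v → v = s ∨ v = u ∨ v ∈ B1 := by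
        intro x hx v hv hxv
        by_cases hvs : v = s
        · exact Or.inl hvs
        · by_cases hvu : v = u
          · exact Or.inr (Or.inl hvu)
          · exact Or.inr (Or.inr (hB1C.2 x hx v
              ⟨hC.2 x (hB1C.1 hx).1 v ⟨hv, hvs⟩ hxv, hvu⟩ hxv))
      have hbadT : ∀ w ∈ W, ¬ Cl G (W \ {w}) B1 := fun w hw hcl => by
        obtain ⟨v, hv, h⟩ := h3T w hw B1 hcl hB1ne
        exact hB1T v hv h
      have hNs : ∃ v ∈ B1, v ∈ G.neighborSet s := by
        by_contra! h
        refine hbadT u huW ⟨fun x hx => ⟨hB1W hx, fun h => huB1 (h ▸ hx)⟩, fun x hx v hv hxv => ?_⟩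
        rcases hout x hx v hv.1 hxv with rfl | rfl | h'
        · exact absurd hxv.symm (h x hx)
        · exact absurd rfl hv.2
        · exact h'
      have hNu : ∃ v ∈ B1, v ∈ G.neighborSet u := by
        by_contra! h
        refine hbadT s hs ⟨fun x hx => ⟨hB1W hx, fun h => hsB1 (h ▸ hx)⟩, fun x hx v hv hxv => ?_⟩
        rcases hout x hx v hv.1 hxv with rfl | rfl | h'
        · exact absurd rfl hv.2
        · exact absurd hxv.symm (h x hx)
        · exact h'
      have hrun : Run G B1 (G.neighborSet s) (G.neighborSet u) (m - 1) := by
        refine ih B1 (card_lt hB1W hs hsB1) _ _ m hm hB1c hNs hNu ?_ False hB1e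
        apply H2.vac
        intro u' hu' B' hB' hne' hm'
        have : Cl G (W \ {u'}) B' := by
          refine ⟨fun x hx => ⟨hB1W (hB'.1 hx).1, (hB'.1 hx).2⟩, fun x hx v hv hxv => ?_⟩
          rcases hout x (hB'.1 hx).1 v hv.1 hxv with rfl | rfl | h'
          · exact absurd hxv.symm (hm' x hx).1
          · exact absurd hxv.symm (hm' x hx).2
          · exact hB'.2 x hx v ⟨h', hv.2⟩ hxv
        obtain ⟨v, hv, h⟩ := h3T u' (hB1W hu') B' this hne'
        exact hB1T v (hB'.1 hv).1 h
      have hus : u ≠ s := fun h => hsC (h ▸ hu)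
      have hus1 : u ≠ s1 := by
        rintro rfl
        obtain ⟨v, hv, h⟩ := h4 B1 ⟨fun x hx => ⟨hB1W hx, by
          rintro (h | h)
          · exact hsB1 (h ▸ hx)
          · exact huB1 (h ▸ hx)⟩, fun x hx v hv hxv => by
          rcases hout x hx v hv.1 hxv with h | h | h'
          · exact absurd (Or.inl h) hv.2
          · exact absurd (Or.inr h) hv.2
          · exact h'⟩ hB1ne
        exact hB1T v hv h
      have huW' : u ∈ W \ {s, s1} := ⟨huW, by simp [hus, hus1]⟩
      obtain ⟨t, ht, htT⟩ := h4 (K G (W \ {s, s1}) u) (K_cl _ _) ⟨u, K_self huW'⟩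
      have hdel : Conn G (K G (W \ {s, s1}) u \ (B1 ∩ K G (W \ {s, s1}) u)) := by
        refine (K_conn huW').del (K_self huW') ⟨fun y hy => ⟨hy.2, fun h => huB1 (h ▸ hy.1)⟩, ?_⟩
        intro x hx v hv hxv
        refine ⟨?_, hv.1⟩
        rcases hout x hx.1 v hv.1.1.1 hxv with h | h | h'
        · exact absurd (Or.inl h) hv.1.1.2
        · exact absurd h hv.2
        · exact h'
      obtain ⟨tl, htl⟩ := hdel.path (a := u) (b := t) ⟨K_self huW', fun h => huB1 h.1⟩
        ⟨ht, fun h => hB1T t h.1 htT⟩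
      have := hrun.map2 (S' := S) (T' := T) (W' := W) (tl.length + 1) (by omega) (by
        intro a b l ha hb hl d hd
        have h1 := hl.append htl hb.symm (fun v hv hv' => hv'.2 ⟨hv, hv'.1⟩)
        have h2 := h1.cons ha (by
          rintro (h | h)
          · exact hsB1 h
          · exact h.1.1.2 (Or.inl rfl))
        have hsub : insert s (B1 ∪ (K G (W \ {s, s1}) u \ (B1 ∩ K G (W \ {s, s1}) u))) ⊆ W :=
          insert_subset hs (union_subset hB1W (fun y hy => hy.1.1.1))
        rcases (by omega : d = 0 ∨ d = 1) with rfl | rfl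
        · exact ⟨s, t, _, hsS, htT, h2.mono hsub, by simp; omega⟩
        · refine ⟨s1, t, _, hs1S, htT, (h2.cons hadj.symm ?_).mono (insert_subset hs1 hsub),
            by simp; omega⟩
          rintro (h | h | h)
          · exact hadj.ne h.symm
          · exact hs1B1 h
          · exact h.1.1.2 (Or.inr rfl))
      rwa [Nat.sub_add_cancel (by omega)] at this
  · have hrun : Run G C (G.neighborSet s) T (m - 1) := by
      refine ih C (card_lt hCW hs hsC) _ T m hm hCc (hW.nbr hs hC hCne) hCT ?_ e
        (fun h => hCe (h.mono subset_rfl (fun x hx => hx.1.2) (fun x hx => hx.1)))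
      apply H2.vac
      intro u hu B hB hne hm'
      have : Cl G (W \ {u}) B := by
        refine ⟨fun x hx => ⟨hCW (hB.1 hx).1, (hB.1 hx).2⟩, fun x hx v hv hxv => ?_⟩
        refine hB.2 x hx v ⟨hC.2 x (hB.1 hx).1 v ⟨hv.1, ?_⟩ hxv, hv.2⟩ hxv
        rintro rfl
        exact (hm' x hx).1 hxv.symm
      obtain ⟨v, hv, h⟩ := h3T u (hCW hu) B this hne
      exact (hm' v hv).2 h
    have := hrun.map2 (S' := S) (T' := T) (W' := W) 1 (by omega) (by
      intro a b l ha hb hl d hd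
      have h2 := hl.cons ha hsC
      rcases (by omega : d = 0 ∨ d = 1) with rfl | rfl
      · exact ⟨s, b, _, hsS, hb, h2.mono (insert_subset hs hCW), by simp⟩
      · refine ⟨s1, b, _, hs1S, hb, (h2.cons hadj.symm ?_).mono
          (insert_subset hs1 (insert_subset hs hCW)), by simp⟩
        rintro (h | h)
        · exact hadj.ne h.symm
        · exact hs1C h)
    rwa [Nat.sub_add_cancel (by omega)] at this

theorem indLemma {W S T D : Set V} {n : ℕ} (ih : RCfor G W.ncard) (hn : 2 ≤ n)
    (hW : Conn G W) (hS : ∃ v ∈ W, v ∈ S) (hT : ∃ v ∈ W, v ∈ T)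
    (hD : Cl G (W \ S) D) (hDc : Conn G D) (hDne : D.Nonempty)
    (he : ¬ CC G D {v | ∃ s ∈ W, s ∈ S ∧ G.Adj s v} T n False)
    (H : ∀ w ∈ W, ∀ B ⊆ D, Cl G (W \ {w}) B → B.Nonempty → ∃ v ∈ B, v ∈ T) :
    Run G W S T (n - 1) := by
  have hDW : D ⊆ W := fun x hx => (hD.1 hx).1
  obtain ⟨s0, hs0, hs0S⟩ := hS
  have hs0D : s0 ∉ D := fun h => (hD.1 h).2 hs0S
  have hlt := card_lt hDW hs0 hs0D
  by_cases hTD : ∃ v ∈ D, v ∈ T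
  · have hrun : Run G D {v | ∃ s ∈ W, s ∈ S ∧ G.Adj s v} T (n - 1) := by
      refine ih D hlt _ T n hn hDc ?_ hTD ?_ False he
      · obtain ⟨x, hx, y, hy, hyD, hxy⟩ := hW.out hDW hDne hs0 hs0D
        refine ⟨x, hx, y, hy, ?_, hxy.symm⟩
        by_contra h
        exact hyD (hD.2 x hx y ⟨hy, h⟩ hxy)
      · apply H2.vac
        intro u hu B hB hne hm
        have : Cl G (W \ {u}) B := by
          refine ⟨fun x hx => ⟨hDW (hB.1 hx).1, (hB.1 hx).2⟩, fun x hx v hv hxv => ?_⟩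
          refine hB.2 x hx v ⟨hD.2 x (hB.1 hx).1 v ⟨hv.1, fun h => ?_⟩ hxv, hv.2⟩ hxv
          exact (hm x hx).1 ⟨v, hv.1, h, hxv.symm⟩
        obtain ⟨v, hv, h⟩ := H u (hDW hu) B (fun x hx => (hB.1 hx).1) this hne
        exact (hm v hv).2 h
    refine hrun.map 1 ?_
    rintro a b l ⟨s, hs, hsS, hsa⟩ hb hl
    exact ⟨s, b, s :: l, hsS, hb, (hl.cons hsa (fun h => (hD.1 h).2 hsS)).mono
      (insert_subset hs hDW), by simp⟩
  · push Not at hTD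
    obtain ⟨t, ht, htT⟩ := hT
    obtain ⟨d0, hd0⟩ := hDne
    obtain ⟨l0, hl0⟩ := hW.path (hDW hd0) ht
    obtain ⟨e2, q, hQ, hq, hqQ⟩ := hl0.lastExit
      (fun v => v ∈ D ∨ (v ∈ S ∧ ∃ d ∈ D, G.Adj v d)) (Or.inl hd0)
    have he2W : e2 ∈ W := hq.3 e2 (by simp)
    have hQ' : e2 ∈ S ∧ ∃ d ∈ D, G.Adj e2 d := by
      rcases hQ with hQ | hQ
      · exfalso
        cases q with
        | nil =>
          have h := hq.5
          simp at h
          exact hTD e2 hQ (h ▸ htT)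
        | cons y q =>
          have hy : G.Adj e2 y := by
            have := hq.1
            rw [List.isChain_cons_cons] at this
            exact this.1
          have hyQ := hqQ y (by simp)
          have hyW : y ∈ W := hq.3 y (by simp)
          apply hyQ
          by_cases hyS : y ∈ S
          · exact Or.inr ⟨hyS, e2, hQ, hy.symm⟩
          · exact Or.inl (hD.2 e2 hQ y ⟨hyW, hyS⟩ hy)
      · exact hQ
    obtain ⟨he2S, d1, hd1, he2d1⟩ := hQ'
    have hrun : Run G D {v | ∃ s ∈ W, (s ∈ S ∧ s ≠ e2) ∧ G.Adj s v} (G.neighborSet e2) (n - 1) := by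
      have hcase : ∀ B ⊆ D, ∀ w ∈ W, (∀ x ∈ B, ∀ v ∈ W, v ≠ w → v ∈ S → ¬ G.Adj x v) →
          B.Nonempty → ¬ Cl G (D \ {w}) B := by
        intro B hBD w hw hBS hne hB
        have : Cl G (W \ {w}) B := by
          refine ⟨fun x hx => ⟨hDW (hBD hx), (hB.1 hx).2⟩, fun x hx v hv hxv => ?_⟩
          refine hB.2 x hx v ⟨hD.2 x (hBD hx) v ⟨hv.1, fun h => ?_⟩ hxv, hv.2⟩ hxv
          exact hBS x hx v hv.1 hv.2 h hxv
        obtain ⟨v, hv, h⟩ := H w hw B hBD this hne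
        exact hTD v (hBD hv) h
      refine ih D hlt _ _ n hn hDc ?_ ⟨d1, hd1, he2d1⟩ ?_ True ?_
      · by_contra! h
        refine hcase D subset_rfl e2 he2W ?_ ⟨d0, hd0⟩ ⟨fun x hx => ⟨hx, fun h =>
          (hD.1 hx).2 (h ▸ he2S)⟩, fun x hx v hv hxv => hv.1⟩
        intro x hx v hv hve hvS hxv
        exact h x hx ⟨v, hv, ⟨hvS, hve⟩, hxv.symm⟩
      · apply H2.vac
        intro u hu B hB hne hm
        refine hcase B (fun x hx => (hB.1 hx).1) u (hDW hu) ?_ hne hB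
        intro x hx v hv hvu hvS hxv
        by_cases hve : v = e2
        · exact (hm x hx).2 (hve ▸ hxv.symm)
        · exact (hm x hx).1 ⟨v, hv, ⟨hvS, hve⟩, hxv.symm⟩
      · rintro ⟨c, α, β, hc, hab⟩
        have hab : α = β := by simpa using hab
        subst hab
        obtain ⟨γ, hγ⟩ := exists_ne_fin hn α
        refine he ⟨c, α, γ, ⟨hc.1, ?_, fun v hv h => absurd h (hTD v hv)⟩, by simp [hγ.symm]⟩
        rintro v hv ⟨s, hs, hsS, hsv⟩
        by_cases hse : s = e2
        · exact hc.2.2 v hv (hse ▸ hsv)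
        · exact hc.2.1 v hv ⟨s, hs, ⟨hsS, hse⟩, hsv⟩
    refine hrun.map (q.length + 2) ?_
    rintro a b l ⟨s, hs, ⟨hsS, hse⟩, hsa⟩ hb hl
    have hτ : Pth G {v | v ∈ W ∧ v ∈ e2 :: q} e2 t (e2 :: q) :=
      ⟨hq.1, hq.2, fun v hv => ⟨hq.3 v hv, hv⟩, hq.4, hq.5⟩
    have h1 := hl.append hτ hb.symm (by
      intro v hv hv'
      rcases List.mem_cons.1 hv'.2 with rfl | h
      · exact (hD.1 hv).2 he2S
      · exact hqQ v h (Or.inl hv))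
    have h2 := h1.cons hsa (by
      rintro (h | h)
      · exact (hD.1 h).2 hsS
      · rcases List.mem_cons.1 h.2 with h | h
        · exact hse h
        · exact hqQ s h (Or.inr ⟨hsS, a, hl.3 a hl.head_mem, hsa⟩))
    exact ⟨s, t, _, hsS, htT, h2.mono (insert_subset hs (union_subset hDW fun x hx => hx.1)),
      by simp; omega⟩

theorem stepInd {W S T : Set V} {n : ℕ} {e : Prop} (ih : RCfor G W.ncard) (hn : 3 ≤ n)
    (hW : Conn G W) (hS : ∃ v ∈ W, v ∈ S) (hT : ∃ v ∈ W, v ∈ T)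
    (h3T : ∀ w ∈ W, ∀ B, Cl G (W \ {w}) B → B.Nonempty → ∃ v ∈ B, v ∈ T)
    (he : ¬ CC G W S T n e)
    (hind : ∀ s ∈ W, s ∈ S → ∀ s1 ∈ W, s1 ∈ S → ¬ G.Adj s s1) : Run G W S T (n - 1) := by
  classical
  have hunc : ¬ CC G (W \ S) {v | ∃ s ∈ W, s ∈ S ∧ G.Adj s v} T n False := by
    rintro ⟨c, α, β, hc, hab⟩
    have hab : α ≠ β := by simpa using hab
    obtain ⟨x, hx, hxe⟩ : ∃ x : Fin n, x ≠ α ∧ (x = β ↔ e) := by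
      by_cases h : e
      · exact ⟨β, hab.symm, by simp [h]⟩
      · obtain ⟨γ, h1, h2⟩ := exists_third hn α β
        exact ⟨γ, h1, by simp [h, h2]⟩
    refine he ⟨fun v => if v ∈ S then α else c v, x, β, ⟨?_, ?_, ?_⟩, hxe⟩
    · intro u hu v hv huv
      by_cases h1 : u ∈ S
      · by_cases h2 : v ∈ S
        · exact absurd huv (hind u hu h1 v hv h2)
        · simpa [h1, h2] using (hc.2.1 v ⟨hv, h2⟩ ⟨u, hu, h1, huv⟩).symm
      · by_cases h2 : v ∈ S
        · simpa [h1, h2] using (hc.2.1 u ⟨hu, h1⟩ ⟨v, hv, h2, huv.symm⟩)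
        · simpa [h1, h2] using hc.1 u ⟨hu, h1⟩ v ⟨hv, h2⟩ huv
    · intro v hv h
      simpa [h] using hx.symm
    · intro v hv h
      by_cases h1 : v ∈ S
      · simpa [h1] using hab
      · simpa [h1] using hc.2.2 v ⟨hv, h1⟩ h
  obtain ⟨D, hD, hDc, hDne, hDe⟩ := exists_bad (by omega) hunc
  exact indLemma ih (by omega) hW hS hT hD hDc hDne hDe (fun w hw B _ hB hne => h3T w hw B hB hne)

theorem RC_all (N : ℕ) : RCfor G N := by
  induction N with
  | zero => intro W h; omega
  | succ N IH =>
  intro W hWN S T n hn hW hS hT h2 e he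
  have ih : RCfor G W.ncard := fun W' hW' => IH W' (by omega)
  by_cases hn2 : n = 2
  · subst hn2
    obtain ⟨s, hs, hsS⟩ := hS
    obtain ⟨t, ht, htT⟩ := hT
    obtain ⟨l, hl⟩ := hW.path hs ht
    refine ⟨l.length, fun i hi => ⟨s, t, l, hsS, htT, hl, by omega⟩⟩
  have hn3 : 3 ≤ n := by omega
  by_contra hcon
  have h2' : ∀ w ∈ W, ∀ B, Cl G (W \ {w}) B → B.Nonempty → ∃ v ∈ B, v ∈ S ∨ v ∈ T := by
    intro w hw B hB hne
    by_contra! h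
    exact hcon (step0 ih hn hW hS hT h2 he hw hB hne h)
  have hg : ∀ w ∈ W, ∀ B, Cl G (W \ {w}) B → (∀ v ∈ B, v ∉ T) →
      ∀ e, CC G B S (G.neighborSet w) n e := by
    intro w hw B hB hm e
    by_contra h
    obtain ⟨C, hC, hCc, hCne, hCe⟩ := exists_bad hn h
    exact hcon (step1a ih hn hW hT h2' hw (hB.trans hC) hCc hCne (fun v hv => hm v (hC.1 hv)) hCe)
  have hg' : ∀ w ∈ W, ∀ B, Cl G (W \ {w}) B → (∀ v ∈ B, v ∉ S) →
      ∀ e, CC G B T (G.neighborSet w) n e := by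
    intro w hw B hB hm e
    by_contra h
    obtain ⟨C, hC, hCc, hCne, hCe⟩ := exists_bad hn h
    refine hcon (step1a ih hn hW hS ?_ hw (hB.trans hC) hCc hCne (fun v hv => hm v (hC.1 hv)) hCe).symm
    intro w hw B hB hne
    obtain ⟨v, hv, h⟩ := h2' w hw B hB hne
    exact ⟨v, hv, h.symm⟩
  have ha : ∀ w ∈ W, ∀ B, Cl G (W \ {w}) B → B.Nonempty → (∀ v ∈ B, v ∉ T) →
      ∀ v ∈ W, v ∈ S → v ∈ B := by
    intro w hw B hB hne hm v hv hvS
    by_contra h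
    exact hcon (step1b ih hn hW hT h2 he hg hw hB hne hm ⟨v, hv, h, hvS⟩)
  have ha' : ∀ w ∈ W, ∀ B, Cl G (W \ {w}) B → B.Nonempty → (∀ v ∈ B, v ∉ S) →
      ∀ v ∈ W, v ∈ T → v ∈ B := by
    intro w hw B hB hne hm v hv hvS
    by_contra h
    exact hcon (step1b ih hn hW hS h2.symm (fun h => he h.symm) hg' hw hB hne hm ⟨v, hv, h, hvS⟩).symm
  have h3T : ∀ w ∈ W, ∀ B, Cl G (W \ {w}) B → B.Nonempty → ∃ v ∈ B, v ∈ T := by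
    intro w hw B hB hne
    by_contra! h
    exact step1c hn he hg hg' ha ha' hw hB hne h
  have h3S : ∀ w ∈ W, ∀ B, Cl G (W \ {w}) B → B.Nonempty → ∃ v ∈ B, v ∈ S := by
    intro w hw B hB hne
    by_contra! h
    exact step1c hn (fun h => he h.symm) hg' hg ha' ha hw hB hne h
  by_cases hadj : ∃ s ∈ W, s ∈ S ∧ ∃ s1 ∈ W, s1 ∈ S ∧ G.Adj s s1
  · obtain ⟨s, hs, hsS, s1, hs1, hs1S, hadj⟩ := hadj
    obtain ⟨m, rfl⟩ : ∃ m, n = m + 1 := ⟨n - 1, by omega⟩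
    refine hcon (stepTri ih (by omega) hW h3T he hs hsS hs1 hs1S hadj ?_)
    intro B hB hne
    by_contra! hm
    by_cases hcs : CS G B S s s1 (m + 1)
    · exact hcon (step2b ih hn hW hT h3S he hs hsS hs1 hs1S hadj hB hne hm hcs)
    · obtain ⟨a, ha, hca⟩ : ∃ a ∈ B, ¬ CS G (K G B a) S s s1 (m + 1) := by
        by_contra! h
        exact hcs (CS.comps hn3 h)
      exact hcon (step2a ih hn h3T h3S hs hsS hs1 hadj (hB.trans (K_cl B a)) (K_conn ha)
        ⟨a, K_self ha⟩ (fun v hv => hm v hv.1) hca)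
  · push Not at hadj
    exact hcon (stepInd ih hn3 hW hS hT h3T he hadj)

theorem RC {W S T : Set V} {n : ℕ} {e : Prop} (hn : 2 ≤ n) (hW : Conn G W)
    (hS : ∃ v ∈ W, v ∈ S) (hT : ∃ v ∈ W, v ∈ T) (h2 : H2 G W S T n) (he : ¬ CC G W S T n e) :
    Run G W S T (n - 1) :=
  RC_all (W.ncard + 1) W (by omega) S T n hn hW hS hT h2 e he

end OC

namespace OC
open Set

variable {V : Type*} {G : SimpleGraph V}

def CycL (G : SimpleGraph V) (n : ℕ) : Prop :=
  ∃ a b l, Pth G univ a b l ∧ G.Adj b a ∧ l.length = n ∧ 3 ≤ n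

def CR (G : SimpleGraph V) (k : ℕ) : Prop := ∃ m, ∀ i < k, CycL G (m + i)

theorem Pth.close {C : Set V} {a b : V} {l : List V} (hl : Pth G C a b l) (p : List V)
    (hp : (b :: (p ++ [a])).IsChain G.Adj) (hnd : p.Nodup) (hd : ∀ v ∈ p, v ∉ C)
    (hlen : 2 ≤ p.length) : CycL G (l.length + p.length) := by
  have hl0 : l ≠ [] := by rintro rfl; simpa using hl.4
  have hl1 : 0 < l.length := List.length_pos_of_ne_nil hl0
  obtain ⟨c, p', rfl⟩ : ∃ c p', p = c :: p' := by
    cases p with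
    | nil => simp at hlen
    | cons c p' => exact ⟨c, p', rfl⟩
  obtain ⟨d, hd'⟩ : ∃ d, (c :: p').getLast? = some d := by
    rw [List.getLast?_eq_getLast_of_ne_nil (by simp)]
    exact ⟨_, rfl⟩
  have h1 : G.Adj b c := by
    rw [List.cons_append, List.isChain_cons_cons] at hp
    exact hp.1
  have h2 : ((c :: p') ++ [a]).IsChain G.Adj := hp.tail
  rw [List.isChain_append] at h2
  have hP : Pth G {v | v ∈ c :: p'} c d (c :: p') := ⟨h2.1, hnd, fun v hv => hv, rfl, hd'⟩
  have h3 : G.Adj d a := h2.2.2 d hd' a (by simp)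
  have := hl.append hP h1 (fun v hv hv' => hd v hv' hv)
  exact ⟨a, d, _, this.mono (subset_univ _), h3, by simp, by omega⟩

theorem Run.close {C S T : Set V} {k N : ℕ} (h : Run G C S T k) (m0 : ℕ) (D : ℕ → Prop)
    (hf : ∀ a b l, a ∈ S → b ∈ T → Pth G C a b l → ∀ d, D d → CycL G (l.length + d))
    (hc : ∀ i < N, ∃ j < k, ∃ d, D d ∧ j + d = m0 + i) : CR G N := by
  obtain ⟨m, hm⟩ := h
  refine ⟨m + m0, fun i hi => ?_⟩
  obtain ⟨j, hj, d, hd, hjd⟩ := hc i hi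
  obtain ⟨a, b, l, ha, hb, hl, hk⟩ := hm j hj
  have := hf a b l ha hb hl d hd
  have he : l.length + d = m + m0 + i := by omega
  rwa [he] at this

def Crit (G : SimpleGraph V) (U : Set V) (n : ℕ) : Prop :=
  (¬ ∃ c : V → Fin n, Pr G U c) ∧ ∀ A ⊆ U, A ≠ U → ∃ c : V → Fin n, Pr G A c

theorem exists_crit [Finite V] {n : ℕ} {X : Set V} (h : ¬ ∃ c : V → Fin n, Pr G X c) :
    ∃ U ⊆ X, Crit G U n := by
  have hfin : {A : Set V | A ⊆ X ∧ ¬ ∃ c : V → Fin n, Pr G A c}.Finite := Set.toFinite _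
  obtain ⟨U, hU⟩ := hfin.exists_minimal ⟨X, subset_rfl, h⟩
  refine ⟨U, hU.1.1, hU.1.2, fun A hA hne => ?_⟩
  by_contra hc
  exact hne (Subset.antisymm hA (hU.2 ⟨hA.trans hU.1.1, hc⟩ hA))

theorem Crit.clique {U X : Set V} {n : ℕ} (hU : Crit G U n) (hXU : X ⊆ U)
    (hX : ∀ x ∈ X, ∀ y ∈ X, x ≠ y → G.Adj x y) : Conn G (U \ X) := by
  classical
  intro C hC hne
  by_contra hCne
  obtain ⟨z, hz, hzC⟩ : ∃ z ∈ U \ X, z ∉ C := by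
    by_contra! h
    exact hCne (Subset.antisymm hC.1 h)
  obtain ⟨y, hy⟩ := hne
  have hCU : C ⊆ U := fun x hx => (hC.1 hx).1
  obtain ⟨c1, h1⟩ := hU.2 (C ∪ X) (union_subset hCU hXU) (by
    intro h
    have : z ∈ C ∪ X := h ▸ hz.1
    rcases this with h | h
    · exact hzC h
    · exact hz.2 h)
  obtain ⟨c2, h2⟩ := hU.2 (U \ C) sdiff_subset (by
    intro h
    have : y ∈ U \ C := by rw [h]; exact hCU hy
    exact this.2 hy)
  have hXC : ∀ x ∈ X, x ∈ U \ C := fun x hx => ⟨hXU hx, fun h => (hC.1 h).2 hx⟩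
  obtain ⟨σ, hσ⟩ := perm_exists (fun x : X => c1 x) (fun x : X => c2 x) (by
    intro i j
    by_cases hij : i = j
    · simp [hij]
    · have hadj := hX i i.2 j j.2 (fun h => hij (Subtype.ext h))
      exact iff_of_false (h1 i (Or.inr i.2) j (Or.inr j.2) hadj)
        (h2 i (hXC i i.2) j (hXC j j.2) hadj))
  let f : V → Fin n := fun v => if v ∈ C then σ (c1 v) else c2 v
  have hUe : U = U \ C ∪ C := by
    rw [Set.sdiff_union_self, Set.union_eq_left.2 hCU]
  refine hU.1 ⟨f, ?_⟩
  rw [hUe]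
  have h1' := h1.comp σ.injective
  refine Pr.glue2 h2 (h1'.mono subset_union_left) (fun v hv => by simp [f, hv.2])
    (fun v hv => by simp [f, hv]) ?_
  intro u hu v hv huv
  have huX : u ∈ X := by
    by_contra h
    exact hu.2 (hC.2 v hv u ⟨hu.1, h⟩ huv.symm)
  have : f u = (σ ∘ c1) u := by simp [f, hu.2, ← hσ ⟨u, huX⟩]
  rw [this, show f v = (σ ∘ c1) v by simp [f, hv]]
  exact h1' u (Or.inr huX) v (Or.inl hv) huv

/-- convenient contradiction form of connectivity -/
theorem Conn.no {U X B : Set V} (hc : Conn G (U \ X)) (hBU : B ⊆ U) (hBX : ∀ x ∈ B, x ∉ X)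
    (hne : B.Nonempty) (hcl : ∀ x ∈ B, ∀ v ∈ U, G.Adj x v → v ∉ B → v ∈ X) {z : V} (hz : z ∈ U)
    (hzX : z ∉ X) (hzB : z ∉ B) : False := by
  have : Cl G (U \ X) B := ⟨fun x hx => ⟨hBU hx, hBX x hx⟩, fun x hx v hv hxv => by
    by_contra h
    exact hv.2 (hcl x hx v hv.1 hxv h)⟩
  have h := hc _ this hne
  exact hzB (h ▸ ⟨hz, hzX⟩)

theorem Crit.single {U : Set V} {n : ℕ} (hU : Crit G U n) {p : V} (hp : p ∈ U) :
    Conn G (U \ {p}) :=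
  hU.clique (by simpa using hp) (by rintro x rfl y rfl h; exact absurd rfl h)

variable [Finite V]

theorem twoCutAux {U : Set V} {n : ℕ} (hU : Crit G U n) (hn : 4 ≤ n) {p q : V}
    (hp : p ∈ U) (hq : q ∈ U) (hpq : p ≠ q) {B : Set V} (hB : Cl G (U \ {p, q}) B)
    {e : Prop} (he : ¬ CC G B (G.neighborSet p) (G.neighborSet q) n e) :
    Run G B (G.neighborSet p) (G.neighborSet q) (n - 1) := by
  obtain ⟨C, hC, hCc, hCne, hCe⟩ := exists_bad (by omega) he
  have hCU := hB.trans hC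
  have hpC : p ∉ C := fun h => (hCU.1 h).2 (by simp)
  have hqC : q ∉ C := fun h => (hCU.1 h).2 (by simp)
  have hout : ∀ x ∈ C, ∀ v ∈ U, G.Adj x v → v ∉ C → v = p ∨ v = q := by
    intro x hx v hv hxv hvC
    by_contra h
    exact hvC (hCU.2 x hx v ⟨hv, by simpa using h⟩ hxv)
  have hsub : C ⊆ U := fun x hx => (hCU.1 hx).1
  have hrun : Run G C (G.neighborSet p) (G.neighborSet q) (n - 1) := by
    refine RC (by omega) hCc ?_ ?_ ?_ hCe
    · by_contra! h
      refine (hU.single hq).no hsub (by rintro x hx rfl; exact hqC hx) hCne ?_ hp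
        (by simpa using hpq) hpC
      intro x hx v hv hxv hvC
      rcases hout x hx v hv hxv hvC with rfl | rfl
      · exact absurd hxv.symm (h x hx)
      · rfl
    · by_contra! h
      refine (hU.single hp).no hsub (by rintro x hx rfl; exact hpC hx) hCne ?_ hq
        (by simpa using hpq.symm) hqC
      intro x hx v hv hxv hvC
      rcases hout x hx v hv hxv hvC with rfl | rfl
      · rfl
      · exact absurd hxv.symm (h x hx)
    · apply H2.vac
      intro u hu B' hB' hne' hm'
      refine (hU.single (hsub hu)).no (fun x hx => hsub (hB'.1 hx).1) (fun x hx => (hB'.1 hx).2)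
        hne' ?_ hp (by rintro rfl; exact hpC hu) (fun h => hpC (hB'.1 h).1)
      intro x hx v hv hxv hvB
      by_contra hvu
      by_cases hvC : v ∈ C
      · exact hvB (hB'.2 x hx v ⟨hvC, hvu⟩ hxv)
      · rcases hout x (hB'.1 hx).1 v hv hxv hvC with rfl | rfl
        · exact (hm' x hx).1 hxv.symm
        · exact (hm' x hx).2 hxv.symm
  exact hrun.map 0 fun a b l ha hb hl => ⟨a, b, l, ha, hb, hl.mono hC.1, rfl⟩

theorem twoCut {U : Set V} {n : ℕ} (hU : Crit G U n) (hn : 4 ≤ n) (hno : ¬ CR G n) {p q : V}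
    (hp : p ∈ U) (hq : q ∈ U) (hpq : p ≠ q) : Conn G (U \ {p, q}) := by
  classical
  by_cases hadj : G.Adj p q
  · refine hU.clique (by rintro x (rfl | rfl) <;> assumption) ?_
    rintro x (rfl | rfl) y (rfl | rfl) h
    · exact absurd rfl h
    · exact hadj
    · exact hadj.symm
    · exact absurd rfl h
  intro B hB hne
  by_contra hBne
  obtain ⟨z, hz, hzB⟩ : ∃ z ∈ U \ {p, q}, z ∉ B := by
    by_contra! h
    exact hBne (Subset.antisymm hB.1 h)
  obtain ⟨y, hy⟩ := hne
  set O := (U \ {p, q}) \ B with hO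
  have hOc : Cl G (U \ {p, q}) O := ⟨sdiff_subset, fun u hu v hv huv =>
    ⟨hv, fun h => hu.2 (hB.2 v h u hu.1 huv.symm)⟩⟩
  have hpB : p ∉ B := fun h => (hB.1 h).2 (by simp)
  have hqB : q ∉ B := fun h => (hB.1 h).2 (by simp)
  have hpO : p ∉ O := fun h => (hOc.1 h).2 (by simp)
  have hqO : q ∉ O := fun h => (hOc.1 h).2 (by simp)
  -- colourability of each side
  have hside : ∀ X, Cl G (U \ {p, q}) X → (∃ z ∈ U \ {p, q}, z ∉ X) →
      ∃ e, CC G X (G.neighborSet p) (G.neighborSet q) n e := by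
    rintro X hX ⟨z, hz, hzX⟩
    obtain ⟨c, hc⟩ := hU.2 (X ∪ {p, q}) (union_subset (fun x hx => (hX.1 hx).1)
      (by rintro x (rfl | rfl) <;> assumption)) (by
      intro h
      have : z ∈ X ∪ {p, q} := h ▸ hz.1
      rcases this with h | h
      · exact hzX h
      · exact hz.2 h)
    refine ⟨_, c, c p, c q, ⟨hc.mono subset_union_left, ?_, ?_⟩, Iff.rfl⟩
    · exact fun v hv hpv => (hc p (by simp) v (Or.inl hv) hpv).symm
    · exact fun v hv hpv => (hc q (by simp) v (Or.inl hv) hpv).symm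
  have hboth : ∀ e, CC G B (G.neighborSet p) (G.neighborSet q) n e →
      CC G O (G.neighborSet p) (G.neighborSet q) n e → False := by
    rintro e hb ⟨c, α, β, hc, hab⟩
    obtain ⟨d, hd⟩ := hb.at α β hab
    let f : V → Fin n := fun v => if v = p then α else if v = q then β else
      if v ∈ B then d v else c v
    have fp : f p = α := by simp [f]
    have fq : f q = β := by simp [f, hpq.symm]
    have fB : ∀ v ∈ B, f v = d v := fun v hv => by
      have h1 : v ≠ p := fun h => hpB (h ▸ hv)
      have h2 : v ≠ q := fun h => hqB (h ▸ hv)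
      simp [f, h1, h2, hv]
    have fO : ∀ v ∈ O, f v = c v := fun v hv => by
      have h1 : v ≠ p := fun h => hpO (h ▸ hv)
      have h2 : v ≠ q := fun h => hqO (h ▸ hv)
      simp [f, h1, h2, hv.2]
    have hcase : ∀ v ∈ U, v = p ∨ v = q ∨ v ∈ B ∨ v ∈ O := by
      intro v hv
      by_cases h1 : v = p
      · exact Or.inl h1
      by_cases h2 : v = q
      · exact Or.inr (Or.inl h2)
      by_cases h3 : v ∈ B
      · exact Or.inr (Or.inr (Or.inl h3))
      · exact Or.inr (Or.inr (Or.inr ⟨⟨hv, by simp [h1, h2]⟩, h3⟩))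
    have hpv : ∀ v ∈ U, G.Adj p v → f v ≠ α := by
      intro v hv hpv
      rcases hcase v hv with rfl | rfl | h | h
      · exact absurd hpv G.irrefl
      · exact absurd hpv hadj
      · rw [fB v h]; exact hd.2.1 v h hpv
      · rw [fO v h]; exact hc.2.1 v h hpv
    have hqv : ∀ v ∈ U, G.Adj q v → f v ≠ β := by
      intro v hv hqv'
      rcases hcase v hv with h | h | h | h
      · exact absurd (h ▸ hqv'.symm) hadj
      · exact absurd (h ▸ hqv') G.irrefl
      · rw [fB v h]; exact hd.2.2 v h hqv'
      · rw [fO v h]; exact hc.2.2 v h hqv'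
    refine hU.1 ⟨f, fun u hu v hv huv => ?_⟩
    rcases hcase u hu with rfl | rfl | h | h
    · rw [fp]; exact (hpv v hv huv).symm
    · rw [fq]; exact (hqv v hv huv).symm
    · rcases hcase v hv with rfl | rfl | h' | h'
      · rw [fp]; exact hpv u hu huv.symm
      · rw [fq]; exact hqv u hu huv.symm
      · rw [fB u h, fB v h']; exact hd.1 u h v h' huv
      · exact absurd (hB.2 u h v h'.1 huv) h'.2
    · rcases hcase v hv with rfl | rfl | h' | h'
      · rw [fp]; exact hpv u hu huv.symm
      · rw [fq]; exact hqv u hu huv.symm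
      · exact absurd (hB.2 v h' u h.1 huv.symm) h.2
      · rw [fO u h, fO v h']; exact hc.1 u h v h' huv
  obtain ⟨e1, he1⟩ := hside B hB ⟨z, hz, hzB⟩
  obtain ⟨e2, he2⟩ := hside O hOc ⟨y, hB.1 hy, fun h => h.2 hy⟩
  have r1 := twoCutAux hU hn hp hq hpq hB (fun h => hboth e2 h he2)
  obtain ⟨m2, hm2⟩ := twoCutAux hU hn hp hq hpq hOc (fun h => hboth e1 he1 h)
  refine hno (r1.close (m2 + 2) (fun d => ∃ i < n - 1, d = m2 + i + 2) ?_ ?_)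
  · rintro a b l ha hb hl d ⟨i, hi, rfl⟩
    obtain ⟨a', b', l', ha', hb', hl', hk⟩ := hm2 i hi
    have h1 := (hl'.reverse.append (Pth.single (W := {p}) rfl) ha'.symm
      (by rintro v hv rfl; exact hpO hv)).cons (s := q) hb' (by
        rintro (h | h)
        · exact hqO h
        · exact hpq h.symm)
    have h2 := hl.append h1 hb.symm (by
      rintro v hv (rfl | h | rfl)
      · exact hqB hv
      · exact h.2 hv
      · exact hpB hv)
    have hl0 : 0 < l.length := List.length_pos_of_ne_nil (by rintro rfl; simpa using hl.4)
    refine ⟨a, p, _, h2.mono (subset_univ _), ha, by simp; omega, ?_⟩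
    have hl1 : 0 < l'.length := List.length_pos_of_ne_nil (by rintro rfl; simpa using hl'.4)
    omega
  · intro i hi
    rcases Nat.lt_or_ge i (n - 1) with h | h
    · exact ⟨i, h, m2 + 0 + 2, ⟨0, by omega, rfl⟩, by omega⟩
    · exact ⟨n - 2, by omega, m2 + (i - (n - 2)) + 2, ⟨i - (n - 2), by omega, rfl⟩, by omega⟩

theorem caseA {U : Set V} {k : ℕ} (hU : Crit G U (k + 1)) (hn : 3 ≤ k)
    (h3c : ∀ p ∈ U, ∀ q ∈ U, p ≠ q → Conn G (U \ {p, q}))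
    {y r1 m r2 : V} (hy : y ∈ U) (hr1 : r1 ∈ U) (hm : m ∈ U) (hr2 : r2 ∈ U)
    (h1 : G.Adj y r1) (h2 : G.Adj r1 m) (h3 : G.Adj m r2) (h4 : G.Adj r2 y)
    (hym : y ≠ m) (hr : r1 ≠ r2) (hna : ¬ G.Adj r1 r2) : CR G (k + 1) := by
  classical
  set W := U \ {y, r1, m, r2} with hW
  set S := G.neighborSet r1 ∪ G.neighborSet r2 with hS
  have hl : ∀ x : Fin k, x.castSucc ≠ Fin.last k := fun x => (Fin.castSucc_lt_last x).ne
  have hbad : ∃ a ∈ W, ((∃ v ∈ K G W a, v ∈ G.neighborSet y) ∧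
      ¬ CC G (K G W a) S (G.neighborSet y) k False) ∨ ((∀ v ∈ K G W a, v ∉ G.neighborSet y) ∧
      ¬ CC G (K G W a) S (G.neighborSet m) (k + 1) False) := by
    by_contra! hcon
    let α : Fin k := ⟨0, by omega⟩
    let β : Fin k := ⟨1, by omega⟩
    have hab : α ≠ β := by simp [α, β]
    obtain ⟨c, hc, hF⟩ := glue (G := G) W (fun v x => (v ∈ S ∧ x = α.castSucc) ∨
      (G.Adj y v ∧ x = β.castSucc) ∨ (G.Adj m v ∧ x = Fin.last k)) (by
      intro a ha
      by_cases hay : ∃ v ∈ K G W a, v ∈ G.neighborSet y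
      · obtain ⟨c, hc⟩ := ((hcon a ha).1 hay).at α β (by simp [hab])
        refine ⟨Fin.castSucc ∘ c, hc.1.comp (Fin.castSucc_injective k), fun v hv => ?_⟩
        rintro (⟨h1, h2⟩ | ⟨h1, h2⟩ | ⟨h1, h2⟩)
        · exact hc.2.1 v hv h1 (by simpa using h2)
        · exact hc.2.2 v hv h1 (by simpa using h2)
        · exact hl _ h2
      · push Not at hay
        obtain ⟨c, hc⟩ := ((hcon a ha).2 hay).at α.castSucc (Fin.last k) (by simpa using hl α)
        refine ⟨c, hc.1, fun v hv => ?_⟩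
        rintro (⟨h1, h2⟩ | ⟨h1, h2⟩ | ⟨h1, h2⟩)
        · exact hc.2.1 v hv h1 (by simpa using h2)
        · exact hay v hv h1
        · exact hc.2.2 v hv h1 h2)
    let f : V → Fin (k + 1) := fun v => if v = r1 ∨ v = r2 then α.castSucc else
      if v = y then β.castSucc else if v = m then Fin.last k else c v
    have f1 : f r1 = α.castSucc := by simp [f]
    have f2 : f r2 = α.castSucc := by simp [f]
    have fy : f y = β.castSucc := by simp [f, h1.ne, h4.ne.symm]
    have fm : f m = Fin.last k := by simp [f, h2.ne.symm, h3.ne, hym.symm]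
    have fW : ∀ v ∈ W, f v = c v := fun v hv => by
      have := hv.2
      simp only [mem_insert_iff, mem_singleton_iff, not_or] at this
      simp [f, this]
    have hcase : ∀ v ∈ U, v = y ∨ v = r1 ∨ v = m ∨ v = r2 ∨ v ∈ W := by
      intro v hv
      by_cases h : v ∈ ({y, r1, m, r2} : Set V)
      · simp at h; tauto
      · exact Or.inr (Or.inr (Or.inr (Or.inr ⟨hv, h⟩)))
    have hS1 : ∀ v ∈ W, G.Adj r1 v → c v ≠ α.castSucc := fun v hv h he =>
      hF v hv (Or.inl ⟨Or.inl h, he⟩)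
    have hS2 : ∀ v ∈ W, G.Adj r2 v → c v ≠ α.castSucc := fun v hv h he =>
      hF v hv (Or.inl ⟨Or.inr h, he⟩)
    have hSy : ∀ v ∈ W, G.Adj y v → c v ≠ β.castSucc := fun v hv h he =>
      hF v hv (Or.inr (Or.inl ⟨h, he⟩))
    have hSm : ∀ v ∈ W, G.Adj m v → c v ≠ Fin.last k := fun v hv h he =>
      hF v hv (Or.inr (Or.inr ⟨h, he⟩))
    have hab' : α.castSucc ≠ β.castSucc := by simpa using hab
    refine hU.1 ⟨f, fun u hu v hv huv => ?_⟩
    rcases hcase u hu with rfl | rfl | rfl | rfl | hu' <;>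
    rcases hcase v hv with rfl | rfl | rfl | rfl | hv' <;>
    first
    | exact absurd huv G.irrefl
    | exact absurd huv hna
    | exact absurd huv.symm hna
    | (simp only [f1, f2, fy, fm]; first | exact hab' | exact hab'.symm | exact hl _ | exact (hl _).symm)
    | (rw [fW v hv']; simp only [f1, f2, fy, fm]; first | exact (hS1 v hv' huv).symm | exact (hS2 v hv' huv).symm | exact (hSy v hv' huv).symm | exact (hSm v hv' huv).symm)
    | (rw [fW u hu']; simp only [f1, f2, fy, fm]; first | exact (hS1 u hu' huv.symm) | exact (hS2 u hu' huv.symm) | exact (hSy u hu' huv.symm) | exact (hSm u hu' huv.symm))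
    | (rw [fW u hu', fW v hv']; exact hc u hu' v hv' huv)
  obtain ⟨a, haW, hbad⟩ := hbad
  set C := K G W a with hC
  have hCW : Cl G W C := K_cl W a
  have hCne : C.Nonempty := ⟨a, K_self haW⟩
  have hCc : Conn G C := K_conn haW
  have hCU : C ⊆ U := fun x hx => (hCW.1 hx).1
  have hyC : y ∉ C := fun h => (hCW.1 h).2 (by simp)
  have hr1C : r1 ∉ C := fun h => (hCW.1 h).2 (by simp)
  have hmC : m ∉ C := fun h => (hCW.1 h).2 (by simp)
  have hr2C : r2 ∉ C := fun h => (hCW.1 h).2 (by simp)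
  have hout : ∀ x ∈ C, ∀ v ∈ U, G.Adj x v → v ∉ C → x ∉ S → v = y ∨ v = m := by
    intro x hx v hv hxv hvC hxS
    by_contra h
    push Not at h
    refine hvC (hCW.2 x hx v ⟨hv, ?_⟩ hxv)
    simp only [mem_insert_iff, mem_singleton_iff, not_or]
    refine ⟨h.1, ?_, h.2, ?_⟩
    · rintro rfl; exact hxS (Or.inl hxv.symm)
    · rintro rfl; exact hxS (Or.inr hxv.symm)
  have hCS : ∃ v ∈ C, v ∈ S := by
    by_contra! h
    refine (h3c y hy m hm hym).no hCU ?_ hCne ?_ hr1 (by simp [h1.ne.symm, h2.ne]) hr1C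
    · rintro x hx (rfl | rfl)
      · exact hyC hx
      · exact hmC hx
    · intro x hx v hv hxv hvC
      exact hout x hx v hv hxv hvC (h x hx)
  -- small B'
  have hsmall : ∀ u ∈ C, ∀ B', Cl G (C \ {u}) B' → B'.Nonempty → (∀ v ∈ B', v ∉ S ∧
      v ∉ G.neighborSet y) → False := by
    intro u hu B' hB' hne' hm'
    have hum : u ≠ m := fun h => hmC (h ▸ hu)
    refine (h3c u (hCU hu) m hm hum).no (fun x hx => hCU (hB'.1 hx).1) ?_ hne' ?_ hr1 ?_
      (fun h => hr1C (hB'.1 h).1)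
    · rintro x hx (rfl | rfl)
      · exact (hB'.1 hx).2 rfl
      · exact hmC (hB'.1 hx).1
    · intro x hx v hv hxv hvB
      by_contra hvu
      simp only [mem_insert_iff, mem_singleton_iff, not_or] at hvu
      by_cases hvC : v ∈ C
      · exact hvB (hB'.2 x hx v ⟨hvC, hvu.1⟩ hxv)
      · rcases hout x (hB'.1 hx).1 v hv hxv hvC (hm' x hx).1 with rfl | rfl
        · exact (hm' x hx).2 hxv.symm
        · exact hvu.2 rfl
    · simp only [mem_insert_iff, mem_singleton_iff, not_or]
      exact ⟨fun h => hr1C (h ▸ hu), h2.ne⟩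
  rcases hbad with ⟨hCy, hCe⟩ | ⟨hCy, hCe⟩
  · have hrun : Run G C S (G.neighborSet y) (k - 1) := by
      refine RC (by omega) hCc hCS hCy (H2.vac hsmall) hCe
    refine hrun.close 2 (fun d => d = 2 ∨ d = 4) ?_ ?_
    · rintro s t l hs ht hl d hd
      rcases hs with hs | hs
      · rcases hd with rfl | rfl
        · refine hl.close [y, r1] ?_ ?_ ?_ (by simp)
          · simp [h1]; exact ⟨ht.symm, hs⟩
          · simp [h1.ne]
          · simp [hyC, hr1C]
        · refine hl.close [y, r2, m, r1] ?_ ?_ ?_ (by simp)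
          · simp [h1, h2.symm, h3.symm, h4.symm]; exact ⟨ht.symm, hs⟩
          · simp [h1.ne, h2.ne.symm, h3.ne.symm, h4.ne.symm, hr.symm, hym]
          · simp [hyC, hr1C, hmC, hr2C]
      · rcases hd with rfl | rfl
        · refine hl.close [y, r2] ?_ ?_ ?_ (by simp)
          · simp [h4.symm]; exact ⟨ht.symm, hs⟩
          · simp [h4.ne.symm]
          · simp [hyC, hr2C]
        · refine hl.close [y, r1, m, r2] ?_ ?_ ?_ (by simp)
          · simp [h1, h2, h3]; exact ⟨ht.symm, hs⟩
          · simp [h1.ne, h2.ne, h3.ne, h4.ne.symm, hr, hym]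
          · simp [hyC, hr1C, hmC, hr2C]
    · intro i hi
      rcases Nat.lt_or_ge i (k - 1) with h | h
      · exact ⟨i, h, 2, Or.inl rfl, by omega⟩
      · exact ⟨i - 2, by omega, 4, Or.inr rfl, by omega⟩
  · have hCm : ∃ v ∈ C, v ∈ G.neighborSet m := by
      by_contra! h
      refine (h3c r1 hr1 r2 hr2 hr).no hCU ?_ hCne ?_ hy (by simp [h1.ne, h4.ne.symm]) hyC
      · rintro x hx (rfl | rfl)
        · exact hr1C hx
        · exact hr2C hx
      · intro x hx v hv hxv hvC
        by_contra hv'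
        simp only [mem_insert_iff, mem_singleton_iff, not_or] at hv'
        refine hvC (hCW.2 x hx v ⟨hv, ?_⟩ hxv)
        simp only [mem_insert_iff, mem_singleton_iff, not_or]
        refine ⟨?_, hv'.1, ?_, hv'.2⟩
        · rintro rfl; exact hCy x hx hxv.symm
        · rintro rfl; exact h x hx hxv.symm
    have hrun : Run G C S (G.neighborSet m) (k + 1 - 1) := by
      refine RC (by omega) hCc hCS hCm (H2.vac ?_) hCe
      intro u hu B' hB' hne' hm'
      exact hsmall u hu B' hB' hne' (fun v hv => ⟨(hm' v hv).1, hCy v (hB'.1 hv).1⟩)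
    refine hrun.close 2 (fun d => d = 2 ∨ d = 4) ?_ ?_
    · rintro s t l hs ht hl d hd
      rcases hs with hs | hs
      · rcases hd with rfl | rfl
        · refine hl.close [m, r1] ?_ ?_ ?_ (by simp)
          · simp [h2.symm]; exact ⟨ht.symm, hs⟩
          · simp [h2.ne.symm]
          · simp [hmC, hr1C]
        · refine hl.close [m, r2, y, r1] ?_ ?_ ?_ (by simp)
          · simp [h1, h3, h4]; exact ⟨ht.symm, hs⟩
          · simp [h1.ne, h2.ne.symm, h3.ne, h4.ne, hr.symm, hym.symm]
          · simp [hyC, hr1C, hmC, hr2C]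
      · rcases hd with rfl | rfl
        · refine hl.close [m, r2] ?_ ?_ ?_ (by simp)
          · simp [h3]; exact ⟨ht.symm, hs⟩
          · simp [h3.ne]
          · simp [hmC, hr2C]
        · refine hl.close [m, r1, y, r2] ?_ ?_ ?_ (by simp)
          · simp [h1.symm, h2.symm, h4.symm]; exact ⟨ht.symm, hs⟩
          · simp [h1.ne.symm, h2.ne.symm, h3.ne, h4.ne.symm, hr, hym.symm]
          · simp [hyC, hr1C, hmC, hr2C]
    · intro i hi
      rcases Nat.lt_or_ge i k with h | h
      · exact ⟨i, h, 2, Or.inl rfl, by omega⟩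
      · exact ⟨i - 2, by omega, 4, Or.inr rfl, by omega⟩

end OC

namespace OC
open Set

variable {V : Type*} {G : SimpleGraph V}

theorem clique_cyc {Q : Finset V} (hQ : ∀ x ∈ Q, ∀ y ∈ Q, x ≠ y → G.Adj x y) {n : ℕ}
    (h3 : 3 ≤ n) (hn : n ≤ Q.card) : CycL G n := by
  classical
  obtain ⟨P, hPQ, hP⟩ := Finset.exists_subset_card_eq hn
  have hlen : P.toList.length = n := by simp [hP]
  have hnd : P.toList.Nodup := P.nodup_toList
  have hmem : ∀ v ∈ P.toList, v ∈ Q := fun v hv => hPQ (by simpa using hv)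
  have hne : P.toList ≠ [] := by intro h; rw [h] at hlen; simp at hlen; omega
  have hpw : P.toList.Pairwise G.Adj := by
    refine List.Pairwise.imp_of_mem ?_ hnd
    intro x y hx hy hxy
    exact hQ x (hmem x hx) y (hmem y hy) hxy
  refine ⟨P.toList.head hne, P.toList.getLast hne, P.toList, ⟨hpw.isChain, hnd,
    fun _ _ => trivial, List.head?_eq_some_head hne, List.getLast?_eq_some_getLast hne⟩, ?_, hlen, h3⟩
  refine hQ _ (hmem _ (List.getLast_mem hne)) _ (hmem _ (List.head_mem hne)) ?_
  rw [List.head_eq_getElem, List.getLast_eq_getElem]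
  intro h
  have := (hnd.getElem_inj_iff).1 h
  omega

variable [Finite V]

theorem caseB {U : Set V} {k : ℕ} (hU : Crit G U (k + 1)) (hn : 3 ≤ k)
    (hA : ∀ y ∈ U, ∀ r1 ∈ U, ∀ m ∈ U, ∀ r2 ∈ U, G.Adj y r1 → G.Adj r1 m → G.Adj m r2 →
      G.Adj r2 y → y ≠ m → r1 ≠ r2 → G.Adj r1 r2)
    {a b c d : V} (ha : a ∈ U) (hb : b ∈ U) (hc : c ∈ U) (hd : d ∈ U)
    (hab : G.Adj a b) (hac : G.Adj a c) (had : G.Adj a d) (hbc : G.Adj b c) (hbd : G.Adj b d)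
    (hcd : G.Adj c d) : CR G (k + 1) ∨ ∀ n, 3 ≤ n → n ≤ k + 2 → CycL G n := by
  classical
  set Q : Set V := {v | v ∈ U ∧ G.Adj c v ∧ G.Adj d v} with hQ
  by_cases hQk : k ≤ Q.ncard
  · right
    intro n h3 hn'
    have hQf : Q.Finite := Set.toFinite _
    have hQa : ∀ x ∈ Q, ∀ y ∈ Q, x ≠ y → G.Adj x y := fun x hx y hy hxy =>
      hA c hc x hx.1 d hd y hy.1 hx.2.1 hx.2.2.symm hy.2.2 hy.2.1.symm hcd.ne hxy
    have hcQ : c ∉ Q := fun h => G.irrefl h.2.1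
    have hdQ : d ∉ Q := fun h => G.irrefl h.2.2
    refine clique_cyc (Q := insert c (insert d hQf.toFinset)) ?_ h3 ?_
    · intro x hx y hy hxy
      simp only [Finset.mem_insert, Set.Finite.mem_toFinset] at hx hy
      rcases hx with rfl | rfl | hx <;> rcases hy with rfl | rfl | hy
      · exact absurd rfl hxy
      · exact hcd
      · exact hy.2.1
      · exact hcd.symm
      · exact absurd rfl hxy
      · exact hy.2.2
      · exact hx.2.1.symm
      · exact hx.2.2.symm
      · exact hQa x hx y hy hxy
    · rw [Finset.card_insert_of_notMem (by simp [hcQ, hcd.ne]), Finset.card_insert_of_notMem (by simp [hdQ]),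
        ← Set.ncard_eq_toFinset_card]
      omega
  left
  push Not at hQk
  set W := U \ {a, b, c, d} with hW
  set S := G.neighborSet b ∪ G.neighborSet c ∪ G.neighborSet d with hS
  set T := G.neighborSet a with hT
  have hl : ∀ x : Fin k, x.castSucc ≠ Fin.last k := fun x => (Fin.castSucc_lt_last x).ne
  have hcase : ∀ v ∈ U, v = a ∨ v = b ∨ v = c ∨ v = d ∨ v ∈ W := by
    intro v hv
    by_cases h : v ∈ ({a, b, c, d} : Set V)
    · simp at h; tauto
    · exact Or.inr (Or.inr (Or.inr (Or.inr ⟨hv, h⟩)))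
  have hCe : ¬ CC G W S T k False := by
    rintro ⟨ψ, α, β, ⟨hψ, hψS, hψT⟩, hne⟩
    have hαβ : α ≠ β := fun h => hne.1 h
    set Q' := Q \ {a, b} with hQ'
    have hQ'c : Q'.ncard + 2 = Q.ncard := by
      rw [← Set.ncard_pair hab.ne]
      exact Set.ncard_sdiff_add_ncard_of_subset (by
        rintro x (rfl | rfl)
        · exact ⟨ha, hac.symm, had.symm⟩
        · exact ⟨hb, hbc.symm, hbd.symm⟩)
    have hQ'f : Q'.Finite := Set.toFinite _
    obtain ⟨γ, hγ⟩ : ∃ γ : Fin k, γ ∉ ({α, β} ∪ hQ'f.toFinset.image ψ : Finset (Fin k)) := by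
      by_contra! h
      have h1 : (Finset.univ : Finset (Fin k)).card ≤ ({α, β} ∪ hQ'f.toFinset.image ψ : Finset (Fin k)).card :=
        Finset.card_le_card (fun x _ => h x)
      have h2 := Finset.card_union_le ({α, β} : Finset (Fin k)) (hQ'f.toFinset.image ψ)
      have h3 := Finset.card_le_two (a := α) (b := β)
      have h4 := Finset.card_image_le (s := hQ'f.toFinset) (f := ψ)
      rw [← Set.ncard_eq_toFinset_card] at h4
      rw [Finset.card_univ, Fintype.card_fin] at h1
      omega
    simp only [Finset.mem_union, Finset.mem_insert, Finset.mem_singleton, Finset.mem_image,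
      Set.Finite.mem_toFinset, not_or, not_exists, not_and] at hγ
    obtain ⟨⟨hγα, hγβ⟩, hγQ⟩ := hγ
    let f : V → Fin (k + 1) := fun v => if v = a then β.castSucc else
      if v = b then α.castSucc else if v = c then γ.castSucc else if v = d then Fin.last k else
      if G.Adj c v ∧ ψ v = γ then Fin.last k else (ψ v).castSucc
    have fa : f a = β.castSucc := by simp [f]
    have fb : f b = α.castSucc := by simp [f, hab.ne.symm]
    have fc : f c = γ.castSucc := by simp [f, hac.ne.symm, hbc.ne.symm]
    have fd : f d = Fin.last k := by simp [f, had.ne.symm, hbd.ne.symm, hcd.ne.symm]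
    have fW : ∀ v ∈ W, f v = if G.Adj c v ∧ ψ v = γ then Fin.last k else (ψ v).castSucc := fun v hv => by
      have := hv.2
      simp only [mem_insert_iff, mem_singleton_iff, not_or] at this
      simp [f, this]
    have ga : ∀ v ∈ W, G.Adj a v → f v ≠ β.castSucc := by
      intro v hv hav
      rw [fW v hv]
      split_ifs with h
      · exact (hl _).symm
      · simpa using hψT v hv hav
    have gb : ∀ v ∈ W, G.Adj b v → f v ≠ α.castSucc := by
      intro v hv hav
      rw [fW v hv]
      split_ifs with h
      · exact (hl _).symm
      · simpa using hψS v hv (Or.inl (Or.inl hav))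
    have gc : ∀ v ∈ W, G.Adj c v → f v ≠ γ.castSucc := by
      intro v hv hav
      rw [fW v hv]
      split_ifs with h
      · exact (hl _).symm
      · simpa [hav] using h
    have gd : ∀ v ∈ W, G.Adj d v → f v ≠ Fin.last k := by
      intro v hv hav
      rw [fW v hv]
      split_ifs with h
      · refine absurd h.2 (hγQ v ⟨⟨hv.1, h.1, hav⟩, ?_⟩)
        rintro (rfl | rfl)
        · exact hv.2 (by simp)
        · exact hv.2 (by simp)
      · exact hl _
    refine hU.1 ⟨f, fun u hu v hv huv => ?_⟩
    have n1 : β.castSucc ≠ α.castSucc := by simpa using hαβ.symm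
    have n2 : β.castSucc ≠ γ.castSucc := by simpa using Ne.symm hγβ
    have n3 : α.castSucc ≠ γ.castSucc := by simpa using Ne.symm hγα
    rcases hcase u hu with rfl | rfl | rfl | rfl | hu' <;>
    rcases hcase v hv with rfl | rfl | rfl | rfl | hv' <;>
    first
    | exact absurd huv G.irrefl
    | (simp only [fa, fb, fc, fd]; first | exact n1 | exact n2 | exact n3 | exact n1.symm | exact n2.symm | exact n3.symm | exact hl _ | exact (hl _).symm)
    | (simp only [fa, fb, fc, fd]; first | exact (ga v hv' huv).symm | exact (gb v hv' huv).symm | exact (gc v hv' huv).symm | exact (gd v hv' huv).symm)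
    | (simp only [fa, fb, fc, fd]; first | exact (ga u hu' huv.symm) | exact (gb u hu' huv.symm) | exact (gc u hu' huv.symm) | exact (gd u hu' huv.symm))
    | skip
    have := hψ u hu' v hv' huv
    rw [fW u hu', fW v hv']
    split_ifs with h1 h2 h2
    · exact absurd (h1.2.trans h2.2.symm) this
    · exact (hl _).symm
    · exact hl _
    · simpa using this
  have hXU : ({a, b, c, d} : Set V) ⊆ U := by rintro x (rfl | rfl | rfl | rfl) <;> assumption
  have hWc : Conn G W := hU.clique hXU (by
    rintro x (rfl | rfl | rfl | rfl) y (rfl | rfl | rfl | rfl) h <;>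
    first
    | exact absurd rfl h
    | assumption
    | (apply SimpleGraph.Adj.symm; assumption))
  have hWne : W.Nonempty := by
    by_contra h
    rw [Set.not_nonempty_iff_eq_empty] at h
    obtain ⟨α, β, h'⟩ := exists_pair (n := k) (by omega) False
    exact hCe ⟨fun _ => α, α, β, ⟨fun u hu => by simp [h] at hu, fun u hu => by simp [h] at hu,
      fun u hu => by simp [h] at hu⟩, h'⟩
  have hWU : W ⊆ U := sdiff_subset
  have haW : a ∉ W := fun h => h.2 (by simp)
  have hbW : b ∉ W := fun h => h.2 (by simp)
  have hcW : c ∉ W := fun h => h.2 (by simp)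
  have hdW : d ∉ W := fun h => h.2 (by simp)
  have hWS : ∃ v ∈ W, v ∈ S := by
    by_contra! h
    refine (hU.single ha).no hWU (by rintro x hx rfl; exact haW hx) hWne ?_ hb
      (by simpa using hab.ne.symm) hbW
    intro x hx v hv hxv hvW
    rcases hcase v hv with rfl | rfl | rfl | rfl | hv'
    · rfl
    · exact absurd (Or.inl (Or.inl hxv.symm)) (h x hx)
    · exact absurd (Or.inl (Or.inr hxv.symm)) (h x hx)
    · exact absurd (Or.inr hxv.symm) (h x hx)
    · exact absurd hv' hvW
  have hWT : ∃ v ∈ W, v ∈ T := by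
    by_contra! h
    have hcl : Conn G (U \ {b, c, d}) := hU.clique (fun x hx => hXU (Or.inr hx)) (by
      rintro x (rfl | rfl | rfl) y (rfl | rfl | rfl) h <;>
      first
      | exact absurd rfl h
      | assumption
      | (apply SimpleGraph.Adj.symm; assumption))
    refine hcl.no hWU (fun x hx h => hx.2 (Or.inr h)) hWne ?_ ha
      (by simp [hab.ne, hac.ne, had.ne]) haW
    intro x hx v hv hxv hvW
    rcases hcase v hv with rfl | rfl | rfl | rfl | hv'
    · exact absurd hxv.symm (h x hx)
    · simp
    · simp
    · simp
    · exact absurd hv' hvW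
  have hrun : Run G W S T (k - 1) := by
    refine RC (by omega) hWc hWS hWT (H2.vac ?_) hCe
    intro u hu B' hB' hne' hm'
    refine (hU.single (hWU hu)).no (fun x hx => hWU (hB'.1 hx).1) (fun x hx => (hB'.1 hx).2)
      hne' ?_ ha (by rintro rfl; exact haW hu) (fun h => haW (hB'.1 h).1)
    intro x hx v hv hxv hvB
    by_contra hvu
    rcases hcase v hv with rfl | rfl | rfl | rfl | hv'
    · exact (hm' x hx).2 hxv.symm
    · exact (hm' x hx).1 (Or.inl (Or.inl hxv.symm))
    · exact (hm' x hx).1 (Or.inl (Or.inr hxv.symm))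
    · exact (hm' x hx).1 (Or.inr hxv.symm)
    · exact hvB (hB'.2 x hx v ⟨hv', hvu⟩ hxv)
  refine hrun.close 2 (fun d => d = 2 ∨ d = 3 ∨ d = 4) ?_ ?_
  · intro s t l hs ht hl e he
    obtain ⟨x, y, z, hsx, hax, hay, haz, hxy, hyz, hxz, hx, hy, hz⟩ : ∃ x y z, G.Adj x s ∧ G.Adj a x ∧ G.Adj a y ∧
        G.Adj a z ∧ G.Adj x y ∧ G.Adj y z ∧ G.Adj x z ∧ x ∉ W ∧ y ∉ W ∧ z ∉ W := by
      rcases hs with (hs | hs) | hs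
      · exact ⟨b, c, d, hs, hab, hac, had, hbc, hcd, hbd, hbW, hcW, hdW⟩
      · exact ⟨c, b, d, hs, hac, hab, had, hbc.symm, hbd, hcd, hcW, hbW, hdW⟩
      · exact ⟨d, b, c, hs, had, hab, hac, hbd.symm, hbc, hcd.symm, hdW, hbW, hcW⟩
    rcases he with rfl | rfl | rfl
    · refine hl.close [a, x] ?_ ?_ ?_ (by simp)
      · simp [hax]; exact ⟨ht.symm, hsx⟩
      · simp [hax.ne]
      · simp [haW, hx]
    · refine hl.close [a, y, x] ?_ ?_ ?_ (by simp)
      · simp [hay, hxy.symm]; exact ⟨ht.symm, hsx⟩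
      · simp [hax.ne, hay.ne, hxy.ne.symm]
      · simp [haW, hx, hy]
    · refine hl.close [a, y, z, x] ?_ ?_ ?_ (by simp)
      · simp [hay, hyz, hxz.symm]; exact ⟨ht.symm, hsx⟩
      · simp [hax.ne, hay.ne, haz.ne, hxy.ne.symm, hyz.ne, hxz.ne.symm]
      · simp [haW, hx, hy, hz]
  · intro i hi
    rcases Nat.lt_or_ge i (k - 1) with h | h
    · exact ⟨i, h, 2, Or.inl rfl, by omega⟩
    · rcases Nat.lt_or_ge i k with h | h
      · exact ⟨i - 1, by omega, 3, Or.inr (Or.inl rfl), by omega⟩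
      · exact ⟨i - 2, by omega, 4, Or.inr (Or.inr rfl), by omega⟩

end OC

namespace OC
open Set

variable {V : Type*} {G : SimpleGraph V} [Finite V]

theorem bowtie {U : Set V} {k : ℕ} (hU : Crit G U (k + 1)) (hn : 3 ≤ k)
    (h3c : ∀ p ∈ U, ∀ q ∈ U, p ≠ q → Conn G (U \ {p, q}))
    (h4 : ∀ p ∈ U, ∀ q ∈ U, ∀ x ∈ U, ∀ y ∈ U, p ≠ q → x ≠ y → G.Adj p x → G.Adj p y →
      G.Adj q x → G.Adj q y → False)
    {a b c s s1 : V} (ha : a ∈ U) (hb : b ∈ U) (hc : c ∈ U) (hs : s ∈ U) (hs1 : s1 ∈ U)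
    (hab : G.Adj a b) (hac : G.Adj a c) (hbc : G.Adj b c) (has : G.Adj a s) (has1 : G.Adj a s1)
    (hss : G.Adj s s1) (hsb : s ≠ b) (hsc : s ≠ c) (hs1b : s1 ≠ b) (hs1c : s1 ≠ c) :
    CR G (k + 1) := by
  classical
  set W := U \ {a, b, c, s, s1} with hW
  set S := G.neighborSet s ∪ G.neighborSet s1 with hS
  set T := G.neighborSet b ∪ G.neighborSet c with hT
  have hl : ∀ x : Fin k, x.castSucc ≠ Fin.last k := fun x => (Fin.castSucc_lt_last x).ne
  have hcase : ∀ v ∈ U, v = a ∨ v = b ∨ v = c ∨ v = s ∨ v = s1 ∨ v ∈ W := by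
    intro v hv
    by_cases h : v ∈ ({a, b, c, s, s1} : Set V)
    · simp at h; tauto
    · exact Or.inr (Or.inr (Or.inr (Or.inr (Or.inr ⟨hv, h⟩))))
  have hcs1 : ¬ G.Adj c s1 := fun h => h4 a ha c hc b hb s1 hs1 hac.ne hs1b.symm hab has1 hbc.symm h
  have haW : a ∉ W := fun h => h.2 (by simp)
  have hbW : b ∉ W := fun h => h.2 (by simp)
  have hcW : c ∉ W := fun h => h.2 (by simp)
  have hsW : s ∉ W := fun h => h.2 (by simp)
  have hs1W : s1 ∉ W := fun h => h.2 (by simp)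
  have hWe : ¬ CC G W S T k False := by
    rintro ⟨ψ, α, β, ⟨hψ, hψS, hψT⟩, hne⟩
    have hαβ : α ≠ β := fun h => hne.1 h
    obtain ⟨γ, hγα, hγβ⟩ := exists_third hn α β
    let f : V → Fin (k + 1) := fun v => if v = a then γ.castSucc else
      if v = b then β.castSucc else if v = c then Fin.last k else if v = s then α.castSucc else
      if v = s1 then Fin.last k else
      if G.Adj a v ∧ ψ v = γ then Fin.last k else (ψ v).castSucc
    have fa : f a = γ.castSucc := by simp [f]
    have fb : f b = β.castSucc := by simp [f, hab.ne.symm]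
    have fc : f c = Fin.last k := by simp [f, hac.ne.symm, hbc.ne.symm]
    have fs : f s = α.castSucc := by simp [f, has.ne.symm, hsb, hsc]
    have fs1 : f s1 = Fin.last k := by simp [f, has1.ne.symm, hs1b, hs1c, hss.ne.symm]
    have fW : ∀ v ∈ W, f v = if G.Adj a v ∧ ψ v = γ then Fin.last k else (ψ v).castSucc := fun v hv => by
      have := hv.2
      simp only [mem_insert_iff, mem_singleton_iff, not_or] at this
      simp [f, this]
    have ga : ∀ v ∈ W, G.Adj a v → f v ≠ γ.castSucc := by
      intro v hv hav
      rw [fW v hv]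
      split_ifs with h
      · exact (hl _).symm
      · simpa [hav] using h
    have gb : ∀ v ∈ W, G.Adj b v → f v ≠ β.castSucc := by
      intro v hv hav
      rw [fW v hv]
      split_ifs with h
      · exact (hl _).symm
      · simpa using hψT v hv (Or.inl hav)
    have gs : ∀ v ∈ W, G.Adj s v → f v ≠ α.castSucc := by
      intro v hv hav
      rw [fW v hv]
      split_ifs with h
      · exact (hl _).symm
      · simpa using hψS v hv (Or.inl hav)
    have gc : ∀ v ∈ W, G.Adj c v → f v ≠ Fin.last k := by
      intro v hv hav
      rw [fW v hv]
      split_ifs with h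
      · exact absurd (h4 a ha c hc b hb v hv.1 hac.ne (fun h => hbW (h ▸ hv)) hab h.1 hbc.symm hav) id
      · exact hl _
    have gs1 : ∀ v ∈ W, G.Adj s1 v → f v ≠ Fin.last k := by
      intro v hv hav
      rw [fW v hv]
      split_ifs with h
      · exact absurd (h4 a ha s1 hs1 s hs v hv.1 has1.ne (fun h => hsW (h ▸ hv)) has h.1 hss.symm hav) id
      · exact hl _
    refine hU.1 ⟨f, fun u hu v hv huv => ?_⟩
    have n1 : β.castSucc ≠ α.castSucc := by simpa using hαβ.symm
    have n2 : β.castSucc ≠ γ.castSucc := by simpa using Ne.symm hγβ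
    have n3 : α.castSucc ≠ γ.castSucc := by simpa using Ne.symm hγα
    rcases hcase u hu with rfl | rfl | rfl | rfl | rfl | hu' <;>
    rcases hcase v hv with rfl | rfl | rfl | rfl | rfl | hv' <;>
    first
    | exact absurd huv G.irrefl
    | exact absurd huv hcs1
    | exact absurd huv.symm hcs1
    | (simp only [fa, fb, fc, fs, fs1]; first | exact n1 | exact n2 | exact n3 | exact n1.symm | exact n2.symm | exact n3.symm | exact hl _ | exact (hl _).symm)
    | (simp only [fa, fb, fc, fs, fs1]; first | exact (ga v hv' huv).symm | exact (gb v hv' huv).symm | exact (gc v hv' huv).symm | exact (gs v hv' huv).symm | exact (gs1 v hv' huv).symm)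
    | (simp only [fa, fb, fc, fs, fs1]; first | exact (ga u hu' huv.symm) | exact (gb u hu' huv.symm) | exact (gc u hu' huv.symm) | exact (gs u hu' huv.symm) | exact (gs1 u hu' huv.symm))
    | skip
    have := hψ u hu' v hv' huv
    rw [fW u hu', fW v hv']
    split_ifs with h1 h2 h2
    · exact absurd (h1.2.trans h2.2.symm) this
    · exact (hl _).symm
    · exact hl _
    · simpa using this
  obtain ⟨C, hC, hCc, hCne, hCe⟩ := exists_bad (by omega) hWe
  have hCW : C ⊆ W := hC.1
  have hCU : C ⊆ U := fun x hx => (hC.1 hx).1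
  have hout : ∀ x ∈ C, ∀ v ∈ U, G.Adj x v → v ∉ C → v ∉ W := fun x hx v _ hxv hvC h =>
    hvC (hC.2 x hx v h hxv)
  have hCS : ∃ v ∈ C, v ∈ S := by
    by_contra! h
    have hcl : Conn G (U \ {a, b, c}) := hU.clique (by rintro x (rfl | rfl | rfl) <;> assumption) (by
      rintro x (rfl | rfl | rfl) y (rfl | rfl | rfl) h <;>
      first
      | exact absurd rfl h
      | assumption
      | (apply SimpleGraph.Adj.symm; assumption))
    refine hcl.no hCU ?_ hCne ?_ hs (by simp [hsb, hsc, has.ne.symm]) (fun h => hsW (hCW h))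
    · rintro x hx (rfl | rfl | rfl)
      · exact haW (hCW hx)
      · exact hbW (hCW hx)
      · exact hcW (hCW hx)
    · intro x hx v hv hxv hvC
      rcases hcase v hv with rfl | rfl | rfl | rfl | rfl | hv'
      · simp
      · simp
      · simp
      · exact absurd (Or.inl hxv.symm) (h x hx)
      · exact absurd (Or.inr hxv.symm) (h x hx)
      · exact absurd hv' (hout x hx v hv hxv hvC)
  have hCT : ∃ v ∈ C, v ∈ T := by
    by_contra! h
    have hcl : Conn G (U \ {a, s, s1}) := hU.clique (by rintro x (rfl | rfl | rfl) <;> assumption) (by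
      rintro x (rfl | rfl | rfl) y (rfl | rfl | rfl) h <;>
      first
      | exact absurd rfl h
      | assumption
      | (apply SimpleGraph.Adj.symm; assumption))
    refine hcl.no hCU ?_ hCne ?_ hb (by simp [hsb.symm, hs1b.symm, hab.ne.symm]) (fun h => hbW (hCW h))
    · rintro x hx (rfl | rfl | rfl)
      · exact haW (hCW hx)
      · exact hsW (hCW hx)
      · exact hs1W (hCW hx)
    · intro x hx v hv hxv hvC
      rcases hcase v hv with rfl | rfl | rfl | rfl | rfl | hv'
      · simp
      · exact absurd (Or.inl hxv.symm) (h x hx)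
      · exact absurd (Or.inr hxv.symm) (h x hx)
      · simp
      · simp
      · exact absurd hv' (hout x hx v hv hxv hvC)
  have hrun : Run G C S T (k - 1) := by
    refine RC (by omega) hCc hCS hCT (H2.vac ?_) hCe
    intro u hu B' hB' hne' hm'
    have hua : u ≠ a := fun h => haW (hCW (h ▸ hu))
    refine (h3c u (hCU hu) a ha hua).no (fun x hx => hCU (hB'.1 hx).1) ?_
      hne' ?_ hb ?_ (fun h => hbW (hCW (hB'.1 h).1))
    · rintro x hx (rfl | rfl)
      · exact (hB'.1 hx).2 rfl
      · exact haW (hCW (hB'.1 hx).1)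
    · intro x hx v hv hxv hvB
      by_contra hvu
      simp only [mem_insert_iff, mem_singleton_iff, not_or] at hvu
      rcases hcase v hv with rfl | rfl | rfl | rfl | rfl | hv'
      · exact hvu.2 rfl
      · exact (hm' x hx).2 (Or.inl hxv.symm)
      · exact (hm' x hx).2 (Or.inr hxv.symm)
      · exact (hm' x hx).1 (Or.inl hxv.symm)
      · exact (hm' x hx).1 (Or.inr hxv.symm)
      · exact hvB (hB'.2 x hx v ⟨hC.2 x (hB'.1 hx).1 v hv' hxv, hvu.1⟩ hxv)
    · simp only [mem_insert_iff, mem_singleton_iff, not_or]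
      exact ⟨fun h => hbW (hCW (h ▸ hu)), hab.ne.symm⟩
  refine hrun.close 3 (fun d => d = 3 ∨ d = 4 ∨ d = 5) ?_ ?_
  · intro x y l hx hy hl e he
    obtain ⟨σ, σ', hσx, haσ, haσ', hσσ, hσW, hσ'W, hσb, hσc, hσ'b, hσ'c⟩ : ∃ σ σ', G.Adj σ x ∧ G.Adj a σ ∧ G.Adj a σ' ∧
        G.Adj σ' σ ∧ σ ∉ C ∧ σ' ∉ C ∧ σ ≠ b ∧ σ ≠ c ∧ σ' ≠ b ∧ σ' ≠ c := by
      rcases hx with hx | hx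
      · exact ⟨s, s1, hx, has, has1, hss.symm, fun h => hsW (hCW h), fun h => hs1W (hCW h), hsb, hsc, hs1b, hs1c⟩
      · exact ⟨s1, s, hx, has1, has, hss, fun h => hs1W (hCW h), fun h => hsW (hCW h), hs1b, hs1c, hsb, hsc⟩
    obtain ⟨t, t', hty, hat, hat', htt, htW, ht'W, h1, h2, h3, h5⟩ : ∃ t t', G.Adj y t ∧ G.Adj t a ∧ G.Adj t' a ∧
        G.Adj t t' ∧ t ∉ C ∧ t' ∉ C ∧ t ≠ σ ∧ t ≠ σ' ∧ t' ≠ σ ∧ t' ≠ σ' := by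
      rcases hy with hy | hy
      · exact ⟨b, c, hy.symm, hab.symm, hac.symm, hbc, fun h => hbW (hCW h), fun h => hcW (hCW h), hσb.symm, hσ'b.symm, hσc.symm, hσ'c.symm⟩
      · exact ⟨c, b, hy.symm, hac.symm, hab.symm, hbc.symm, fun h => hcW (hCW h), fun h => hbW (hCW h), hσc.symm, hσ'c.symm, hσb.symm, hσ'b.symm⟩
    have haC : a ∉ C := fun h => haW (hCW h)
    rcases he with rfl | rfl | rfl
    · refine hl.close [t, a, σ] ?_ ?_ ?_ (by simp)
      · simp [*]
      · simp [hat.ne, h1, haσ.ne]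
      · simp [*]
    · refine hl.close [t, t', a, σ] ?_ ?_ ?_ (by simp)
      · simp [*]
      · simp [hat.ne, hat'.ne, h1, h3, haσ.ne, htt.ne]
      · simp [*]
    · refine hl.close [t, t', a, σ', σ] ?_ ?_ ?_ (by simp)
      · simp [*]
      · simp [hat.ne, hat'.ne, h1, h3, haσ.ne, htt.ne, h2, h5, haσ'.ne, hσσ.ne]
      · simp [*]
  · intro i hi
    rcases Nat.lt_or_ge i (k - 1) with h | h
    · exact ⟨i, h, 3, Or.inl rfl, by omega⟩
    · rcases Nat.lt_or_ge i k with h | h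
      · exact ⟨i - 1, by omega, 4, Or.inr (Or.inl rfl), by omega⟩
      · exact ⟨i - 2, by omega, 5, Or.inr (Or.inr rfl), by omega⟩

theorem caseC {U : Set V} {k : ℕ} (hU : Crit G U (k + 1)) (hn : 3 ≤ k)
    (h3c : ∀ p ∈ U, ∀ q ∈ U, p ≠ q → Conn G (U \ {p, q}))
    (h4 : ∀ p ∈ U, ∀ q ∈ U, ∀ x ∈ U, ∀ y ∈ U, p ≠ q → x ≠ y → G.Adj p x → G.Adj p y →
      G.Adj q x → G.Adj q y → False)
    {a b c : V} (ha : a ∈ U) (hb : b ∈ U) (hc : c ∈ U)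
    (hab : G.Adj a b) (hac : G.Adj a c) (hbc : G.Adj b c) : CR G (k + 1) := by
  classical
  by_contra hno
  have hNa : ∀ s ∈ U, ∀ s1 ∈ U, G.Adj a s → G.Adj a s1 → s ≠ b → s ≠ c → s1 ≠ b → s1 ≠ c →
      ¬ G.Adj s s1 := fun s hs s1 hs1 h1 h2 h3 h5 h6 h7 h8 =>
    hno (bowtie hU hn h3c h4 ha hb hc hs hs1 hab hac hbc h1 h2 h8 h3 h5 h6 h7)
  have hNc : ∀ s ∈ U, ∀ s1 ∈ U, G.Adj c s → G.Adj c s1 → s ≠ b → s ≠ a → s1 ≠ b → s1 ≠ a →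
      ¬ G.Adj s s1 := fun s hs s1 hs1 h1 h2 h3 h5 h6 h7 h8 =>
    hno (bowtie hU hn h3c h4 hc hb ha hs hs1 hbc.symm hac.symm hab.symm h1 h2 h8 h3 h5 h6 h7)
  apply hno
  clear hno
  set W := U \ {a, b, c} with hW
  set S := G.neighborSet a ∪ G.neighborSet c with hS
  set T := G.neighborSet b with hT
  have hcase : ∀ v ∈ U, v = a ∨ v = b ∨ v = c ∨ v ∈ W := by
    intro v hv
    by_cases h : v ∈ ({a, b, c} : Set V)
    · simp at h; tauto
    · exact Or.inr (Or.inr (Or.inr ⟨hv, h⟩))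
  have haW : a ∉ W := fun h => h.2 (by simp)
  have hbW : b ∉ W := fun h => h.2 (by simp)
  have hcW : c ∉ W := fun h => h.2 (by simp)
  have hWU : W ⊆ U := sdiff_subset
  have hind : ∀ x ∈ W, x ∈ S → ∀ y ∈ W, y ∈ S → ¬ G.Adj x y := by
    have hcross : ∀ x ∈ W, ∀ y ∈ W, G.Adj a x → G.Adj c y → ¬ G.Adj x y := by
      intro x hx y hy hax hcy hxy
      exact h4 a ha y (hWU hy) x (hWU hx) c hc (fun h => haW (h ▸ hy)) (fun h => hcW (h ▸ hx)) hax hac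
        hxy.symm hcy.symm
    intro x hx hxS y hy hyS
    have nx := hx.2
    have ny := hy.2
    simp only [mem_insert_iff, mem_singleton_iff, not_or] at nx ny
    rcases hxS with hxS | hxS <;> rcases hyS with hyS | hyS
    · exact hNa x hx.1 y hy.1 hxS hyS nx.2.1 nx.2.2 ny.2.1 ny.2.2
    · exact hcross x hx y hy hxS hyS
    · exact fun h => hcross y hy x hx hyS hxS h.symm
    · exact hNc x hx.1 y hy.1 hxS hyS nx.2.1 nx.1 ny.2.1 ny.1
  have hWe : ¬ CC G (W \ S) {v | ∃ s ∈ W, s ∈ S ∧ G.Adj s v} T (k + 1) False := by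
    rintro h
    let α : Fin (k + 1) := ⟨0, by omega⟩
    let β : Fin (k + 1) := ⟨1, by omega⟩
    let γ : Fin (k + 1) := ⟨2, by omega⟩
    let δ : Fin (k + 1) := ⟨3, by omega⟩
    obtain ⟨ψ, hψ, hψS, hψT⟩ := h.at α β (by simp [α, β])
    let f : V → Fin (k + 1) := fun v => if v = a then γ else
      if v = b then β else if v = c then δ else if v ∈ S then α else ψ v
    have fa : f a = γ := by simp [f]
    have fb : f b = β := by simp [f, hab.ne.symm]
    have fc : f c = δ := by simp [f, hac.ne.symm, hbc.ne.symm]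
    have fW : ∀ v ∈ W, f v = if v ∈ S then α else ψ v := fun v hv => by
      have := hv.2
      simp only [mem_insert_iff, mem_singleton_iff, not_or] at this
      simp [f, this]
    have ga : ∀ v ∈ W, G.Adj a v → f v ≠ γ := by
      intro v hv hav
      rw [fW v hv, if_pos (show v ∈ S from Or.inl hav)]
      simp [α, γ]
    have gc : ∀ v ∈ W, G.Adj c v → f v ≠ δ := by
      intro v hv hav
      rw [fW v hv, if_pos (show v ∈ S from Or.inr hav)]
      simp [α, δ]
    have gb : ∀ v ∈ W, G.Adj b v → f v ≠ β := by
      intro v hv hav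
      rw [fW v hv]
      split_ifs with h
      · simp [α, β]
      · exact hψT v ⟨hv, h⟩ hav
    refine hU.1 ⟨f, fun u hu v hv huv => ?_⟩
    rcases hcase u hu with rfl | rfl | rfl | hu' <;>
    rcases hcase v hv with rfl | rfl | rfl | hv' <;>
    first
    | exact absurd huv G.irrefl
    | (simp only [fa, fb, fc]; simp [β, γ, δ]; done)
    | (simp only [fa, fb, fc]; first | exact (ga v hv' huv).symm | exact (gb v hv' huv).symm | exact (gc v hv' huv).symm)
    | (simp only [fa, fb, fc]; first | exact (ga u hu' huv.symm) | exact (gb u hu' huv.symm) | exact (gc u hu' huv.symm))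
    | skip
    rw [fW u hu', fW v hv']
    split_ifs with h1 h2 h2
    · exact absurd huv (hind u hu' h1 v hv' h2)
    · exact (hψS v ⟨hv', h2⟩ ⟨u, hu', h1, huv⟩).symm
    · exact (hψS u ⟨hu', h1⟩ ⟨v, hv', h2, huv.symm⟩)
    · exact hψ u ⟨hu', h1⟩ v ⟨hv', h2⟩ huv
  obtain ⟨D, hD, hDc, hDne, hDe⟩ := exists_bad (by omega) hWe
  have hWc : Conn G W := hU.clique (by rintro x (rfl | rfl | rfl) <;> assumption) (by
      rintro x (rfl | rfl | rfl) y (rfl | rfl | rfl) h <;>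
      first
      | exact absurd rfl h
      | assumption
      | (apply SimpleGraph.Adj.symm; assumption))
  have hWne : W.Nonempty := hDne.mono (fun x hx => (hD.1 hx).1)
  have hWS : ∃ v ∈ W, v ∈ S := by
    by_contra! h
    refine (hU.single hb).no hWU (by rintro x hx rfl; exact hbW hx) hWne ?_ ha
      (by simpa using hab.ne) haW
    intro x hx v hv hxv hvW
    rcases hcase v hv with rfl | rfl | rfl | hv'
    · exact absurd (Or.inl hxv.symm) (h x hx)
    · rfl
    · exact absurd (Or.inr hxv.symm) (h x hx)
    · exact absurd hv' hvW
  have hWT : ∃ v ∈ W, v ∈ T := by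
    by_contra! h
    refine (h3c a ha c hc hac.ne).no hWU ?_ hWne ?_ hb (by simp [hab.ne.symm, hbc.ne]) hbW
    · rintro x hx (rfl | rfl)
      · exact haW hx
      · exact hcW hx
    intro x hx v hv hxv hvW
    rcases hcase v hv with rfl | rfl | rfl | hv'
    · simp
    · exact absurd hxv.symm (h x hx)
    · simp
    · exact absurd hv' hvW
  have hrun : Run G W S T (k + 1 - 1) := by
    refine indLemma (RC_all _) (by omega) hWc hWS hWT hD hDc hDne hDe ?_
    intro w hw B hBD hB hne
    by_contra! h
    refine (hU.single (hWU hw)).no (fun x hx => hWU (hB.1 hx).1) (fun x hx => (hB.1 hx).2)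
      hne ?_ hb (by rintro rfl; exact hbW hw) (fun h => hbW (hB.1 h).1)
    intro x hx v hv hxv hvB
    by_contra hvu
    rcases hcase v hv with rfl | rfl | rfl | hv'
    · exact (hD.1 (hBD hx)).2 (Or.inl hxv.symm)
    · exact h x hx hxv.symm
    · exact (hD.1 (hBD hx)).2 (Or.inr hxv.symm)
    · exact hvB (hB.2 x hx v ⟨hv', hvu⟩ hxv)
  refine hrun.close 2 (fun d => d = 2 ∨ d = 3) ?_ ?_
  · intro x y l hx hy hl e he
    obtain ⟨σ, σ', hσx, hbσ, hbσ', hσσ, hσW, hσ'W⟩ : ∃ σ σ', G.Adj σ x ∧ G.Adj b σ ∧ G.Adj b σ' ∧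
        G.Adj σ' σ ∧ σ ∉ W ∧ σ' ∉ W := by
      rcases hx with hx | hx
      · exact ⟨a, c, hx, hab.symm, hbc, hac.symm, haW, hcW⟩
      · exact ⟨c, a, hx, hbc, hab.symm, hac, hcW, haW⟩
    have hy' : G.Adj y b := SimpleGraph.Adj.symm hy
    rcases he with rfl | rfl
    · refine hl.close [b, σ] ?_ ?_ ?_ (by simp)
      · simp [*]
      · simp [hbσ.ne]
      · simp [hbW, hσW]
    · refine hl.close [b, σ', σ] ?_ ?_ ?_ (by simp)
      · simp [*]
      · simp [hbσ.ne, hbσ'.ne, hσσ.ne]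
      · simp [hbW, hσW, hσ'W]
  · intro i hi
    rcases Nat.lt_or_ge i k with h | h
    · exact ⟨i, h, 2, Or.inl rfl, by omega⟩
    · exact ⟨i - 1, by omega, 3, Or.inr rfl, by omega⟩

end OC

namespace OC
open Set

variable {V : Type*} {G : SimpleGraph V}

def rs (G : SimpleGraph V) (U : Set V) : SimpleGraph V where
  Adj u v := G.Adj u v ∧ u ∈ U ∧ v ∈ U
  symm := ⟨fun _ _ h => ⟨h.1.symm, h.2.2, h.2.1⟩⟩
  loopless := ⟨fun _ h => G.irrefl h.1⟩

theorem rs_dist {U : Set V} {ρ u v : V} (hr : (rs G U).Reachable ρ u) (h : (rs G U).Adj u v) :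
    (rs G U).dist ρ v ≤ (rs G U).dist ρ u + 1 := by
  obtain ⟨p, hp⟩ := hr.exists_walk_length_eq_dist
  have := (rs G U).dist_le (p.concat h)
  rw [SimpleGraph.Walk.length_concat, hp] at this
  exact this

theorem bfs {U : Set V} (hU : Conn G U) {ρ : V} (hρ : ρ ∈ U) : ∃ (lev : V → ℕ) (par : V → V),
    (∀ v ∈ U, lev v = 0 → v = ρ) ∧
    (∀ v ∈ U, lev v ≠ 0 → par v ∈ U ∧ G.Adj v (par v) ∧ lev (par v) + 1 = lev v) ∧
    (∀ u ∈ U, ∀ v ∈ U, G.Adj u v → lev v ≤ lev u + 1) := by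
  classical
  have hreach : ∀ v ∈ U, (rs G U).Reachable ρ v := by
    have : {v | v ∈ U ∧ (rs G U).Reachable ρ v} = U := by
      refine hU _ ⟨fun v hv => hv.1, ?_⟩ ⟨ρ, hρ, SimpleGraph.Reachable.refl _⟩
      intro u hu v hv huv
      exact ⟨hv, hu.2.trans (SimpleGraph.Adj.reachable ⟨huv, hu.1, hv⟩)⟩
    intro v hv
    rw [← this] at hv
    exact hv.2
  set lev : V → ℕ := fun v => (rs G U).dist ρ v with hlev
  have h3 : ∀ u ∈ U, ∀ v ∈ U, G.Adj u v → lev v ≤ lev u + 1 := fun u hu v hv huv =>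
    rs_dist (hreach u hu) ⟨huv, hu, hv⟩
  have h1 : ∀ v ∈ U, lev v = 0 → v = ρ := fun v hv h =>
    ((hreach v hv).dist_eq_zero_iff.1 h).symm
  have h2 : ∀ v, ∃ w, v ∈ U → lev v ≠ 0 → w ∈ U ∧ G.Adj v w ∧ lev w + 1 = lev v := by
    intro v
    by_cases hv : v ∈ U ∧ lev v ≠ 0
    · obtain ⟨p, hp⟩ := (hreach v hv.1).symm.exists_walk_length_eq_dist
      cases p with
      | nil => exact absurd (by simp [hlev]) hv.2
      | @cons _ w _ h q =>
        refine ⟨w, fun _ _ => ⟨h.2.2, h.1, ?_⟩⟩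
        have a1 := (rs G U).dist_le q.reverse
        have a2 := h3 w h.2.2 v h.2.1 h.1.symm
        rw [SimpleGraph.Walk.length_cons, SimpleGraph.dist_comm] at hp
        rw [SimpleGraph.Walk.length_reverse] at a1
        simp only [hlev] at a2 ⊢
        omega
    · exact ⟨v, fun a b => absurd ⟨a, b⟩ hv⟩
  choose par hpar using h2
  exact ⟨lev, par, h1, hpar, h3⟩

theorem treeCycle {U : Set V} {ρ : V} {lev : V → ℕ} {par : V → V}
    (h1 : ∀ v ∈ U, lev v = 0 → v = ρ)
    (h2 : ∀ v ∈ U, lev v ≠ 0 → par v ∈ U ∧ G.Adj v (par v) ∧ lev (par v) + 1 = lev v) (h : ℕ) :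
    ∀ (j : ℕ) (x y : V) (l : List V), Pth G {v | v ∈ U ∧ j ≤ lev v} x y l → lev x = j → lev y = j →
      par^[h] x ≠ par^[h] y → par^[h + 1] x = par^[h + 1] y → CycL G (l.length + 2 * h + 1) := by
  induction h with
  | zero =>
    intro j x y l hl hx hy hne heq
    simp only [Function.iterate_zero, id_eq, zero_add, Function.iterate_one] at hne heq
    have hxU := hl.mem _ hl.head_mem
    have hyU := hl.mem _ hl.last_mem
    have hj : j ≠ 0 := by
      rintro rfl
      exact hne ((h1 x hxU.1 hx).trans (h1 y hyU.1 hy).symm)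
    obtain ⟨a1, a2, a3⟩ := h2 x hxU.1 (by omega)
    obtain ⟨b1, b2, b3⟩ := h2 y hyU.1 (by omega)
    have hc := hl.cons (s := par x) a2.symm (fun h => by have := h.2; omega)
    refine ⟨par x, y, _, hc.mono (subset_univ _), heq ▸ b2, by simp, ?_⟩
    have : 2 ≤ l.length := by
      rcases l with _ | ⟨u, _ | ⟨w, l⟩⟩
      · simpa using hl.4
      · have e1 := hl.4
        have e2 := hl.5
        simp at e1 e2
        exact absurd (e1.symm.trans e2) hne
      · simp
    omega
  | succ h ih =>
    intro j x y l hl hx hy hne heq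
    have hxU := hl.mem _ hl.head_mem
    have hyU := hl.mem _ hl.last_mem
    have hxy : x ≠ y := fun h => hne (by rw [h])
    have hj : j ≠ 0 := by
      rintro rfl
      exact hxy ((h1 x hxU.1 hx).trans (h1 y hyU.1 hy).symm)
    obtain ⟨a1, a2, a3⟩ := h2 x hxU.1 (by omega)
    obtain ⟨b1, b2, b3⟩ := h2 y hyU.1 (by omega)
    have hpp : par x ≠ par y := fun e => hne (by rw [Function.iterate_succ_apply, Function.iterate_succ_apply, e])
    have hc := hl.cons (s := par x) a2.symm (fun h => by have := h.2; omega)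
    have hd := hc.append (Pth.single (W := {par y}) rfl) b2 (by
      rintro v (rfl | hv) hv'
      · exact hpp hv'
      · have e : v = par y := hv'
        have := hv.2
        rw [e] at this
        omega)
    have := ih (j - 1) (par x) (par y) _ (hd.mono (by
      rintro v ((rfl | hv) | hv)
      · exact ⟨a1, by omega⟩
      · exact ⟨hv.1, by have := hv.2; omega⟩
      · have e : v = par y := hv
        rw [e]
        exact ⟨b1, by omega⟩)) (by omega) (by omega)
        (by simpa [Function.iterate_succ_apply] using hne)
        (by rw [Function.iterate_succ_apply (f := par) (n := h + 1), Function.iterate_succ_apply (f := par) (n := h + 1)] at heq; exact heq)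
    have e : (par x :: l ++ [par y]).length + 2 * h + 1 = l.length + 2 * (h + 1) + 1 := by simp; omega
    rwa [e] at this

theorem layerThm [Finite V] {U : Set V} {r : ℕ} (hr : 1 ≤ r) (hU : Crit G U (2 * r)) : ∃ X0 ⊆ U,
    (¬ ∃ c : V → Fin r, Pr G X0 c) ∧ ∀ X ⊆ X0, (∃ x ∈ X, ∃ y ∈ X, x ≠ y) →
      ∃ (φ : V → V) (h : ℕ), 1 ≤ h ∧ (∃ x ∈ X, ∃ y ∈ X, φ x ≠ φ y) ∧
        ∀ x y l, φ x ≠ φ y → Pth G X x y l → CycL G (l.length + 2 * h - 1) := by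
  classical
  have hne : U.Nonempty := by
    by_contra h
    rw [Set.not_nonempty_iff_eq_empty] at h
    subst h
    exact hU.1 ⟨fun _ => ⟨0, by omega⟩, fun v hv => absurd hv (by simp)⟩
  obtain ⟨ρ, hρ⟩ := hne
  have hUc : Conn G U := by
    have := hU.clique (X := ∅) (by simp) (by simp)
    simpa using this
  obtain ⟨lev, par, h1, h2, h3⟩ := bfs hUc hρ
  obtain ⟨j, hj⟩ : ∃ j, ¬ ∃ c : V → Fin r, Pr G {v | v ∈ U ∧ lev v = j} c := by
    by_contra! hcon
    choose c hc using hcon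
    refine hU.1 ⟨fun v => finProdFinEquiv (⟨lev v % 2, Nat.mod_lt _ (by norm_num)⟩, c (lev v) v), ?_⟩
    intro u hu v hv huv heq
    have heq := finProdFinEquiv.injective heq
    simp only [Prod.mk.injEq, Fin.mk.injEq] at heq
    have e1 := h3 u hu v hv huv
    have e2 := h3 v hv u hu huv.symm
    have e3 : lev u = lev v := by omega
    have := heq.2
    rw [e3] at this
    exact hc (lev v) u ⟨hu, e3⟩ v ⟨hv, rfl⟩ huv this
  refine ⟨{v | v ∈ U ∧ lev v = j}, fun v hv => hv.1, hj, ?_⟩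
  rintro X hX ⟨x, hx, y, hy, hxy⟩
  have hroot : ∀ i, ∀ v ∈ U, lev v = i → par^[i] v = ρ := by
    intro i
    induction i with
    | zero => exact fun v hv h => h1 v hv h
    | succ i ih =>
      intro v hv h
      obtain ⟨a1, a2, a3⟩ := h2 v hv (by omega)
      rw [Function.iterate_succ_apply]
      exact ih _ a1 (by omega)
  have hex : ∃ h, ∀ x ∈ X, ∀ y ∈ X, par^[h] x = par^[h] y :=
    ⟨j, fun x hx y hy => (hroot j x (hX hx).1 (hX hx).2).trans (hroot j y (hX hy).1 (hX hy).2).symm⟩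
  obtain ⟨g, hg⟩ : ∃ g, Nat.find hex = g + 1 := by
    refine Nat.exists_eq_succ_of_ne_zero fun h0 => ?_
    have := Nat.find_spec hex
    rw [h0] at this
    exact hxy (this x hx y hy)
  refine ⟨par^[g], g + 1, by omega, ?_, ?_⟩
  · have := Nat.find_min hex (m := g) (by omega)
    push Not at this
    exact this
  · intro a b l hab hl
    have hs := Nat.find_spec hex
    rw [hg] at hs
    have ha := hl.mem _ hl.head_mem
    have hb := hl.mem _ hl.last_mem
    have := treeCycle h1 h2 g j a b l (hl.mono (fun v hv => ⟨(hX hv).1, (hX hv).2.ge⟩)) (hX ha).2 (hX hb).2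
      hab (hs a ha b hb)
    have e : l.length + 2 * (g + 1) - 1 = l.length + 2 * g + 1 := by omega
    rwa [e]

end OC

namespace OC
open Set

variable {V : Type*} {G : SimpleGraph V}

structure ZC (G : SimpleGraph V) (X : Set V) (N : ℕ) (v : ℤ → V) : Prop where
  per : ∀ i, v (i + N) = v i
  inj : ∀ i j, v i = v j → |i - j| < N → i = j
  adj : ∀ i, G.Adj (v i) (v (i + 1))
  mem : ∀ i, v i ∈ X

theorem ZC.arc {X : Set V} {N : ℕ} {v : ℤ → V} (Z : ZC G X N v) (i e : ℤ) (he : e = 1 ∨ e = -1)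
    (k : ℕ) (hk : k < N) : ∃ l, Pth G {x | ∃ t : ℕ, t ≤ k ∧ x = v (i + e * t)} (v i) (v (i + e * k)) l ∧
      l.length = k + 1 := by
  induction k with
  | zero => exact ⟨[v i], by simpa using (Pth.single (W := {x | x = v i}) rfl), rfl⟩
  | succ k ih =>
    obtain ⟨l, hl, hlen⟩ := ih (by omega)
    refine ⟨l ++ [v (i + e * (k + 1 : ℕ))], ((hl.append (Pth.single (W := {v (i + e * (k + 1 : ℕ))}) rfl) ?_ ?_).mono ?_), by simp [hlen]⟩
    · rcases he with rfl | rfl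
      · have := Z.adj (i + 1 * k)
        have e : i + 1 * (k : ℤ) + 1 = i + 1 * ((k + 1 : ℕ) : ℤ) := by push_cast; ring
        rwa [e] at this
      · have := (Z.adj (i + -1 * (k + 1 : ℕ))).symm
        have e : i + -1 * ((k + 1 : ℕ) : ℤ) + 1 = i + -1 * (k : ℤ) := by push_cast; ring
        rwa [e] at this
    · rintro x ⟨t, ht, rfl⟩ hx
      have hx : v (i + e * t) = v (i + e * (k + 1 : ℕ)) := hx
      rcases he with rfl | rfl
      · have := Z.inj _ _ hx (by rw [abs_lt]; constructor <;> push_cast <;> omega)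
        push_cast at this; omega
      · have := Z.inj _ _ hx (by rw [abs_lt]; constructor <;> push_cast <;> omega)
        push_cast at this; omega
    · rintro x (⟨t, ht, rfl⟩ | hx)
      · exact ⟨t, by omega, rfl⟩
      · exact ⟨k + 1, le_rfl, hx⟩

theorem ZC.two {X : Set V} {N : ℕ} {v : ℤ → V} (Z : ZC G X N v) {c : ℤ} (hc : G.Adj (v 0) (v c))
    (e1 e2 : ℤ) (he1 : e1 = 1 ∨ e1 = -1) (he2 : e2 = 1 ∨ e2 = -1) (p q : ℕ) (hp : p < N) (hq : q < N)
    (hd : ∀ s t : ℕ, s ≤ p → t ≤ q → 0 < c + e2 * t - e1 * s ∧ c + e2 * t - e1 * s < N) :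
    ∃ l, Pth G X (v (e1 * p)) (v (c + e2 * q)) l ∧ l.length = p + q + 2 := by
  obtain ⟨l1, h1, n1⟩ := Z.arc 0 e1 he1 p hp
  obtain ⟨l2, h2, n2⟩ := Z.arc c e2 he2 q hq
  have := h1.reverse.append h2 hc (by
    rintro x ⟨s, hs, rfl⟩ ⟨t, ht, h⟩
    obtain ⟨d1, d2⟩ := hd s t hs ht
    have := Z.inj _ _ h (by rw [abs_lt]; constructor <;> linarith)
    linarith)
  rw [zero_add] at this
  refine ⟨_, this.mono ?_, by simp [n1, n2]; omega⟩
  rintro x (⟨s, hs, rfl⟩ | ⟨t, ht, rfl⟩) <;> exact Z.mem _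

theorem win_pos {L : Type*} {F : ℤ → L} {g : ℕ} (hg : Function.Periodic F g) (hg0 : 0 < g) (w d : ℤ)
    (h : ∀ x, w ≤ x → x < w + g → F x = F (x + d)) (x : ℤ) : F x = F (x + d) := by
  have hm := Int.emod_add_mul_ediv (x - w) g
  have h1 := Int.emod_nonneg (x - w) (b := g) (by omega)
  have h2 := Int.emod_lt_of_pos (x - w) (b := g) (by omega)
  have hk := hg.int_mul ((x - w) / g)
  rw [Int.cast_id] at hk
  have e : x = w + (x - w) % g + (x - w) / g * g := by linarith
  have a1 := hk (w + (x - w) % g)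
  have a2 := hk (w + (x - w) % g + d)
  have e2 : x + d = w + (x - w) % g + d + (x - w) / g * g := by linarith
  have a1' := (congrArg F e).trans a1
  have a2' := (congrArg F e2).trans a2
  rw [a1', a2']
  exact h _ (by linarith) (by linarith)

theorem win_neg {L : Type*} {F : ℤ → L} {g : ℕ} (hg : Function.Periodic F g) (hg0 : 0 < g) (w d : ℤ)
    (h : ∀ x, w ≤ x → x < w + g → F x = F (d - x)) (x : ℤ) : F x = F (d - x) := by
  have hm := Int.emod_add_mul_ediv (x - w) g
  have h1 := Int.emod_nonneg (x - w) (b := g) (by omega)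
  have h2 := Int.emod_lt_of_pos (x - w) (b := g) (by omega)
  have hk := hg.int_mul ((x - w) / g)
  rw [Int.cast_id] at hk
  have e : x = w + (x - w) % g + (x - w) / g * g := by linarith
  have a1 := hk (w + (x - w) % g)
  have a2 := hk (d - x)
  have e2 : d - x + (x - w) / g * g = d - (w + (x - w) % g) := by linarith
  have a1' := (congrArg F e).trans a1
  rw [e2] at a2
  rw [a1', ← a2]
  exact h _ (by linarith) (by linarith)

theorem min_per {L : Type*} {F : ℤ → L} {N : ℕ} (hN : 0 < N) (h : Function.Periodic F N) :
    ∃ g : ℕ, 0 < g ∧ Function.Periodic F g ∧ ∀ p : ℤ, Function.Periodic F p → (g : ℤ) ∣ p := by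
  classical
  have hex : ∃ g : ℕ, 0 < g ∧ Function.Periodic F g := ⟨N, hN, h⟩
  obtain ⟨g0, g1⟩ := Nat.find_spec hex
  refine ⟨Nat.find hex, g0, g1, fun p hp => ?_⟩
  set g := Nat.find hex with hg
  rw [Int.dvd_iff_emod_eq_zero]
  have h1 := Int.emod_nonneg p (b := g) (by omega)
  have h2 := Int.emod_lt_of_pos p (b := g) (by omega)
  by_contra hne
  have hper : Function.Periodic F (p % g) := by
    have hk := g1.int_mul (p / g)
    rw [Int.cast_id] at hk
    have hm := Int.emod_add_mul_ediv p g
    intro x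
    have := hk (x + p % g)
    have e : x + p % g + (p / g) * g = x + p := by linarith
    rw [e, hp x] at this
    exact this.symm
  refine Nat.find_min hex (m := (p % g).toNat) (by omega) ⟨by omega, ?_⟩
  rwa [Int.toNat_of_nonneg h1]

theorem ZC.periodic {X : Set V} {N : ℕ} {v : ℤ → V} (Z : ZC G X N v) {L : Type*} (f : V → L) {ℓ : ℕ}
    (hℓ : ℓ < N) (H : ∀ x y l, Pth G X x y l → l.length = ℓ + 1 → f x = f y) :
    Function.Periodic (f ∘ v) ℓ := by
  intro i
  obtain ⟨l, hl, hlen⟩ := Z.arc i 1 (Or.inl rfl) ℓ hℓ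
  have := H _ _ l (hl.mono (by rintro x ⟨t, _, rfl⟩; exact Z.mem _)) hlen
  simpa using this.symm

theorem ZC.SV {X : Set V} {N : ℕ} {v : ℤ → V} (Z : ZC G X N v) {c : ℕ} (hc2 : 2 ≤ c) (hcN : c + 2 ≤ N)
    (hc : G.Adj (v 0) (v c)) {L : Type*} (f : V → L) (hf : ∃ i j, f (v i) ≠ f (v j)) {ℓ : ℕ}
    (hℓ : ℓ < N) (hodd : ℓ % 2 = 1) :
    ∃ x y l, f x ≠ f y ∧ Pth G X x y l ∧ l.length = ℓ + 1 := by
  by_contra! hcon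
  have H : ∀ x y l, Pth G X x y l → l.length = ℓ + 1 → f x = f y := by
    intro x y l h1 h2
    by_contra h
    exact hcon x y l h h1 h2
  set F : ℤ → L := f ∘ v with hF
  have pN : Function.Periodic F N := fun i => by simp [hF, Z.per]
  have pℓ : Function.Periodic F ℓ := Z.periodic f hℓ H
  obtain ⟨g, g0, pg, hg⟩ := min_per (by omega) pN
  have dN : g ∣ N := by exact_mod_cast hg _ pN
  have dℓ : g ∣ ℓ := by exact_mod_cast hg _ pℓ
  have g1 : g ≠ 1 := by
    rintro rfl
    obtain ⟨i, j, hij⟩ := hf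
    have : ∀ i, F i = F 0 := fun i => by
      have := pg.int_mul i 0
      simpa using this
    exact hij ((this i).trans (this j).symm)
  have godd : g % 2 = 1 := by
    obtain ⟨k, hk⟩ := dℓ
    have := Nat.odd_iff.2 hodd
    rw [hk, Nat.odd_mul] at this
    exact Nat.odd_iff.1 this.1
  have gℓ : g ≤ ℓ := Nat.le_of_dvd (by omega) dℓ
  have gNℓ : g ≤ N - ℓ := Nat.le_of_dvd (by omega) (Nat.dvd_sub dN dℓ)
  -- chord paths
  have key : ∀ (e1 e2 : ℤ), (e1 = 1 ∨ e1 = -1) → (e2 = 1 ∨ e2 = -1) → ∀ j : ℕ, j < ℓ →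
      (∀ s t : ℕ, s ≤ j → t ≤ ℓ - 1 - j → 0 < (c : ℤ) + e2 * t - e1 * s ∧ (c : ℤ) + e2 * t - e1 * s < N) →
      F (e1 * j) = F (c + e2 * (ℓ - 1 - j : ℕ)) := by
    intro e1 e2 he1 he2 j hj hd
    obtain ⟨l, hl, hlen⟩ := Z.two hc e1 e2 he1 he2 j (ℓ - 1 - j) (by omega) (by omega) hd
    exact H _ _ l hl (by omega)
  by_cases hcg : c < g
  · have := win_pos pg g0 (-g + 1) (c - 1) (by
      intro x hx1 hx2
      have := key (-1) 1 (Or.inr rfl) (Or.inl rfl) (-x).toNat (by omega) (by intro s t hs ht; omega)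
      have e1 : (-1 : ℤ) * ((-x).toNat : ℤ) = x := by omega
      have e2 : (c : ℤ) + 1 * ((ℓ - 1 - (-x).toNat : ℕ) : ℤ) = x + (c - 1) + ℓ := by omega
      rw [e1, e2, pℓ] at this
      exact this)
    have hp : Function.Periodic F ((c : ℤ) - 1) := fun x => (this x).symm
    have := Int.le_of_dvd (by omega) (hg _ hp)
    omega
  by_cases hcg' : N - c < g
  · have := win_pos pg g0 0 (c + 1) (by
      intro x hx1 hx2
      have := key 1 (-1) (Or.inl rfl) (Or.inr rfl) x.toNat (by omega) (by intro s t hs ht; omega)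
      have e1 : (1 : ℤ) * (x.toNat : ℤ) = x := by omega
      have e2 : (c : ℤ) + -1 * ((ℓ - 1 - x.toNat : ℕ) : ℤ) + ℓ = x + (c + 1) := by omega
      rw [e1, ← pℓ (c + _), e2] at this
      exact this)
    have hp : Function.Periodic F ((c : ℤ) + 1) := fun x => (this x).symm
    have d1 := dvd_sub (Int.natCast_dvd_natCast.2 dN) (hg _ hp)
    have := Int.le_of_dvd (by omega) d1
    omega
  · have r1 := win_neg pg g0 (-((ℓ - c : ℕ) + g - 1 : ℤ)) (c + 1) (by
      intro x hx1 hx2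
      have := key (-1) (-1) (Or.inr rfl) (Or.inr rfl) (-x).toNat (by omega) (by intro s t hs ht; omega)
      have e1 : (-1 : ℤ) * ((-x).toNat : ℤ) = x := by omega
      have e2 : (c : ℤ) + -1 * ((ℓ - 1 - (-x).toNat : ℕ) : ℤ) + ℓ = c + 1 - x := by omega
      rw [e1, ← pℓ (c + _), e2] at this
      exact this)
    have r2 := win_neg pg g0 ((ℓ + c - N : ℕ) : ℤ) (c - 1) (by
      intro x hx1 hx2
      have := key 1 1 (Or.inl rfl) (Or.inl rfl) x.toNat (by omega) (by intro s t hs ht; omega)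
      have e1 : (1 : ℤ) * (x.toNat : ℤ) = x := by omega
      have e2 : (c : ℤ) + 1 * ((ℓ - 1 - x.toNat : ℕ) : ℤ) = c - 1 - x + ℓ := by omega
      rw [e1, e2, pℓ] at this
      exact this)
    have hp : Function.Periodic F (2 : ℤ) := fun x => by
      have a1 := r1 (c - 1 - x)
      have a2 := r2 (c - 1 - x)
      have e1 : (c : ℤ) + 1 - (c - 1 - x) = x + 2 := by ring
      have e2 : (c : ℤ) - 1 - (c - 1 - x) = x := by ring
      rw [e1] at a1
      rw [e2] at a2
      exact a1.symm.trans a2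
    have := Int.le_of_dvd (by omega) (hg _ hp)
    omega

theorem ZC.SV2 {X : Set V} {N : ℕ} {v : ℤ → V} (Z : ZC G X N v) (hN : 5 ≤ N) (hN2 : N % 2 = 1)
    {L : Type*} (f : V → L) (hf : ∃ i j, f (v i) ≠ f (v j)) :
    ∃ e, ∀ i < 2, ∃ x y l, f x ≠ f y ∧ Pth G X x y l ∧ l.length = 2 + 2 * i + 2 * e := by
  set F : ℤ → L := f ∘ v with hF
  have pN : Function.Periodic F N := fun i => by simp [hF, Z.per]
  obtain ⟨g, g0, pg, hg⟩ := min_per (by omega) pN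
  have dN : g ∣ N := by exact_mod_cast hg _ pN
  have g1 : g ≠ 1 := by
    rintro rfl
    obtain ⟨i, j, hij⟩ := hf
    have : ∀ i, F i = F 0 := fun i => by
      have := pg.int_mul i 0
      simpa using this
    exact hij ((this i).trans (this j).symm)
  have hP : ∀ ℓ < N, ¬ g ∣ ℓ → ∃ x y l, f x ≠ f y ∧ Pth G X x y l ∧ l.length = ℓ + 1 := by
    intro ℓ hℓ hgl
    by_contra! hcon
    refine hgl ?_
    exact_mod_cast hg _ (Z.periodic f hℓ (by
      intro x y l h1 h2
      by_contra h
      exact hcon x y l h h1 h2))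
  by_cases h3 : g = 3
  · subst h3
    have : N ≠ 7 := by omega
    refine ⟨2, fun i hi => ?_⟩
    have := hP (5 + 2 * i) (by omega) (by omega)
    obtain ⟨x, y, l, a1, a2, a3⟩ := this
    exact ⟨x, y, l, a1, a2, by omega⟩
  · refine ⟨0, fun i hi => ?_⟩
    have := hP (1 + 2 * i) (by omega) (by
      intro h
      rcases Nat.lt_or_ge i 1 with hi' | hi'
      · have := Nat.le_of_dvd (by omega) h
        omega
      · have e : 1 + 2 * i = 3 := by omega
        rw [e] at h
        rcases (Nat.dvd_prime Nat.prime_three).1 h with h | h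
        · exact g1 h
        · exact h3 h)
    obtain ⟨x, y, l, a1, a2, a3⟩ := this
    exact ⟨x, y, l, a1, a2, by omega⟩

end OC

namespace OC
open Set

variable {V : Type*} {G : SimpleGraph V}

theorem zc_of_list {l : List V} (hch : l.IsChain G.Adj) (hnd : l.Nodup) (hN : 0 < l.length)
    (hcl : G.Adj (l[l.length - 1]'(by omega)) (l[0]'hN)) :
    ∃ v : ℤ → V, ZC G (range v) l.length v ∧ (∀ i, v i ∈ l) ∧
      ∀ (i : ℕ) (hi : i < l.length), v i = l[i] := by
  have hb : ∀ i : ℤ, (i % l.length).toNat < l.length := by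
    intro i
    have h1 := Int.emod_nonneg i (b := l.length) (by omega)
    have h2 := Int.emod_lt_of_pos i (b := l.length) (by omega)
    omega
  refine ⟨fun i => l[(i % l.length).toNat]'(hb i), ⟨?_, ?_, ?_, fun i => ⟨i, rfl⟩⟩, ?_, ?_⟩
  · intro i
    simp
  · intro i j hij habs
    have := (hnd.getElem_inj_iff).1 hij
    have h1 := Int.emod_nonneg i (b := l.length) (by omega)
    have h2 := Int.emod_nonneg j (b := l.length) (by omega)
    have h3 : i % l.length = j % l.length := by omega
    have h4 : (l.length : ℤ) ∣ i - j := Int.dvd_of_emod_eq_zero (Int.emod_eq_emod_iff_emod_sub_eq_zero.1 h3)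
    have := Int.eq_zero_of_abs_lt_dvd h4 habs
    omega
  · intro i
    have h1 := Int.emod_nonneg i (b := l.length) (by omega)
    have h2 := Int.emod_lt_of_pos i (b := l.length) (by omega)
    have hadd : (i + 1) % l.length = (i % l.length + 1) % l.length := by simp
    by_cases h : i % l.length + 1 < l.length
    · have e : (i + 1) % l.length = i % l.length + 1 := by
        rw [hadd, Int.emod_eq_of_lt (by omega) h]
      have := (List.isChain_iff_getElem.1 hch) (i % l.length).toNat (by omega)
      have e2 : ((i + 1) % l.length).toNat = (i % l.length).toNat + 1 := by omega
      simpa only [e2] using this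
    · have e : (i + 1) % l.length = 0 := by
        rw [hadd, show i % l.length + 1 = l.length by omega]
        simp
      have e2 : ((i + 1) % l.length).toNat = 0 := by omega
      have e3 : (i % l.length).toNat = l.length - 1 := by omega
      simpa only [e2, e3] using hcl
  · intro i
    exact List.getElem_mem _
  · intro i hi
    have : ((i : ℤ) % l.length).toNat = i := by
      rw [Int.emod_eq_of_lt (by omega) (by omega)]; simp
    simp only [this]

theorem Pth.get0 {W : Set V} {a b : V} {l : List V} (h : Pth G W a b l) :
    ∃ hN : 0 < l.length, l[0] = a ∧ l[l.length - 1] = b := by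
  have hne : l ≠ [] := by rintro rfl; simpa using h.4
  refine ⟨List.length_pos_of_ne_nil hne, ?_, ?_⟩
  · have := h.4
    rw [List.head?_eq_some_head hne] at this
    rw [← List.head_eq_getElem hne]
    exact Option.some.inj this
  · have := h.5
    rw [List.getLast?_eq_some_getLast hne] at this
    rw [← List.getLast_eq_getElem hne]
    exact Option.some.inj this

theorem CycL.zc {n : ℕ} (h : CycL G n) : 3 ≤ n ∧ ∃ v : ℤ → V, ZC G (range v) n v := by
  obtain ⟨a, b, l, hl, hba, rfl, h3⟩ := h
  obtain ⟨hN, e0, e1⟩ := hl.get0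
  obtain ⟨v, hv, -⟩ := zc_of_list hl.1 hl.2 hN (by rw [e0, e1]; exact hba)
  exact ⟨h3, v, hv⟩

variable [Finite V]

theorem caseOne {U : Set V} (hU : Crit G U 2) : ∃ m, 0 < m ∧ CycL G (2 * m + 1) := by
  classical
  obtain ⟨X0, hX0, hne, hX⟩ := layerThm (r := 1) le_rfl hU
  obtain ⟨x, hx, y, hy, hxy⟩ : ∃ x ∈ X0, ∃ y ∈ X0, G.Adj x y := by
    by_contra! h
    exact hne ⟨fun _ => 0, fun u hu v hv huv => absurd huv (h u hu v hv)⟩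
  obtain ⟨φ, h, h1, ⟨a, ha, b, hb, hab⟩, hc⟩ := hX {x, y} (by rintro z (rfl | rfl) <;> assumption)
    ⟨x, by simp, y, by simp, hxy.ne⟩
  have hadj : G.Adj a b := by
    rcases ha with rfl | rfl <;> rcases hb with rfl | rfl
    · exact absurd rfl hab
    · exact hxy
    · exact hxy.symm
    · exact absurd rfl hab
  have := hc a b [a, b] hab ⟨by simpa using hadj, by simpa using hadj.ne, by
    intro v hv
    simp only [List.mem_cons, List.not_mem_nil, or_false] at hv
    rcases hv with rfl | rfl <;> assumption, rfl, rfl⟩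
  refine ⟨h, by omega, ?_⟩
  have e : [a, b].length + 2 * h - 1 = 2 * h + 1 := by simp; omega
  rwa [e] at this

theorem rs_crit {H : Set V} {n : ℕ} (hH : Crit G H n) : Crit (rs G H) H n := by
  constructor
  · rintro ⟨c, hc⟩
    exact hH.1 ⟨c, fun u hu v hv huv => hc u hu v hv ⟨huv, hu, hv⟩⟩
  · intro A hA hne
    obtain ⟨c, hc⟩ := hH.2 A hA hne
    exact ⟨c, fun u hu v hv huv => hc u hu v hv huv.1⟩

theorem Crit.deg {H : Set V} {r : ℕ} (hH : Crit G H r) {v : V} (hv : v ∈ H) :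
    r ≤ {u | u ∈ H ∧ G.Adj v u}.ncard := by
  classical
  by_contra! hlt
  obtain ⟨c, hc⟩ := hH.2 (H \ {v}) sdiff_subset (fun h => by
    have : v ∈ H \ {v} := (Set.ext_iff.1 h v).2 hv
    exact this.2 rfl)
  set Q := {u | u ∈ H ∧ G.Adj v u} with hQ
  have hf : Q.Finite := Set.toFinite _
  obtain ⟨γ, hγ⟩ : ∃ γ : Fin r, γ ∉ hf.toFinset.image c := by
    by_contra! h
    have h1 : (Finset.univ : Finset (Fin r)).card ≤ (hf.toFinset.image c).card :=
      Finset.card_le_card (fun x _ => h x)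
    have h4 := Finset.card_image_le (s := hf.toFinset) (f := c)
    rw [← Set.ncard_eq_toFinset_card] at h4
    rw [Finset.card_univ, Fintype.card_fin] at h1
    omega
  simp only [Finset.mem_image, Set.Finite.mem_toFinset, not_exists, not_and] at hγ
  refine hH.1 ⟨Function.update c v γ, fun x hx y hy hxy => ?_⟩
  by_cases h1 : x = v
  · subst h1
    rw [Function.update_self, Function.update_of_ne hxy.ne.symm]
    exact fun h => hγ y ⟨hy, hxy⟩ h.symm
  · by_cases h2 : y = v
    · subst h2
      rw [Function.update_self, Function.update_of_ne h1]
      exact hγ x ⟨hx, hxy.symm⟩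
    · rw [Function.update_of_ne h1, Function.update_of_ne h2]
      exact hc x ⟨hx, h1⟩ y ⟨hy, h2⟩ hxy

theorem longest {H : Set V} (hH : H.Nonempty) : ∃ a b l, Pth G H a b l ∧
    ∀ u ∈ H, G.Adj a u → u ∈ l := by
  classical
  have : Fintype V := Fintype.ofFinite V
  let S : Set ℕ := {n | ∃ a b l, Pth G H a b l ∧ l.length = n}
  have hne : S.Nonempty := by
    obtain ⟨a, ha⟩ := hH
    exact ⟨1, a, a, [a], Pth.single ha, rfl⟩
  have hbd : BddAbove S := by
    refine ⟨Fintype.card V, ?_⟩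
    rintro n ⟨a, b, l, hl, rfl⟩
    exact hl.nodup.length_le_card
  obtain ⟨a, b, l, hl, hlen⟩ := Nat.sSup_mem hne hbd
  refine ⟨a, b, l, hl, fun u hu hau => ?_⟩
  by_contra hul
  have hl' : Pth G {x | x ∈ l} a b l := ⟨hl.1, hl.2, fun v hv => hv, hl.4, hl.5⟩
  have hc := (hl'.cons (s := u) hau.symm hul).mono (W' := H) (by
    rintro x (rfl | hx)
    · exact hu
    · exact hl.mem x hx)
  have := le_csSup hbd (⟨u, b, _, hc, rfl⟩ : (u :: l).length ∈ S)
  simp at this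
  omega

theorem cycle_chord {H : Set V} {r : ℕ} (hr : 3 ≤ r) (hH : Crit G H r)
    (htri : ∀ a ∈ H, ∀ b ∈ H, ∀ c ∈ H, G.Adj a b → G.Adj b c → ¬ G.Adj a c) :
    ∃ (N : ℕ) (v : ℤ → V) (c : ℕ), 2 * r ≤ N ∧ ZC G (range v) N v ∧ (∀ i, v i ∈ H) ∧ 2 ≤ c ∧ c + 2 ≤ N ∧
      G.Adj (v 0) (v c) := by
  classical
  have hne : H.Nonempty := by
    by_contra h
    rw [Set.not_nonempty_iff_eq_empty] at h
    subst h
    exact hH.1 ⟨fun _ => ⟨0, by omega⟩, fun v hv => absurd hv (by simp)⟩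
  obtain ⟨a, b, l, hl, hmax⟩ := longest (G := G) hne
  obtain ⟨hN, e0, -⟩ := hl.get0
  let I : Finset ℕ := (Finset.range l.length).filter (fun i => G.Adj a (l.getD i a))
  have hI : ∀ i, i ∈ I ↔ ∃ hi : i < l.length, G.Adj a l[i] := by
    intro i
    simp only [I, Finset.mem_filter, Finset.mem_range]
    constructor
    · rintro ⟨h1, h2⟩
      exact ⟨h1, by simpa [h1] using h2⟩
    · rintro ⟨h1, h2⟩
      exact ⟨h1, by simpa [h1] using h2⟩
  have hIr : r ≤ I.card := by
    refine (hH.deg (hl.mem _ hl.head_mem)).trans ?_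
    have hsub : {u | u ∈ H ∧ G.Adj a u} ⊆ ((I.image (fun i => l.getD i a) : Finset V) : Set V) := by
      rintro u ⟨hu, hau⟩
      obtain ⟨i, hi, rfl⟩ := List.getElem_of_mem (hmax u hu hau)
      simp only [Finset.coe_image, Set.mem_image, Finset.mem_coe]
      exact ⟨i, (hI i).2 ⟨hi, hau⟩, by simp [hi]⟩
    have := Set.ncard_le_ncard hsub (Finset.finite_toSet _)
    rw [Set.ncard_coe_finset] at this
    exact this.trans Finset.card_image_le
  have hI0 : 0 ∉ I := by
    intro h
    obtain ⟨_, h⟩ := (hI 0).1 h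
    rw [e0] at h
    exact G.irrefl h
  have hIc : ∀ i, i ∈ I → i + 1 ∈ I → False := by
    intro i h1 h2
    obtain ⟨hi, h1⟩ := (hI i).1 h1
    obtain ⟨hi', h2⟩ := (hI _).1 h2
    exact htri a (hl.mem _ hl.head_mem) _ (hl.mem _ (List.getElem_mem hi)) _ (hl.mem _ (List.getElem_mem hi'))
      h1 ((List.isChain_iff_getElem.1 hl.1) i hi') h2
  have hIne : I.Nonempty := Finset.card_pos.1 (by omega)
  obtain ⟨M, hMI, hM⟩ : ∃ M ∈ I, ∀ i ∈ I, i ≤ M := ⟨I.max' hIne, I.max'_mem hIne, fun i hi => I.le_max' i hi⟩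
  have hM0 : M ≠ 0 := fun h => hI0 (h ▸ hMI)
  have hMr : 2 * r ≤ M + 1 := by
    have : I.card ≤ (Finset.range ((M - 1) / 2 + 1)).card := by
      refine Finset.card_le_card_of_injOn (fun i => (i - 1) / 2) ?_ ?_
      · intro i hi
        have := hM i hi
        simp only [Finset.coe_range, Set.mem_Iio]
        omega
      · intro i hi j hj hij
        have hi : i ∈ I := hi
        have hj : j ∈ I := hj
        have i0 : i ≠ 0 := fun h => hI0 (h ▸ hi)
        have j0 : j ≠ 0 := fun h => hI0 (h ▸ hj)
        have h1 : i + 1 ≠ j := by rintro rfl; exact hIc i hi hj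
        have h2 : j + 1 ≠ i := by rintro rfl; exact hIc j hj hi
        simp only at hij
        omega
    rw [Finset.card_range] at this
    omega
  obtain ⟨c, hcI, hc⟩ : ∃ c ∈ I, c ∉ ({1, M} : Finset ℕ) := by
    refine Finset.exists_mem_notMem_of_card_lt_card ?_
    have := Finset.card_le_two (a := 1) (b := M)
    omega
  simp only [Finset.mem_insert, Finset.mem_singleton, not_or] at hc
  have c0 : c ≠ 0 := fun h => hI0 (h ▸ hcI)
  have cM := hM c hcI
  obtain ⟨hMl, hMa⟩ := (hI M).1 hMI
  obtain ⟨hcl, hca⟩ := (hI c).1 hcI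
  have hlen : (l.take (M + 1)).length = M + 1 := by simp; omega
  obtain ⟨v, hZ, hm, hv⟩ := zc_of_list (G := G) (l := l.take (M + 1)) (hl.1.take _) (hl.2.sublist (List.take_sublist _ _))
    (by omega) (by
      simp only [hlen, List.getElem_take, Nat.add_sub_cancel, e0]
      exact hMa.symm)
  rw [hlen] at hZ
  refine ⟨M + 1, v, c, hMr, hZ, fun i => hl.mem _ (List.mem_of_mem_take (hm i)), by omega, by omega, ?_⟩
  have v0 := hv 0 (by omega)
  have vc := hv c (by omega)
  simp only [List.getElem_take, Nat.cast_zero, e0] at v0 vc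
  rw [v0, vc]
  exact hca

theorem caseT {U : Set V} {r : ℕ} (hr : 2 ≤ r) (hU : Crit G U (2 * r))
    (htri : ∀ a ∈ U, ∀ b ∈ U, ∀ c ∈ U, G.Adj a b → G.Adj b c → ¬ G.Adj a c) :
    ∃ m, 0 < m ∧ ∀ i < r, CycL G (2 * m + 1 + 2 * i) := by
  classical
  obtain ⟨X0, hX0, hne, hX⟩ := layerThm (by omega) hU
  obtain ⟨H, hHX, hH⟩ := exists_crit hne
  have htri' : ∀ a ∈ H, ∀ b ∈ H, ∀ c ∈ H, G.Adj a b → G.Adj b c → ¬ G.Adj a c :=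
    fun a ha b hb c hc => htri a (hX0 (hHX ha)) b (hX0 (hHX hb)) c (hX0 (hHX hc))
  suffices hs : ∃ v : ℤ → V, (∀ i, G.Adj (v i) (v (i + 1))) ∧ (∀ i, v i ∈ H) ∧ ∀ f : V → V, (∃ i j, f (v i) ≠ f (v j)) →
      ∃ e, ∀ i < r, ∃ x y l, f x ≠ f y ∧ Pth G (range v) x y l ∧ l.length = 2 + 2 * i + 2 * e by
    obtain ⟨v, hadj, hvH, hv⟩ := hs
    obtain ⟨φ, h, h1, ⟨a, ⟨i, rfl⟩, b, ⟨j, rfl⟩, hab⟩, hc⟩ := hX (range v) (by rintro _ ⟨i, rfl⟩; exact hHX (hvH i))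
      ⟨v 0, ⟨0, rfl⟩, v (0 + 1), ⟨_, rfl⟩, (hadj 0).ne⟩
    obtain ⟨e, he⟩ := hv φ ⟨i, j, hab⟩
    refine ⟨h + e, by omega, fun i hi => ?_⟩
    obtain ⟨x, y, l, hxy, hl, hlen⟩ := he i hi
    have := hc x y l hxy hl
    have e : l.length + 2 * h - 1 = 2 * (h + e) + 1 + 2 * i := by omega
    rwa [e] at this
  rcases Nat.lt_or_ge 2 r with h3 | h3
  · obtain ⟨N, v, c, hN, hZ, hvH, hc2, hcN, hc⟩ := cycle_chord h3 hH htri'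
    refine ⟨v, hZ.adj, hvH, fun f hf => ⟨0, fun i hi => ?_⟩⟩
    obtain ⟨x, y, l, h1, h2, h3⟩ := hZ.SV hc2 hcN hc f hf (ℓ := 1 + 2 * i) (by omega) (by omega)
    exact ⟨x, y, l, h1, h2, by omega⟩
  · obtain rfl : r = 2 := by omega
    obtain ⟨m, hm, hcyc⟩ := caseOne (rs_crit hH)
    obtain ⟨hN3, v, hZ⟩ := hcyc.zc
    have hZ' : ZC G (range v) (2 * m + 1) v := ⟨hZ.per, hZ.inj, fun i => (hZ.adj i).1, hZ.mem⟩
    have hvH : ∀ i, v i ∈ H := fun i => (hZ.adj i).2.1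
    have hN5 : m ≠ 1 := by
      rintro rfl
      have a0 := hZ'.adj 0
      have a1 := hZ'.adj 1
      have a2 := hZ'.adj 2
      have p := hZ'.per 0
      norm_num at a0 a1 a2 p
      rw [p] at a2
      exact htri' _ (hvH 0) _ (hvH 1) _ (hvH 2) a0 a1 a2.symm
    exact ⟨v, hZ'.adj, hvH, fun f hf => hZ'.SV2 (by omega) (by omega) f hf⟩

theorem main {X : Set V} {r : ℕ} (hr : 1 ≤ r) (hX : ¬ ∃ c : V → Fin (2 * r), Pr G X c) :
    ∃ m, 0 < m ∧ ∀ i < r, CycL G (2 * m + 1 + 2 * i) := by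
  classical
  obtain ⟨U, -, hU⟩ := exists_crit hX
  rcases Nat.lt_or_ge r 2 with h2 | h2
  · obtain rfl : r = 1 := by omega
    obtain ⟨m, hm, h⟩ := caseOne hU
    refine ⟨m, hm, fun i hi => ?_⟩
    obtain rfl : i = 0 := by omega
    exact h
  have hCR : CR G (2 * r) → ∃ m, 0 < m ∧ ∀ i < r, CycL G (2 * m + 1 + 2 * i) := by
    rintro ⟨m, hm⟩
    have h3 : 3 ≤ m := by
      obtain ⟨_, _, _, _, _, _, h⟩ := hm 0 (by omega)
      omega
    refine ⟨m / 2, by omega, fun i hi => ?_⟩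
    have := hm (2 * (m / 2) + 1 - m + 2 * i) (by omega)
    have e : m + (2 * (m / 2) + 1 - m + 2 * i) = 2 * (m / 2) + 1 + 2 * i := by omega
    rwa [e] at this
  by_cases hno : CR G (2 * r)
  · exact hCR hno
  by_cases htri : ∀ a ∈ U, ∀ b ∈ U, ∀ c ∈ U, G.Adj a b → G.Adj b c → ¬ G.Adj a c
  · exact caseT h2 hU htri
  push Not at htri
  obtain ⟨a, ha, b, hb, c, hc, hab, hbc, hac⟩ := htri
  obtain ⟨k, hk⟩ : ∃ k, 2 * r = k + 1 := ⟨2 * r - 1, by omega⟩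
  have h3c : ∀ p ∈ U, ∀ q ∈ U, p ≠ q → Conn G (U \ {p, q}) := fun p hp q hq hpq =>
    twoCut hU (by omega) hno hp hq hpq
  rw [hk] at hU hno hCR
  have hA : ∀ y ∈ U, ∀ r1 ∈ U, ∀ m ∈ U, ∀ r2 ∈ U, G.Adj y r1 → G.Adj r1 m → G.Adj m r2 →
      G.Adj r2 y → y ≠ m → r1 ≠ r2 → G.Adj r1 r2 := by
    intro y hy r1 hr1 m hm r2 hr2 h1 h2 h3 h4 hym hr12
    by_contra hna
    exact hno (caseA hU (by omega) h3c hy hr1 hm hr2 h1 h2 h3 h4 hym hr12 hna)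
  by_cases h4 : ∃ p ∈ U, ∃ q ∈ U, ∃ x ∈ U, ∃ y ∈ U, p ≠ q ∧ x ≠ y ∧ G.Adj p x ∧ G.Adj p y ∧
      G.Adj q x ∧ G.Adj q y
  · obtain ⟨p, hp, q, hq, x, hx, y, hy, hpq, hxy, px, py, qx, qy⟩ := h4
    have h1 := hA p hp x hx q hq y hy px qx.symm qy py.symm hpq hxy
    have h2' := hA x hx p hp y hy q hq px.symm py qy.symm qx hxy hpq
    rcases caseB hU (by omega) hA hp hq hx hy h2' px py qx qy h1 with h | h
    · exact absurd h hno
    · exact ⟨1, by omega, fun i hi => h _ (by omega) (by omega)⟩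
  · push Not at h4
    exact absurd (caseC hU (by omega) h3c (fun p hp q hq x hx y hy hpq hxy a1 a2 a3 a4 =>
      h4 p hp q hq x hx y hy hpq hxy a1 a2 a3 a4) ha hb hc hab hac hbc) hno

end OC

namespace OC
open Set

theorem walk_of_list {V : Type*} {G : SimpleGraph V} (l : List V) : ∀ a b, l.IsChain G.Adj →
    l.head? = some a → l.getLast? = some b → ∃ p : G.Walk a b, p.support = l := by
  induction l with
  | nil => intro a b _ h; simp at h
  | cons x t ih =>
    intro a b hc hh hl
    simp only [List.head?_cons, Option.some.injEq] at hh
    subst hh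
    cases t with
    | nil =>
      simp only [List.getLast?_singleton, Option.some.injEq] at hl
      subst hl
      exact ⟨SimpleGraph.Walk.nil, rfl⟩
    | cons y t =>
      rw [List.isChain_cons_cons] at hc
      obtain ⟨p, hp⟩ := ih y b hc.2 rfl (by simpa [List.getLast?_cons_cons] using hl)
      exact ⟨SimpleGraph.Walk.cons hc.1 p, by simp [hp]⟩

theorem CycL.hasCycleLength {V : Type*} {G : SimpleGraph V} {n : ℕ} (h : CycL G n) :
    HasCycleLength G n := by
  obtain ⟨a, b, l, hP, hba, hl, hn⟩ := h
  obtain ⟨p, hp⟩ := walk_of_list l a b hP.chain hP.head hP.last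
  have hpath : p.IsPath := (SimpleGraph.Walk.isPath_def p).2 (hp ▸ hP.nodup)
  have hlen : p.length + 1 = n := by rw [← SimpleGraph.Walk.length_support, hp, hl]
  refine ⟨b, SimpleGraph.Walk.cons hba p, ?_, by simpa using hlen⟩
  rw [SimpleGraph.Walk.cons_isCycle_iff]
  refine ⟨hpath, fun he => ?_⟩
  rw [Sym2.eq_swap] at he
  have := hpath.length_eq_one_of_mem_edges he
  omega

end OC

/-- Every graph of chromatic number `k + 1` (with `k ≥ 2`) contains cycles of `⌊k / 2⌋`
consecutive odd lengths `2m + 1, 2m + 3, …`. -/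
theorem stmt_1 {V : Type*} [Fintype V] (k : ℕ) (hk : 2 ≤ k)
    (G : SimpleGraph V) (hchrom : G.chromaticNumber = k + 1) :
    ∃ m : ℕ, 0 < m ∧ ∀ i < k / 2, HasCycleLength G (2 * m + 1 + 2 * i) := by
  classical
  have hno : ¬ ∃ c : V → Fin (2 * (k / 2)), OC.Pr G Set.univ c := by
    rintro ⟨c, hc⟩
    have hcol : G.Colorable (2 * (k / 2)) :=
      ⟨SimpleGraph.Coloring.mk c fun {u v} huv => hc u trivial v trivial huv⟩
    have h1 := hcol.chromaticNumber_le
    rw [hchrom] at h1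
    have h2 : k + 1 ≤ 2 * (k / 2) := by exact_mod_cast h1
    omega
  obtain ⟨m, hm, h⟩ := OC.main (r := k / 2) (by omega) hno
  exact ⟨m, hm, fun i hi => (h i hi).hasCycleLength⟩
end
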